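/- A class of finite graphs C is monadically dependent if and only if for every r ≥ 1 there exists k ∈ ℕ such that C excludes as induced subgraphs all flipped star r-crossings of order k, all flipped clique r-crossings of order k, all flipped half-graph r-crossings of order k, and the comparability grid of order k. -/

import Mathlib

set_option autoImplicit false

/-- A class of finite graphs, given as a predicate singling out, for each `n`,
the graphs on vertex set `Fin n` that belong to the class. -/
abbrev GraphClass : Type := ∀ n : ℕ, SimpleGraph (Fin n) → Prop

open FirstOrder

/-- The first-order language of graphs expanded by `k` unary color predicates:
one binary relation symbol (adjacency) and `k` unary relation symbols (the colors). -/
def colLang (k : ℕ) : FirstOrder.Language where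
  Functions := fun _ => Empty
  Relations := fun n =>
    match n with
    | 1 => Fin k
    | 2 => Unit
    | _ => Empty

/-- Interpretation of the relation symbols of `colLang k` in a graph `G`
whose vertices are colored by `c`. -/
def colRelMap {k : ℕ} {V : Type} (G : SimpleGraph V) (c : V → Fin k) :
    ∀ n : ℕ, (colLang k).Relations n → (Fin n → V) → Prop
  | 0, r, _ => Empty.elim r
  | 1, i, x => c (x 0) = i
  | 2, _, x => G.Adj (x 0) (x 1)
  | _ + 3, r, _ => Empty.elim r

/-- The `colLang k`-structure determined by a graph `G` with coloring `c`. -/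
def colStruct {k : ℕ} {V : Type} (G : SimpleGraph V) (c : V → Fin k) :
    (colLang k).Structure V where
  funMap := fun f _ => Empty.elim f
  RelMap := fun {n} => colRelMap G c n

/-- Satisfaction of a formula `φ(x, y)` at a pair of vertices of the colored graph `(G, c)`. -/
def colSat {k : ℕ} {V : Type} (G : SimpleGraph V) (c : V → Fin k)
    (φ : (colLang k).Formula (Fin 2)) (u v : V) : Prop :=
  letI := colStruct G c
  φ.Realize ![u, v]

/-- The class `C` transduces the class of all graphs: for some number `k` of colors and
some first-order formula `φ(x,y)` over the language of graphs with `k` unary predicates,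
every finite graph `H` is obtained by coloring some `G ∈ C`, taking the graph with edges
`{uv : u ≠ v and φ(u,v) ∨ φ(v,u)}`, and passing to an induced subgraph isomorphic to `H`. -/
def TransducesAllGraphs (C : GraphClass) : Prop :=
  ∃ (k : ℕ) (φ : (colLang k).Formula (Fin 2)),
    ∀ (n : ℕ) (H : SimpleGraph (Fin n)),
      ∃ (N : ℕ) (G : SimpleGraph (Fin N)), C N G ∧
        ∃ (c : Fin N → Fin k) (e : Fin n → Fin N), Function.Injective e ∧
          ∀ u v : Fin n, H.Adj u v ↔
            (e u ≠ e v ∧ (colSat G c φ (e u) (e v) ∨ colSat G c φ (e v) (e u)))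

/-- A graph class is monadically dependent if it does not transduce the class of all graphs. -/
def MonadicallyDependent (C : GraphClass) : Prop := ¬ TransducesAllGraphs C

/-- The vertex set of an `r`-crossing of order `n`: roots `a_1, …, a_n` (left summand),
path vertices `p_{i,j,t}` for `i, j ∈ [n]`, `t ∈ [r]` (middle summand), and
roots `b_1, …, b_n` (right summand). -/
abbrev CrossVert (n r : ℕ) : Type := Fin n ⊕ ((Fin n × Fin n × Fin r) ⊕ Fin n)

/-- The layer of a vertex of an `r`-crossing: the `a`-roots form layer `0`, the `t`-th
vertices of the paths form layer `t`, and the `b`-roots form layer `r + 1`. -/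
def layer {n r : ℕ} : CrossVert n r → Fin (r + 2)
  | Sum.inl _ => 0
  | Sum.inr (Sum.inl (_, _, t)) => t.succ.castSucc
  | Sum.inr (Sum.inr _) => Fin.last (r + 1)

/-- The star `r`-crossing of order `n`: the `r`-subdivision of `K_{n,n}`.  Each root `a_i`
is adjacent to the first vertices of the paths `π_{i,j}`, the paths are induced paths with
`r` vertices, and each root `b_j` is adjacent to the last vertices of the paths `π_{i,j}`. -/
def starCross (n r : ℕ) : SimpleGraph (CrossVert n r) :=
  SimpleGraph.fromRel fun u v =>
    match u, v with
    | Sum.inl i, Sum.inr (Sum.inl (i', _, t)) => i = i' ∧ (t : ℕ) = 0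
    | Sum.inr (Sum.inr j), Sum.inr (Sum.inl (_, j', t)) => j = j' ∧ (t : ℕ) + 1 = r
    | Sum.inr (Sum.inl (i, j, t)), Sum.inr (Sum.inl (i', j', t')) =>
        i = i' ∧ j = j' ∧ (t' : ℕ) = (t : ℕ) + 1
    | _, _ => False

/-- The clique `r`-crossing of order `n`: obtained from the star `r`-crossing by turning
the neighborhood of each root into a clique. -/
def cliqueCross (n r : ℕ) : SimpleGraph (CrossVert n r) :=
  SimpleGraph.fromRel fun u v =>
    match u, v with
    | Sum.inl i, Sum.inr (Sum.inl (i', _, t)) => i = i' ∧ (t : ℕ) = 0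
    | Sum.inr (Sum.inr j), Sum.inr (Sum.inl (_, j', t)) => j = j' ∧ (t : ℕ) + 1 = r
    | Sum.inr (Sum.inl (i, j, t)), Sum.inr (Sum.inl (i', j', t')) =>
        (i = i' ∧ j = j' ∧ (t' : ℕ) = (t : ℕ) + 1) ∨
        (i = i' ∧ (t : ℕ) = 0 ∧ (t' : ℕ) = 0 ∧ j ≠ j') ∨
        (j = j' ∧ (t : ℕ) + 1 = r ∧ (t' : ℕ) + 1 = r ∧ i ≠ i')
    | _, _ => False

/-- The half-graph `r`-crossing of order `n`: as the star `r`-crossing, except that `a_i`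
is adjacent to the first vertices of the paths `π_{i',j}` with `i ≤ i'`, and `b_j` is
adjacent to the last vertices of the paths `π_{i,j'}` with `j ≤ j'`. -/
def halfCross (n r : ℕ) : SimpleGraph (CrossVert n r) :=
  SimpleGraph.fromRel fun u v =>
    match u, v with
    | Sum.inl i, Sum.inr (Sum.inl (i', _, t)) => i ≤ i' ∧ (t : ℕ) = 0
    | Sum.inr (Sum.inr j), Sum.inr (Sum.inl (_, j', t)) => j ≤ j' ∧ (t : ℕ) + 1 = r
    | Sum.inr (Sum.inl (i, j, t)), Sum.inr (Sum.inl (i', j', t')) =>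
        i = i' ∧ j = j' ∧ (t' : ℕ) = (t : ℕ) + 1
    | _, _ => False

/-- `H` is obtained from the `r`-crossing `G` by a flip whose parts are the `r + 2` layers. -/
def IsLayerFlip {n r : ℕ} (G H : SimpleGraph (CrossVert n r)) : Prop :=
  ∃ F : Fin (r + 2) → Fin (r + 2) → Prop, Symmetric F ∧
    ∀ u v : CrossVert n r, u ≠ v →
      (H.Adj u v ↔ Xor' (G.Adj u v) (F (layer u) (layer v)))

/-- The comparability grid of order `n`: vertices `a_{i,j}` for `i, j ∈ [n]`, where distinct
`a_{i,j}` and `a_{i',j'}` are adjacent iff `i = i'`, or `j = j'`, or (`i < i' ⟺ j < j'`). -/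
def compGrid (n : ℕ) : SimpleGraph (Fin n × Fin n) :=
  SimpleGraph.fromRel fun u v =>
    u.1 = v.1 ∨ u.2 = v.2 ∨ (u.1 < v.1 ↔ u.2 < v.2)


open Filter

/-- Iterated nonprincipal ultrafilter over a list of coordinates. -/
noncomputable def Ql : List ℤ → Ultrafilter (ℤ → ℕ)
  | [] => pure (fun _ => 0)
  | i :: l => (hyperfilter ℕ).bind (fun y => (Ql l).map (fun x => Function.update x i y))

theorem Ql_nil (P : (ℤ → ℕ) → Prop) : (∀ᶠ x in (Ql [] : Filter (ℤ → ℕ)), P x) ↔ P (fun _ => 0) := by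
  simp only [Ql, Ultrafilter.coe_pure]
  exact Filter.eventually_pure

theorem Ultra_bind_iff {α β : Type} (f : Ultrafilter α) (m : α → Ultrafilter β) (P : β → Prop) :
    (∀ᶠ x in (Ultrafilter.bind f m : Filter β), P x) ↔
      ∀ᶠ y in (f : Filter α), ∀ᶠ x in (m y : Filter β), P x := by
  exact Filter.eventually_bind

theorem Ql_cons (i : ℤ) (l : List ℤ) (P : (ℤ → ℕ) → Prop) :
    (∀ᶠ x in (Ql (i :: l) : Filter (ℤ → ℕ)), P x) ↔
      ∀ᶠ y in (hyperfilter ℕ : Filter ℕ), ∀ᶠ x in (Ql l : Filter (ℤ → ℕ)),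
        P (Function.update x i y) := by
  rw [Ql, Ultra_bind_iff]
  exact Iff.rfl

/-- The predicate depends only on coordinates in `S`. -/
def SuppOn (S : Finset ℤ) (P : (ℤ → ℕ) → Prop) : Prop :=
  ∀ x y : ℤ → ℕ, (∀ i ∈ S, x i = y i) → (P x ↔ P y)

theorem Ql_filter (S : Finset ℤ) (l : List ℤ) : ∀ (P : (ℤ → ℕ) → Prop), SuppOn S P →
    ((∀ᶠ x in (Ql l : Filter (ℤ → ℕ)), P x) ↔
      ∀ᶠ x in (Ql (l.filter (· ∈ S)) : Filter (ℤ → ℕ)), P x) := by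
  induction l with
  | nil => intro P _; simp
  | cons i l ih =>
    intro P hP
    by_cases hi : i ∈ S
    · rw [List.filter_cons_of_pos (by simpa using hi), Ql_cons, Ql_cons]
      refine eventually_congr (Eventually.of_forall fun y => ih _ ?_)
      intro x x' h
      apply hP
      intro j hj
      by_cases hji : j = i
      · subst hji; simp
      · simp [hji, h j hj]
    · rw [List.filter_cons_of_neg (by simpa using hi), Ql_cons, ← ih P hP]
      have : ∀ y x, P (Function.update x i y) ↔ P x := by
        intro y x
        apply hP
        intro j hj
        have : j ≠ i := fun h => hi (h ▸ hj)
        simp [this]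
      simp [this]

theorem Ql_map (g : ℤ → ℤ) (hg : Function.Injective g) (l : List ℤ) :
    ∀ (P : (ℤ → ℕ) → Prop),
    ((∀ᶠ x in (Ql (l.map g) : Filter (ℤ → ℕ)), P (x ∘ g)) ↔
      ∀ᶠ x in (Ql l : Filter (ℤ → ℕ)), P x) := by
  induction l with
  | nil => intro P; rw [List.map_nil, Ql_nil, Ql_nil]; rfl
  | cons i l ih =>
    intro P
    rw [List.map_cons, Ql_cons, Ql_cons]
    refine eventually_congr (Eventually.of_forall fun y => ?_)
    rw [← ih (fun x => P (Function.update x i y))]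
    refine eventually_congr (Eventually.of_forall fun x => ?_)
    rw [Function.update_comp_eq_of_injective _ hg]

/-- The limit ultrafilter on sequences indexed by the integers. -/
noncomputable def Wu : Ultrafilter (ℤ → ℕ) :=
  (hyperfilter ℕ).bind (fun m : ℕ => Ql ((Finset.Icc (-(m : ℤ)) m).sort (· ≤ ·)))

theorem sort_filter_eq (S T : Finset ℤ) (h : S ⊆ T) :
    (T.sort (· ≤ ·)).filter (· ∈ S) = S.sort (· ≤ ·) := by
  apply List.Perm.eq_of_pairwise' (r := (· ≤ ·))
  · exact (Finset.pairwise_sort T _).filter _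
  · exact Finset.pairwise_sort S _
  · rw [List.perm_ext_iff_of_nodup ((Finset.sort_nodup T _).filter _) (Finset.sort_nodup S _)]
    intro a
    simp
    exact fun ha => h ha

theorem Wu_iff (S : Finset ℤ) (P : (ℤ → ℕ) → Prop) (hP : SuppOn S P) :
    (∀ᶠ x in (Wu : Filter (ℤ → ℕ)), P x) ↔
      ∀ᶠ x in (Ql (S.sort (· ≤ ·)) : Filter (ℤ → ℕ)), P x := by
  rw [Wu, Ultra_bind_iff]
  have hev : ∀ᶠ m : ℕ in (hyperfilter ℕ : Filter ℕ), S ⊆ Finset.Icc (-(m : ℤ)) m := by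
    apply Nat.hyperfilter_le_atTop
    rw [Filter.mem_atTop_sets]
    refine ⟨S.sup Int.natAbs, fun m hm i hi => ?_⟩
    have := (Finset.le_sup (f := Int.natAbs) hi).trans hm
    rw [Finset.mem_Icc]
    omega
  have : ∀ᶠ m : ℕ in (hyperfilter ℕ : Filter ℕ),
      ((∀ᶠ x in (Ql ((Finset.Icc (-(m : ℤ)) m).sort (· ≤ ·)) : Filter (ℤ → ℕ)), P x) ↔
      ∀ᶠ x in (Ql (S.sort (· ≤ ·)) : Filter (ℤ → ℕ)), P x) := by
    filter_upwards [hev] with m hm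
    rw [Ql_filter S _ P hP, sort_filter_eq S _ hm]
  rw [eventually_congr this]
  simp

theorem sort_image_eq (S : Finset ℤ) (g : ℤ → ℤ) (hg : StrictMono g) :
    (S.image g).sort (· ≤ ·) = (S.sort (· ≤ ·)).map g := by
  apply List.Perm.eq_of_pairwise' (r := (· ≤ ·))
  · exact Finset.pairwise_sort _ _
  · exact (Finset.pairwise_sort S _).map _ (fun a b h => hg.monotone h)
  · rw [List.perm_ext_iff_of_nodup (Finset.sort_nodup _ _)
      ((Finset.sort_nodup S _).map hg.injective)]
    intro a
    simp

theorem Wu_invariant (g : ℤ → ℤ) (hg : StrictMono g) (S : Finset ℤ) (P : (ℤ → ℕ) → Prop)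
    (hP : SuppOn S P) :
    (∀ᶠ x in (Wu : Filter (ℤ → ℕ)), P (x ∘ g)) ↔ ∀ᶠ x in (Wu : Filter (ℤ → ℕ)), P x := by
  rw [Wu_iff S P hP, Wu_iff (S.image g) (fun x => P (x ∘ g)), sort_image_eq S g hg,
    Ql_map g hg.injective]
  intro x y h
  apply hP
  intro i hi
  exact h (g i) (Finset.mem_image_of_mem g hi)

theorem Wu_const (i : ℤ) (P : ℕ → Prop) (h : ∀ᶠ n in (hyperfilter ℕ : Filter ℕ), P n) :
    ∀ᶠ x in (Wu : Filter (ℤ → ℕ)), P (x i) := by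
  rw [Wu_iff {i} (fun x => P (x i)) (by intro x y h; simp [h i])]
  rw [Finset.sort_singleton, Ql_cons]
  simpa using h

theorem Wu_ne : ∀ᶠ x in (Wu : Filter (ℤ → ℕ)), x 0 ≠ x 1 := by
  rw [Wu_iff {0, 1} (fun x => x 0 ≠ x 1) (by intro x y h; simp [h 0, h 1])]
  have : (({0, 1} : Finset ℤ).sort (· ≤ ·)) = [0, 1] := by
    apply List.Perm.eq_of_pairwise' (r := (· ≤ ·))
    · exact Finset.pairwise_sort _ _
    · simp
    · rw [List.perm_ext_iff_of_nodup (Finset.sort_nodup _ _) (by simp)]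
      intro a
      simp
  rw [this, Ql_cons]
  refine Eventually.of_forall fun y => ?_
  rw [Ql_cons]
  have h1 : ∀ᶠ z in (hyperfilter ℕ : Filter ℕ), z ≠ y := by
    apply Nat.hyperfilter_le_atTop
    exact eventually_ne_atTop y
  filter_upwards [h1] with z hz
  rw [Ql_nil]
  simpa using hz.symm

open Filter

/-- Sample space of the limit construction. -/
abbrev Om : Type := (ℤ → ℕ) × (ℤ → ℕ) × ℕ

/-- The product ultrafilter on the sample space. -/
noncomputable def WW : Ultrafilter Om :=
  Ultrafilter.bind Wu fun x => Ultrafilter.bind Wu fun x' =>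
    Ultrafilter.map (fun n => (x, x', n)) (hyperfilter ℕ)

theorem WW_iff (P : Om → Prop) : (∀ᶠ ω in (WW : Filter Om), P ω) ↔
    ∀ᶠ x in (Wu : Filter (ℤ → ℕ)), ∀ᶠ x' in (Wu : Filter (ℤ → ℕ)),
      ∀ᶠ n in (hyperfilter ℕ : Filter ℕ), P (x, x', n) := by
  rw [WW, Ultra_bind_iff]
  refine eventually_congr (Eventually.of_forall fun x => ?_)
  rw [Ultra_bind_iff]
  exact Iff.rfl

/-- `x` and `y` agree on coordinates of absolute value at most `m`. -/
def Agr (m : ℕ) (x y : ℤ → ℕ) : Prop := ∀ i : ℤ, -(m : ℤ) ≤ i → i ≤ m → x i = y i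

theorem Agr.mono {m m' : ℕ} (h : m ≤ m') {x y : ℤ → ℕ} (ha : Agr m' x y) : Agr m x y :=
  fun i h1 h2 => ha i (by omega) (by omega)

theorem WW_invariant (P : Om → Prop) (m : ℕ)
    (hP : ∀ x y x' y' n, Agr m x y → Agr m x' y' → (P (x, x', n) ↔ P (y, y', n)))
    (g g' : ℤ → ℤ) (hg : StrictMono g) (hg' : StrictMono g') :
    (∀ᶠ ω in (WW : Filter Om), P (ω.1 ∘ g, ω.2.1 ∘ g', ω.2.2)) ↔ ∀ᶠ ω in (WW : Filter Om), P ω := by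
  rw [WW_iff, WW_iff]
  dsimp only
  rw [Wu_invariant g hg (Finset.Icc (-(m : ℤ)) m) (fun x => ∀ᶠ x' in (Wu : Filter (ℤ → ℕ)),
      ∀ᶠ n in (hyperfilter ℕ : Filter ℕ), P (x, x' ∘ g', n))]
  · refine eventually_congr (Eventually.of_forall fun x => ?_)
    rw [Wu_invariant g' hg' (Finset.Icc (-(m : ℤ)) m) (fun x' =>
      ∀ᶠ n in (hyperfilter ℕ : Filter ℕ), P (x, x', n))]
    intro y z h
    refine eventually_congr (Eventually.of_forall fun n => ?_)
    apply hP
    · intro i _ _; rfl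
    · intro i h1 h2
      exact h i (Finset.mem_Icc.2 ⟨h1, h2⟩)
  · intro y z h
    refine eventually_congr (Eventually.of_forall fun x' => ?_)
    refine eventually_congr (Eventually.of_forall fun n => ?_)
    apply hP
    · intro i h1 h2
      exact h i (Finset.mem_Icc.2 ⟨h1, h2⟩)
    · intro i _ _; rfl

/-- Elements of the limit structure: finitely supported choice functions. -/
def FSupp (N : ℕ → ℕ) (m : ℕ) (F : ∀ ω : Om, Fin (N ω.2.2)) : Prop :=
  ∀ (x y x' y' : ℤ → ℕ) (n : ℕ), Agr m x y → Agr m x' y' → F (x, x', n) = F (y, y', n)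

/-- The limit vertex set. -/
def VS (N : ℕ → ℕ) : Type := {F : ∀ ω : Om, Fin (N ω.2.2) // ∃ m : ℕ, FSupp N m F}

theorem FSupp.mono {N : ℕ → ℕ} {m m' : ℕ} (h : m ≤ m') {F : ∀ ω : Om, Fin (N ω.2.2)}
    (hF : FSupp N m F) : FSupp N m' F :=
  fun x y x' y' n h1 h2 => hF x y x' y' n (h1.mono h) (h2.mono h)

/-- The shift action. -/
def act {N : ℕ → ℕ} (i j : ℤ) (F : VS N) : VS N :=
  ⟨fun ω => F.1 (fun t => ω.1 (t + i), fun t => ω.2.1 (t + j), ω.2.2), by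
    obtain ⟨m, hm⟩ := F.2
    refine ⟨m + i.natAbs + j.natAbs, fun x y x' y' n h1 h2 => ?_⟩
    apply hm
    · intro t ht1 ht2
      apply h1 <;> omega
    · intro t ht1 ht2
      apply h2 <;> omega⟩

theorem act_act {N : ℕ → ℕ} (i j i' j' : ℤ) (F : VS N) :
    act i j (act i' j' F) = act (i + i') (j + j') F := by
  apply Subtype.ext
  funext ω
  change F.1 (fun t => ω.1 (t + i' + i), fun t => ω.2.1 (t + j' + j), ω.2.2) =
    F.1 (fun t => ω.1 (t + (i + i')), fun t => ω.2.1 (t + (j + j')), ω.2.2)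
  have h1 : (fun t : ℤ => ω.1 (t + i' + i)) = fun t => ω.1 (t + (i + i')) := by
    funext t; ring_nf
  have h2 : (fun t : ℤ => ω.2.1 (t + j' + j)) = fun t => ω.2.1 (t + (j + j')) := by
    funext t; ring_nf
  rw [h1, h2]

theorem act_zero {N : ℕ → ℕ} (F : VS N) : act 0 0 F = F := by
  apply Subtype.ext
  funext ω
  obtain ⟨m, hm⟩ := F.2
  obtain ⟨x, x', n⟩ := ω
  refine hm _ _ _ _ _ ?_ ?_
  · intro t _ _; simp
  · intro t _ _; simp

section limit

variable {k : ℕ} {N : ℕ → ℕ} (G : ∀ n, SimpleGraph (Fin (N n))) (c : ∀ n, Fin (N n) → Fin k)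

/-- Limit adjacency. -/
def Es (F H : VS N) : Prop := ∀ᶠ ω in (WW : Filter Om), (G ω.2.2).Adj (F.1 ω) (H.1 ω)

/-- Limit equality. -/
def Qs (F H : VS N) : Prop := ∀ᶠ ω in (WW : Filter Om), F.1 ω = H.1 ω

/-- Limit color. -/
def Cs (F : VS N) (i : Fin k) : Prop := ∀ᶠ ω in (WW : Filter Om), c ω.2.2 (F.1 ω) = i

/-- Limit of satisfaction. -/
def Sats {n : ℕ} (θ : (colLang k).BoundedFormula (Fin 2) n) (v : Fin 2 → VS N)
    (xs : Fin n → VS N) : Prop :=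
  ∀ᶠ ω in (WW : Filter Om),
    @FirstOrder.Language.BoundedFormula.Realize (colLang k) (Fin (N ω.2.2))
      (colStruct (G ω.2.2) (c ω.2.2)) (Fin 2) n θ (fun i => (v i).1 ω) (fun i => (xs i).1 ω)

theorem Es_comm (F H : VS N) : Es G F H ↔ Es G H F :=
  eventually_congr (Eventually.of_forall fun _ => SimpleGraph.adj_comm _ _ _)

theorem Es_irrefl (F : VS N) : ¬ Es G F F := by
  intro h
  obtain ⟨ω, hω⟩ := h.exists
  exact (G ω.2.2).irrefl hω

theorem Qs_refl (F : VS N) : Qs F F := Eventually.of_forall fun _ => rfl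

theorem Qs.symm {F H : VS N} (h : Qs F H) : Qs H F := h.mono fun _ h => h.symm

theorem Qs.trans {F H K : VS N} (h : Qs F H) (h' : Qs H K) : Qs F K := by
  filter_upwards [h, h'] with ω a b using a.trans b

theorem Qs.Es_left {F F' H : VS N} (h : Qs F F') : Es G F H ↔ Es G F' H := by
  apply eventually_congr
  filter_upwards [h] with ω a
  rw [a]

theorem act_invariant_gen (i j : ℤ) (F H : VS N) (R : ∀ n, Fin (N n) → Fin (N n) → Prop) :
    (∀ᶠ ω in (WW : Filter Om), R ω.2.2 ((act i j F).1 ω) ((act i j H).1 ω)) ↔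
    (∀ᶠ ω in (WW : Filter Om), R ω.2.2 (F.1 ω) (H.1 ω)) := by
  obtain ⟨m, hm⟩ := F.2
  obtain ⟨m', hm'⟩ := H.2
  refine WW_invariant (fun ω => R ω.2.2 (F.1 ω) (H.1 ω)) (m + m') ?_ (fun t => t + i)
    (fun t => t + j) (fun a b h => by simpa using h) (fun a b h => by simpa using h)
  intro x y x' y' n h1 h2
  have e1 := hm.mono (Nat.le_add_right m m') x y x' y' n h1 h2
  have e2 := hm'.mono (Nat.le_add_left m' m) x y x' y' n h1 h2
  dsimp only
  rw [e1, e2]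

theorem act_Es (i j : ℤ) (F H : VS N) : Es G (act i j F) (act i j H) ↔ Es G F H :=
  act_invariant_gen i j F H (fun n => (G n).Adj)

theorem act_Qs (i j : ℤ) (F H : VS N) : Qs (act i j F) (act i j H) ↔ Qs F H :=
  act_invariant_gen i j F H (fun _ => Eq)

theorem act_Cs (i j : ℤ) (F : VS N) (a : Fin k) : Cs c (act i j F) a ↔ Cs c F a :=
  act_invariant_gen i j F F (fun n x _ => c n x = a)

/-- Los for the universal quantifier. -/
theorem Sats_all (hN : ∀ n, 0 < N n) {n : ℕ} (θ : (colLang k).BoundedFormula (Fin 2) (n + 1))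
    (v : Fin 2 → VS N) (xs : Fin n → VS N) :
    Sats G c θ.all v xs ↔ ∀ F : VS N, Sats G c θ v (Fin.snoc xs F) := by
  have snoc_eq : ∀ (F : VS N) (ω : Om),
      (fun i => ((Fin.snoc xs F : Fin (n + 1) → VS N) i).1 ω) =
      (Fin.snoc (fun i => (xs i).1 ω) (F.1 ω) : Fin (n + 1) → Fin (N ω.2.2)) := by
    intro F ω
    funext i
    refine Fin.lastCases ?_ (fun i => ?_) i
    · simp
    · simp
  constructor
  · intro h F
    refine h.mono fun ω hω => ?_
    rw [snoc_eq]
    exact hω (F.1 ω)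
  · intro h
    classical
    let T : ∀ n' : ℕ, (Fin 2 → Fin (N n')) → (Fin n → Fin (N n')) → Fin (N n') → Prop :=
      fun n' v' xs' a => @FirstOrder.Language.BoundedFormula.Realize (colLang k) (Fin (N n'))
        (colStruct (G n') (c n')) (Fin 2) (n + 1) θ v' (Fin.snoc xs' a)
    let ch : ∀ n' : ℕ, (Fin 2 → Fin (N n')) → (Fin n → Fin (N n')) → Fin (N n') :=
      fun n' v' xs' => if hh : ∃ a, ¬ T n' v' xs' a then hh.choose else ⟨0, hN n'⟩
    have hch : ∀ n' v' xs', T n' v' xs' (ch n' v' xs') → ∀ a, T n' v' xs' a := by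
      intro n' v' xs' ht a
      by_contra hcon
      have hh : ∃ a, ¬ T n' v' xs' a := ⟨a, hcon⟩
      have : ch n' v' xs' = hh.choose := by simp only [ch]; rw [dif_pos hh]
      rw [this] at ht
      exact hh.choose_spec ht
    choose mv hmv using fun i => (v i).2
    choose mx hmx using fun i => (xs i).2
    let F : VS N := ⟨fun ω => ch ω.2.2 (fun i => (v i).1 ω) (fun i => (xs i).1 ω), by
      refine ⟨(∑ i, mv i) + ∑ i, mx i, fun x y x' y' n' h1 h2 => ?_⟩
      dsimp only
      congr 1
      · funext i
        refine (hmv i).mono ?_ x y x' y' n' h1 h2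
        have := Finset.single_le_sum (f := mv) (fun _ _ => Nat.zero_le _) (Finset.mem_univ i)
        omega
      · funext i
        refine (hmx i).mono ?_ x y x' y' n' h1 h2
        have := Finset.single_le_sum (f := mx) (fun _ _ => Nat.zero_le _) (Finset.mem_univ i)
        omega⟩
    refine (h F).mono fun ω hω => ?_
    rw [snoc_eq] at hω
    exact hch _ _ _ hω

theorem term_var {α : Type} (t : (colLang k).Term α) : ∃ i, t = FirstOrder.Language.Term.var i := by
  cases t with
  | var i => exact ⟨i, rfl⟩
  | func f _ => exact Empty.elim f

theorem Sats_auto (hN : ∀ n, 0 < N n) (f : VS N → VS N) (hs : Function.Surjective f)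
    (hE : ∀ F H, Es G (f F) (f H) ↔ Es G F H) (hQ : ∀ F H, Qs (f F) (f H) ↔ Qs F H)
    (hC : ∀ F a, Cs c (f F) a ↔ Cs c F a) {n : ℕ}
    (θ : (colLang k).BoundedFormula (Fin 2) n) :
    ∀ (v : Fin 2 → VS N) (xs : Fin n → VS N),
    Sats G c θ (f ∘ v) (f ∘ xs) ↔ Sats G c θ v xs := by
  have hel : ∀ {n : ℕ} (v : Fin 2 → VS N) (xs : Fin n → VS N) (i : Fin 2 ⊕ Fin n) (ω : Om),
      (Sum.elim (fun i => (v i).1 ω) (fun i => (xs i).1 ω) i : Fin (N ω.2.2)) =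
        (Sum.elim v xs i).1 ω := by
    intro n v xs i ω
    cases i <;> rfl
  have hel2 : ∀ {n : ℕ} (v : Fin 2 → VS N) (xs : Fin n → VS N) (i : Fin 2 ⊕ Fin n),
      Sum.elim (f ∘ v) (f ∘ xs) i = f (Sum.elim v xs i) := by
    intro n v xs i
    cases i <;> rfl
  induction θ with
  | falsum => intro v xs; exact Iff.rfl
  | equal t₁ t₂ =>
    intro v xs
    obtain ⟨i, rfl⟩ := term_var t₁
    obtain ⟨j, rfl⟩ := term_var t₂
    have key : ∀ v xs, Sats G c (FirstOrder.Language.BoundedFormula.equal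
        (FirstOrder.Language.Term.var i) (FirstOrder.Language.Term.var j)) v xs ↔
        Qs (Sum.elim v xs i) (Sum.elim v xs j) := by
      intro v xs
      refine eventually_congr (Eventually.of_forall fun ω => ?_)
      rw [← hel, ← hel]
      exact Iff.rfl
    rw [key, key, hel2, hel2]
    exact hQ _ _
  | @rel n l R ts =>
    intro v xs
    have hts : ∀ a, ∃ i, ts a = FirstOrder.Language.Term.var i := fun a => term_var _
    choose ix hix using hts
    obtain rfl : ts = fun a => FirstOrder.Language.Term.var (ix a) := funext hix
    match l, R, ix with
    | 1, R, ix =>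
      have key : ∀ v xs, Sats G c (FirstOrder.Language.BoundedFormula.rel R
          (fun a => FirstOrder.Language.Term.var (ix a))) v xs ↔
          Cs c (Sum.elim v xs (ix 0)) R := by
        intro v xs
        refine eventually_congr (Eventually.of_forall fun ω => ?_)
        rw [← hel]
        exact Iff.rfl
      rw [key, key, hel2]
      exact hC _ _
    | 2, R, ix =>
      have key : ∀ v xs, Sats G c (FirstOrder.Language.BoundedFormula.rel R
          (fun a => FirstOrder.Language.Term.var (ix a))) v xs ↔
          Es G (Sum.elim v xs (ix 0)) (Sum.elim v xs (ix 1)) := by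
        intro v xs
        refine eventually_congr (Eventually.of_forall fun ω => ?_)
        rw [← hel, ← hel]
        exact Iff.rfl
      rw [key, key, hel2, hel2]
      exact hE _ _
  | imp φ ψ ih1 ih2 =>
    intro v xs
    have key : ∀ v xs, Sats G c (φ.imp ψ) v xs ↔ (Sats G c φ v xs → Sats G c ψ v xs) :=
      fun v xs => Ultrafilter.eventually_imp
    rw [key, key, ih1, ih2]
  | all φ ih =>
    intro v xs
    rw [Sats_all G c hN, Sats_all G c hN]
    have hsn : ∀ F, (Fin.snoc (f ∘ xs) (f F) : Fin _ → VS N) = f ∘ (Fin.snoc xs F : Fin _ → VS N) := by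
      intro F
      funext i
      refine Fin.lastCases ?_ (fun i => ?_) i
      · simp
      · simp
    constructor
    · intro h F
      rw [← ih, ← hsn]
      exact h (f F)
    · intro h F
      obtain ⟨F, rfl⟩ := hs F
      rw [hsn, ih]
      exact h F

end limit

open Filter

/-- `i` is zero or of large absolute value. -/
def Far (m : ℕ) (i : ℤ) : Prop := i = 0 ∨ 2 * (m : ℤ) + 1 ≤ i ∨ i ≤ -(2 * (m : ℤ) + 1)

theorem gap_map (m : ℕ) (i : ℤ) (hi : Far m i) : ∃ g : ℤ → ℤ, StrictMono g ∧
    (∀ t, -(m : ℤ) ≤ t → t ≤ m → g t = t) ∧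
    (∀ t, -(m : ℤ) ≤ t → t ≤ m → g (t + (SignType.sign i : ℤ) * (2 * m + 1)) = t + i) := by
  rcases hi with rfl | hi | hi
  · exact ⟨id, strictMono_id, by simp, by simp⟩
  · refine ⟨fun t => if t ≤ m then t else t + (i - (2 * m + 1)), ?_, ?_, ?_⟩
    · intro a b hab
      dsimp only
      split_ifs <;> omega
    · intro t h1 h2
      simp [h2]
    · intro t h1 h2
      rw [sign_pos (by omega)]
      simp only [SignType.coe_one, one_mul]
      rw [if_neg (by omega)]
      ring
  · refine ⟨fun t => if -(m : ℤ) ≤ t then t else t + (i + (2 * m + 1)), ?_, ?_, ?_⟩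
    · intro a b hab
      dsimp only
      split_ifs <;> omega
    · intro t h1 h2
      simp [h1]
    · intro t h1 h2
      rw [sign_neg (by omega)]
      have e : t + ((-1 : SignType) : ℤ) * (2 * m + 1) = t - (2 * m + 1) := by
        rw [SignType.coe_neg_one]; ring
      rw [e]
      simp only
      rw [if_neg (by omega)]
      ring

section limit

variable {N : ℕ → ℕ} (G : ∀ n, SimpleGraph (Fin (N n)))

theorem Es_std (p q : VS N) (m : ℕ) (hp : FSupp N m p.1) (hq : FSupp N m q.1) (i j : ℤ)
    (hi : Far m i) (hj : Far m j) :
    Es G (act i j p) q ↔ Es G (act ((SignType.sign i : ℤ) * (2 * m + 1))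
      ((SignType.sign j : ℤ) * (2 * m + 1)) p) q := by
  obtain ⟨g, hg, hg1, hg2⟩ := gap_map m i hi
  obtain ⟨g', hg', hg1', hg2'⟩ := gap_map m j hj
  set i0 := (SignType.sign i : ℤ) * (2 * m + 1)
  set j0 := (SignType.sign j : ℤ) * (2 * m + 1)
  obtain ⟨m', hm'⟩ := (act i0 j0 p).2
  have := WW_invariant (fun ω => (G ω.2.2).Adj ((act i0 j0 p).1 ω) (q.1 ω)) (m' + m) (by
    intro x y x' y' n h1 h2
    have e1 := hm'.mono (Nat.le_add_right m' m) x y x' y' n h1 h2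
    have e2 := hq.mono (Nat.le_add_left m m') x y x' y' n h1 h2
    dsimp only
    rw [e1, e2]) g g' hg hg'
  unfold Es
  rw [← this]
  refine eventually_congr (Eventually.of_forall fun ω => ?_)
  obtain ⟨x, x', n⟩ := ω
  dsimp only
  have e1 : (act i j p).1 (x, x', n) = (act i0 j0 p).1 (x ∘ g, x' ∘ g', n) := by
    refine hp _ _ _ _ _ ?_ ?_
    · intro t h1 h2
      change x (t + i) = x (g (t + i0))
      rw [hg2 t h1 h2]
    · intro t h1 h2
      change x' (t + j) = x' (g' (t + j0))
      rw [hg2' t h1 h2]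
  have e2 : q.1 (x, x', n) = q.1 (x ∘ g, x' ∘ g', n) := by
    refine hq _ _ _ _ _ ?_ ?_
    · intro t h1 h2
      change x t = x (g t)
      rw [hg1 t h1 h2]
    · intro t h1 h2
      change x' t = x' (g' t)
      rw [hg1' t h1 h2]
  rw [e1, e2]

/-- Array relation of the limit structure. -/
def Ev (p q : VS N) (σ τ : SignType) : Prop :=
  ∀ᶠ M : ℕ in atTop, Es G (act ((σ : ℤ) * M) ((τ : ℤ) * M) p) q

theorem Far.mul (m M : ℕ) (h : 2 * m + 1 ≤ M) (z : ℤ) : Far m (z * M) := by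
  rcases lt_trichotomy z 0 with hz | rfl | hz
  · right; right
    have : (2 * (m : ℤ) + 1) ≤ M := by exact_mod_cast h
    nlinarith
  · left; simp
  · right; left
    have : (2 * (m : ℤ) + 1) ≤ M := by exact_mod_cast h
    nlinarith

theorem sign_mul_nat (z : ℤ) (M : ℕ) (hM : 0 < M) : SignType.sign (z * M) = SignType.sign z := by
  rw [sign_mul, sign_pos (by exact_mod_cast hM : (0 : ℤ) < M), mul_one]

theorem sign_coe_int (σ : SignType) : SignType.sign (σ : ℤ) = σ := by
  cases σ <;> rfl

theorem Ev_far (p q : VS N) : ∃ m : ℕ, ∀ i j, Far m i → Far m j →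
    (Ev G p q (SignType.sign i) (SignType.sign j) ↔ Es G (act i j p) q) := by
  obtain ⟨m1, h1⟩ := p.2
  obtain ⟨m2, h2⟩ := q.2
  have hp := h1.mono (Nat.le_add_right m1 m2)
  have hq := h2.mono (Nat.le_add_left m2 m1)
  set m := m1 + m2
  refine ⟨m, fun i j hi hj => ?_⟩
  rw [Es_std G p q m hp hq i j hi hj]
  have : ∀ᶠ M : ℕ in atTop, (Es G (act ((SignType.sign i : ℤ) * M) ((SignType.sign j : ℤ) * M) p) q ↔
     Es G (act ((SignType.sign i : ℤ) * (2 * m + 1)) ((SignType.sign j : ℤ) * (2 * m + 1)) p) q) := by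
    filter_upwards [eventually_ge_atTop (2 * m + 1)] with M hM
    rw [Es_std G p q m hp hq _ _ (Far.mul m M hM _) (Far.mul m M hM _), sign_mul_nat _ _ (by omega),
      sign_mul_nat _ _ (by omega), sign_coe_int, sign_coe_int]
  unfold Ev
  rw [eventually_congr this]
  exact eventually_const

theorem Ev_zero (p q : VS N) : Ev G p q 0 0 ↔ Es G p q := by
  obtain ⟨m, hm⟩ := Ev_far G p q
  have := hm 0 0 (Or.inl rfl) (Or.inl rfl)
  rw [act_zero] at this
  simpa using this

theorem Ev_eventually (p q : VS N) (σ τ : SignType) : ∀ᶠ M : ℕ in atTop,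
    (Ev G p q σ τ ↔ Es G (act ((σ : ℤ) * M) ((τ : ℤ) * M) p) q) := by
  obtain ⟨m, hm⟩ := Ev_far G p q
  filter_upwards [eventually_ge_atTop (2 * m + 1)] with M hM
  rw [← hm _ _ (Far.mul m M hM _) (Far.mul m M hM _), sign_mul_nat _ _ (by omega),
      sign_mul_nat _ _ (by omega), sign_coe_int, sign_coe_int]

theorem Es_shift (i j : ℤ) (p q : VS N) : Es G (act i j p) q ↔ Es G p (act (-i) (-j) q) := by
  rw [← act_Es G (-i) (-j) (act i j p) q, act_act]
  simp [act_zero]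

theorem Ev_symm (p q : VS N) (σ τ : SignType) : Ev G p q σ τ ↔ Ev G q p (-σ) (-τ) := by
  refine eventually_congr (Eventually.of_forall fun M => ?_)
  rw [Es_shift, Es_comm]
  have h1 : (((-σ : SignType) : ℤ)) = -(σ : ℤ) := by cases σ <;> rfl
  have h2 : (((-τ : SignType) : ℤ)) = -(τ : ℤ) := by cases τ <;> rfl
  rw [h1, h2, neg_mul, neg_mul]

theorem Ev_act (i j : ℤ) (p q : VS N) (σ τ : SignType) :
    Ev G (act i j p) (act i j q) σ τ ↔ Ev G p q σ τ := by
  refine eventually_congr (Eventually.of_forall fun M => ?_)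
  rw [act_act, add_comm, add_comm _ j, ← act_act, act_Es]

theorem Ev_Qs_left {p p' : VS N} (h : Qs p p') (q : VS N) (σ τ : SignType) :
    Ev G p q σ τ ↔ Ev G p' q σ τ := by
  refine eventually_congr (Eventually.of_forall fun M => ?_)
  exact Qs.Es_left G ((act_Qs _ _ _ _).2 h)

theorem Ev_Qs_right {q q' : VS N} (h : Qs q q') (p : VS N) (σ τ : SignType) :
    Ev G p q σ τ ↔ Ev G p q' σ τ := by
  rw [Ev_symm, Ev_Qs_left G h, ← Ev_symm]

/-- Realization of finite pieces of the array. -/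
theorem Ev_realize {ι : Type} [Finite ι] (f : ι → VS N × ℤ × ℤ) :
    ∃ (n : ℕ) (h : ι → Fin (N n)), ∀ u v, (G n).Adj (h u) (h v) ↔
      Ev G (f u).1 (f v).1 (SignType.sign ((f u).2.1 - (f v).2.1))
        (SignType.sign ((f u).2.2 - (f v).2.2)) := by
  choose m hm using fun u v => Ev_far G (f u).1 (f v).1
  have hev : ∀ᶠ M : ℕ in atTop, ∀ u v, 2 * m u v + 1 ≤ M :=
    eventually_all.2 fun u => eventually_all.2 fun v => eventually_ge_atTop _
  obtain ⟨M, hM⟩ := hev.exists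
  let X : ι → VS N := fun u => act ((f u).2.1 * M) ((f u).2.2 * M) (f u).1
  have hX : ∀ u v, (Ev G (f u).1 (f v).1 (SignType.sign ((f u).2.1 - (f v).2.1))
        (SignType.sign ((f u).2.2 - (f v).2.2)) ↔ Es G (X u) (X v)) := by
    intro u v
    have h0 := hM u v
    have := hm u v (((f u).2.1 - (f v).2.1) * M) (((f u).2.2 - (f v).2.2) * M)
      (Far.mul _ _ h0 _) (Far.mul _ _ h0 _)
    rw [sign_mul_nat _ _ (by omega), sign_mul_nat _ _ (by omega)] at this
    rw [this]
    simp only [X]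
    rw [← act_Es G ((f v).2.1 * M) ((f v).2.2 * M) (act _ _ (f u).1) (f v).1, act_act]
    have e : ∀ a b : ℤ, b * M + (a - b) * M = a * M := fun a b => by ring
    rw [e, e]
  have : ∀ᶠ ω in (WW : Filter Om), ∀ u v, (G ω.2.2).Adj ((X u).1 ω) ((X v).1 ω) ↔ Es G (X u) (X v) := by
    refine eventually_all.2 fun u => eventually_all.2 fun v => ?_
    by_cases h : Es G (X u) (X v)
    · refine Eventually.mono h fun ω hω => ?_
      simp [h, hω]
    · have h' : ∀ᶠ ω in (WW : Filter Om), ¬ (G ω.2.2).Adj ((X u).1 ω) ((X v).1 ω) :=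
        Ultrafilter.eventually_not.2 h
      refine h'.mono fun ω hω => ?_
      simp [h, hω]
  obtain ⟨ω, hω⟩ := this.exists
  refine ⟨ω.2.2, fun u => (X u).1 ω, fun u v => ?_⟩
  rw [hX, hω]

end limit

open Filter Relation

section limit

variable {k : ℕ} {N : ℕ → ℕ} (G : ∀ n, SimpleGraph (Fin (N n))) (c : ∀ n, Fin (N n) → Fin k)

/-- Reachability from `w` in direction `(d1, d2)`. -/
inductive Rch (d1 d2 : SignType) (w : VS N) : VS N → Prop
  | base : Rch d1 d2 w w
  | fwd (x : VS N) : Rch d1 d2 w x → Rch d1 d2 w (act (d1 : ℤ) (d2 : ℤ) x)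
  | bwd (x : VS N) : Rch d1 d2 w x → Rch d1 d2 w (act (-(d1 : ℤ)) (-(d2 : ℤ)) x)
  | eqv (x y : VS N) : Rch d1 d2 w x → Qs x y → Rch d1 d2 w y
  | step (x y : VS N) : Rch d1 d2 w x →
      ¬ (Es G (act (d1 : ℤ) (d2 : ℤ) x) y ↔ Es G x y) → Rch d1 d2 w y

theorem Rch_auto (hN : ∀ n, 0 < N n) (d1 d2 : SignType) (w s : VS N) (hs : ¬ Rch G d1 d2 w s)
    (θ : (colLang k).BoundedFormula (Fin 2) 0) :
    (Sats G c θ ![act (d1 : ℤ) (d2 : ℤ) w, s] default ↔ Sats G c θ ![w, s] default) ∧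
    (Sats G c θ ![s, act (d1 : ℤ) (d2 : ℤ) w] default ↔ Sats G c θ ![s, w] default) := by
  classical
  let f : VS N → VS N := fun x => if Rch G d1 d2 w x then act (d1 : ℤ) (d2 : ℤ) x else x
  have fpos : ∀ x, Rch G d1 d2 w x → f x = act (d1 : ℤ) (d2 : ℤ) x := fun x h => if_pos h
  have fneg : ∀ x, ¬ Rch G d1 d2 w x → f x = x := fun x h => if_neg h
  have hsurj : Function.Surjective f := by
    intro x
    by_cases hx : Rch G d1 d2 w x
    · refine ⟨act (-(d1 : ℤ)) (-(d2 : ℤ)) x, ?_⟩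
      rw [fpos _ (Rch.bwd x hx), act_act]
      simp [act_zero]
    · exact ⟨x, fneg x hx⟩
  have mixE : ∀ x y, Rch G d1 d2 w x → ¬ Rch G d1 d2 w y →
      (Es G (act (d1 : ℤ) (d2 : ℤ) x) y ↔ Es G x y) := by
    intro x y hx hy
    by_contra h
    exact hy (Rch.step x y hx h)
  have hE : ∀ F H, Es G (f F) (f H) ↔ Es G F H := by
    intro x y
    by_cases hx : Rch G d1 d2 w x <;> by_cases hy : Rch G d1 d2 w y
    · rw [fpos x hx, fpos y hy, act_Es]
    · rw [fpos x hx, fneg y hy]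
      exact mixE x y hx hy
    · rw [fneg x hx, fpos y hy, Es_comm, Es_comm G x y]
      exact mixE y x hy hx
    · rw [fneg x hx, fneg y hy]
  have mixQ : ∀ x y, Rch G d1 d2 w x → ¬ Rch G d1 d2 w y →
      (Qs (act (d1 : ℤ) (d2 : ℤ) x) y ↔ Qs x y) := by
    intro x y hx hy
    constructor
    · intro h; exact absurd (Rch.eqv _ _ (Rch.fwd _ hx) h) hy
    · intro h; exact absurd (Rch.eqv _ _ hx h) hy
  have hQ : ∀ F H, Qs (f F) (f H) ↔ Qs F H := by
    intro x y
    by_cases hx : Rch G d1 d2 w x <;> by_cases hy : Rch G d1 d2 w y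
    · rw [fpos x hx, fpos y hy, act_Qs]
    · rw [fpos x hx, fneg y hy]
      exact mixQ x y hx hy
    · rw [fneg x hx, fpos y hy]
      have := mixQ y x hy hx
      exact ⟨fun h => (this.1 h.symm).symm, fun h => (this.2 h.symm).symm⟩
    · rw [fneg x hx, fneg y hy]
  have hC : ∀ F a, Cs c (f F) a ↔ Cs c F a := by
    intro x a
    by_cases hx : Rch G d1 d2 w x
    · rw [fpos x hx, act_Cs]
    · rw [fneg x hx]
  have main := Sats_auto G c hN f hsurj hE hQ hC θ
  have fw : f w = act (d1 : ℤ) (d2 : ℤ) w := fpos w Rch.base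
  have fs : f s = s := fneg s hs
  have dd : ∀ (g : Fin 0 → VS N), g = default := fun g => Subsingleton.elim _ _
  constructor
  · have := main ![w, s] default
    have e : f ∘ ![w, s] = ![act (d1 : ℤ) (d2 : ℤ) w, s] := by
      funext i; fin_cases i
      · exact fw
      · exact fs
    rwa [e, dd (f ∘ _)] at this
  · have := main ![s, w] default
    have e : f ∘ ![s, w] = ![s, act (d1 : ℤ) (d2 : ℤ) w] := by
      funext i; fin_cases i
      · exact fs
      · exact fw
    rwa [e, dd (f ∘ _)] at this

/-- Strict link in a direction. -/
def SLk (d1 d2 : SignType) (x y : VS N) : Prop :=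
  ∃ σ : SignType, ¬ (Ev G x y (σ * d1) (σ * d2) ↔ Ev G x y 0 0)

theorem SLk_step (d1 d2 : SignType) (x y : VS N)
    (h : ¬ (Es G (act (d1 : ℤ) (d2 : ℤ) x) y ↔ Es G x y)) :
    SLk G d1 d2 x y ∨ SLk G d1 d2 (act (d1 : ℤ) (d2 : ℤ) x) y := by
  by_contra hc
  push Not at hc
  obtain ⟨h1, h2⟩ := hc
  apply h
  have a1 : Ev G x y d1 d2 ↔ Ev G x y 0 0 := by
    by_contra h'
    exact h1 ⟨1, by simpa using h'⟩
  have a2 : Ev G (act (d1 : ℤ) (d2 : ℤ) x) y d1 d2 ↔ Ev G (act (d1 : ℤ) (d2 : ℤ) x) y 0 0 := by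
    by_contra h'
    exact h2 ⟨1, by simpa using h'⟩
  rw [Ev_zero] at a1 a2
  rw [← a1, ← a2]
  have e1 := (Filter.tendsto_add_atTop_nat 1).eventually (Ev_eventually G x y d1 d2)
  have e2 := Ev_eventually G (act (d1 : ℤ) (d2 : ℤ) x) y d1 d2
  obtain ⟨M, h3, h4⟩ := (e1.and e2).exists
  rw [h3, h4, act_act]
  push_cast
  have : ∀ z : ℤ, z * M + z = z * (M + 1) := fun z => by ring
  rw [this, this]

theorem SLk_act (d1 d2 : SignType) (i j : ℤ) (x y : VS N) (h : SLk G d1 d2 x y) :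
    SLk G d1 d2 (act i j x) (act i j y) := by
  obtain ⟨σ, h⟩ := h
  exact ⟨σ, by rwa [Ev_act, Ev_act]⟩

theorem Rch_chain (d1 d2 : SignType) (w s : VS N) (h : Rch G d1 d2 w s) :
    ∃ (j : ℤ) (z : VS N), Qs (act (j * d1) (j * d2) w) z ∧ ReflTransGen (SLk G d1 d2) z s := by
  have shift : ∀ (e : ℤ) (x : VS N), (∃ (j : ℤ) (z : VS N), Qs (act (j * d1) (j * d2) w) z ∧
      ReflTransGen (SLk G d1 d2) z x) → ∃ (j : ℤ) (z : VS N), Qs (act (j * d1) (j * d2) w) z ∧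
      ReflTransGen (SLk G d1 d2) z (act (e * d1) (e * d2) x) := by
    rintro e x ⟨j, z, h1, h2⟩
    refine ⟨e + j, act (e * d1) (e * d2) z, ?_, ?_⟩
    · have := (act_Qs (e * d1) (e * d2) _ _).2 h1
      rwa [act_act, ← add_mul, ← add_mul] at this
    · exact ReflTransGen.lift (act (e * d1) (e * d2)) (fun a b => SLk_act G d1 d2 _ _ a b) _ _ h2
  induction h with
  | base => exact ⟨0, w, by simpa [act_zero] using Qs_refl w, ReflTransGen.refl⟩
  | fwd x _ ih => simpa using shift 1 x ih
  | bwd x _ ih => simpa using shift (-1) x ih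
  | eqv x y _ hxy ih =>
    obtain ⟨j, z, h1, h2⟩ := ih
    rcases ReflTransGen.cases_tail h2 with rfl | ⟨u, hu, σ, hσ⟩
    · exact ⟨j, y, h1.trans hxy, ReflTransGen.refl⟩
    · refine ⟨j, z, h1, hu.tail ⟨σ, ?_⟩⟩
      rwa [← Ev_Qs_right G hxy, ← Ev_Qs_right G hxy]
  | step x y _ hxy ih =>
    rcases SLk_step G d1 d2 x y hxy with h | h
    · obtain ⟨j, z, h1, h2⟩ := ih
      exact ⟨j, z, h1, h2.tail h⟩
    · have := shift 1 x ih
      simp only [one_mul] at this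
      obtain ⟨j, z, h1, h2⟩ := this
      exact ⟨j, z, h1, h2.tail h⟩

end limit

section arr

variable {P : Type} (E : P → P → SignType → SignType → Prop)

/-- Nonconstant pair of nodes. -/
def Linked (p q : P) : Prop := ∃ σ τ σ' τ', E p q σ τ ∧ ¬ E p q σ' τ'

/-- `q` distinguishes the first coordinate of `p`. -/
def KR (p : P) : Prop := ∃ q τ, τ ≠ 0 ∧ ∃ σ σ', E q p σ τ ∧ ¬ E q p σ' τ

/-- `q` distinguishes the second coordinate of `p`. -/
def AR (p : P) : Prop := ∃ q σ, σ ≠ 0 ∧ ∃ τ τ', E q p σ τ ∧ ¬ E q p σ τ'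

end arr

section concrete

/-- The vertex type of the test graph. -/
abbrev TV (n : ℕ) : Type := Fin (n + 1) ⊕ Fin (n + 1) ⊕ (Fin (n + 1) × Fin (n + 1))

/-- The test graph: the 1-subdivision of a complete bipartite graph. -/
def testG (n : ℕ) : SimpleGraph (TV n) :=
  SimpleGraph.fromRel fun u v =>
    match u, v with
    | Sum.inl i, Sum.inr (Sum.inr (i', _)) => i = i'
    | Sum.inr (Sum.inl j), Sum.inr (Sum.inr (_, j')) => j = j'
    | _, _ => False

theorem testG_left (n : ℕ) (i i' j' : Fin (n + 1)) :
    (testG n).Adj (Sum.inl i) (Sum.inr (Sum.inr (i', j'))) ↔ i = i' := by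
  simp [testG, SimpleGraph.fromRel_adj]

theorem testG_right (n : ℕ) (j i' j' : Fin (n + 1)) :
    (testG n).Adj (Sum.inr (Sum.inl j)) (Sum.inr (Sum.inr (i', j'))) ↔ j = j' := by
  simp [testG, SimpleGraph.fromRel_adj]

theorem trans_test (C : GraphClass) (hC : TransducesAllGraphs C) :
    ∃ (k : ℕ) (φ : (colLang k).Formula (Fin 2)) (N : ℕ → ℕ) (G : ∀ n, SimpleGraph (Fin (N n)))
      (c : ∀ n, Fin (N n) → Fin k) (e : ∀ n, TV n → Fin (N n)),
      (∀ n, C (N n) (G n)) ∧ ∀ n (u v : TV n), u ≠ v →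
        ((testG n).Adj u v ↔ (colSat (G n) (c n) φ (e n u) (e n v) ∨
          colSat (G n) (c n) φ (e n v) (e n u))) := by
  obtain ⟨k, φ, h⟩ := hC
  have : ∀ n, ∃ (N : ℕ) (G : SimpleGraph (Fin N)) (c : Fin N → Fin k) (e : TV n → Fin N), C N G ∧
      ∀ (u v : TV n), u ≠ v →
        ((testG n).Adj u v ↔ (colSat G c φ (e u) (e v) ∨ colSat G c φ (e v) (e u))) := by
    intro n
    let eq := Fintype.equivFin (TV n)
    obtain ⟨N, G, hG, c, e, he, hh⟩ := h _ ((testG n).map eq.toEmbedding)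
    refine ⟨N, G, c, fun u => e (eq u), hG, fun u v huv => ?_⟩
    have h1 := hh (eq u) (eq v)
    have h2 : ((testG n).map eq.toEmbedding).Adj (eq u) (eq v) ↔ (testG n).Adj u v :=
      SimpleGraph.map_adj_apply (f := eq.toEmbedding)
    rw [h2] at h1
    rw [h1]
    have : e (eq u) ≠ e (eq v) := fun h => huv (eq.injective (he h))
    simp [this]
  choose N G c e h1 h2 using this
  exact ⟨k, φ, N, G, c, e, h1, h2⟩

/-- The data extracted from a class which transduces all graphs. -/
theorem master (C : GraphClass) (hC : TransducesAllGraphs C) :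
    ∃ (P : Type) (E : P → P → SignType → SignType → Prop),
      (∀ p q σ τ, E p q σ τ ↔ E q p (-σ) (-τ)) ∧ (∀ p, ¬ E p p 0 0) ∧
      (∃ p q, KR E p ∧ AR E q ∧ ReflTransGen (Linked E) p q) ∧
      ∀ (ι : Type) [Finite ι] (f : ι → P × ℤ × ℤ), ∃ (n : ℕ) (G : SimpleGraph (Fin n)), C n G ∧
        ∃ h : ι → Fin n, ∀ u v, G.Adj (h u) (h v) ↔
          E (f u).1 (f v).1 (SignType.sign ((f u).2.1 - (f v).2.1))
            (SignType.sign ((f u).2.2 - (f v).2.2)) := by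
  obtain ⟨k, φ, N, G, c, e, hG, hφ⟩ := trans_test C hC
  have hN : ∀ n, 0 < N n := fun n => (e n (Sum.inl 0)).pos
  refine ⟨VS N, Ev G, Ev_symm G, fun p => by rw [Ev_zero]; exact Es_irrefl G p, ?_, ?_⟩
  swap
  · intro ι _ f
    obtain ⟨n, h, hh⟩ := Ev_realize G f
    exact ⟨N n, G n, hG n, h, hh⟩
  have agr0 : ∀ x y : ℤ → ℕ, Agr 0 x y → x 0 = y 0 := fun x y h => h 0 (by simp) (by simp)
  let w : VS N := ⟨fun ω => e ω.2.2 (Sum.inl (Fin.ofNat _ (ω.1 0))), 0, by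
    intro x y x' y' n h1 h2
    dsimp only
    rw [agr0 x y h1]⟩
  let w' : VS N := ⟨fun ω => e ω.2.2 (Sum.inr (Sum.inl (Fin.ofNat _ (ω.2.1 0)))), 0, by
    intro x y x' y' n h1 h2
    dsimp only
    rw [agr0 x' y' h2]⟩
  let s : VS N := ⟨fun ω => e ω.2.2 (Sum.inr (Sum.inr (Fin.ofNat _ (ω.1 0), Fin.ofNat _ (ω.2.1 0)))),
    0, by
    intro x y x' y' n h1 h2
    dsimp only
    rw [agr0 x' y' h2, agr0 x y h1]⟩
  have sat_eq : ∀ F H : VS N, (Sats G c φ ![F, H] default ↔ ∀ᶠ ω in (WW : Filter Om),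
      colSat (G ω.2.2) (c ω.2.2) φ (F.1 ω) (H.1 ω)) := by
    intro F H
    refine eventually_congr (Eventually.of_forall fun ω => ?_)
    unfold colSat FirstOrder.Language.Formula.Realize
    have e1 : (fun i => ((![F, H] : Fin 2 → VS N) i).1 ω) = ![F.1 ω, H.1 ω] := by
      funext i; fin_cases i <;> rfl
    rw [e1]
    have e2 : (fun i => ((default : Fin 0 → VS N) i).1 ω) = default := Subsingleton.elim _ _
    rw [e2]
  have or_eq : ∀ F H : VS N, (Sats G c φ ![F, H] default ∨ Sats G c φ ![H, F] default) ↔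
      ∀ᶠ ω in (WW : Filter Om), (colSat (G ω.2.2) (c ω.2.2) φ (F.1 ω) (H.1 ω) ∨
        colSat (G ω.2.2) (c ω.2.2) φ (H.1 ω) (F.1 ω)) := by
    intro F H
    rw [sat_eq, sat_eq, Ultrafilter.eventually_or]
  have ofNat_ne : ∀ a b : ℕ, a ≠ b → ∀ᶠ n in (hyperfilter ℕ : Filter ℕ),
      Fin.ofNat (n + 1) a ≠ Fin.ofNat (n + 1) b := by
    intro a b hab
    apply Nat.hyperfilter_le_atTop
    filter_upwards [eventually_ge_atTop (a + b)] with n hn h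
    have := congrArg Fin.val h
    simp only [Fin.val_ofNat] at this
    rw [Nat.mod_eq_of_lt (by omega), Nat.mod_eq_of_lt (by omega)] at this
    exact hab this
  have p1 : Sats G c φ ![w, s] default ∨ Sats G c φ ![s, w] default := by
    rw [or_eq]
    refine Eventually.of_forall fun ω => ?_
    rw [← hφ _ _ _ (by simp), testG_left]
  have p2 : Sats G c φ ![w', s] default ∨ Sats G c φ ![s, w'] default := by
    rw [or_eq]
    refine Eventually.of_forall fun ω => ?_
    rw [← hφ _ _ _ (by simp), testG_right]
  have n1 : ¬ (Sats G c φ ![act 1 0 w, s] default ∨ Sats G c φ ![s, act 1 0 w] default) := by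
    rw [or_eq, ← Ultrafilter.eventually_not, WW_iff]
    filter_upwards [Wu_ne] with x hx
    refine Eventually.of_forall fun x' => ?_
    filter_upwards [ofNat_ne _ _ hx] with n hn
    have h1 : (act 1 0 w).1 (x, x', n) = e n (Sum.inl (Fin.ofNat (n + 1) (x 1))) := rfl
    have h2 : s.1 (x, x', n) = e n (Sum.inr (Sum.inr (Fin.ofNat _ (x 0), Fin.ofNat _ (x' 0)))) := rfl
    rw [h1, h2, ← hφ _ _ _ (by simp), testG_left]
    exact fun h => hn h.symm
  have n2 : ¬ (Sats G c φ ![act 0 1 w', s] default ∨ Sats G c φ ![s, act 0 1 w'] default) := by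
    rw [or_eq, ← Ultrafilter.eventually_not, WW_iff]
    refine Eventually.of_forall fun x => ?_
    filter_upwards [Wu_ne] with x' hx
    filter_upwards [ofNat_ne _ _ hx] with n hn
    have h1 : (act 0 1 w').1 (x, x', n) = e n (Sum.inr (Sum.inl (Fin.ofNat (n + 1) (x' 1)))) := rfl
    have h2 : s.1 (x, x', n) = e n (Sum.inr (Sum.inr (Fin.ofNat _ (x 0), Fin.ofNat _ (x' 0)))) := rfl
    rw [h1, h2, ← hφ _ _ _ (by simp), testG_right]
    exact fun h => hn h.symm
  have r1 : Rch G 1 0 w s := by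
    by_contra h
    obtain ⟨h1, h2⟩ := Rch_auto G c hN 1 0 w s h φ
    simp only [SignType.coe_one, SignType.coe_zero] at h1 h2
    rw [h1, h2] at n1
    exact n1 p1
  have r2 : Rch G 0 1 w' s := by
    by_contra h
    obtain ⟨h1, h2⟩ := Rch_auto G c hN 0 1 w' s h φ
    simp only [SignType.coe_one, SignType.coe_zero] at h1 h2
    rw [h1, h2] at n2
    exact n2 p2
  -- invariance of satisfaction under shifts and under limit equality
  have sat_act : ∀ (i j : ℤ) (F H : VS N),
      (Sats G c φ ![act i j F, act i j H] default ↔ Sats G c φ ![F, H] default) := by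
    intro i j F H
    rw [sat_eq, sat_eq]
    exact act_invariant_gen i j F H (fun n => colSat (G n) (c n) φ)
  have sat_Q : ∀ (F F' H : VS N), Qs F F' → 
      ((Sats G c φ ![H, F] default ↔ Sats G c φ ![H, F'] default) ∧
      (Sats G c φ ![F, H] default ↔ Sats G c φ ![F', H] default)) := by
    intro F F' H h
    simp only [sat_eq]
    constructor
    · apply eventually_congr
      filter_upwards [h] with ω hω
      rw [hω]
    · apply eventually_congr
      filter_upwards [h] with ω hω
      rw [hω]
  have wfix : ∀ j : ℤ, act 0 j w = w := fun j => rfl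
  have wfix' : ∀ j : ℤ, act j 0 w' = w' := fun j => rfl
  obtain ⟨j, z, hz, hzs⟩ := Rch_chain G 1 0 w s r1
  obtain ⟨j', z', hz', hzs'⟩ := Rch_chain G 0 1 w' s r2
  simp only [SignType.coe_one, SignType.coe_zero, mul_one, mul_zero] at hz hz'
  have zfix : ∀ t : ℤ, Qs (act 0 t z) z := by
    intro t
    have := (act_Qs 0 t _ _).2 hz
    rw [act_act, add_comm 0 j, add_comm t 0, ← act_act, wfix] at this
    exact this.symm.trans hz
  have zfix' : ∀ t : ℤ, Qs (act t 0 z') z' := by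
    intro t
    have := (act_Qs t 0 _ _).2 hz'
    rw [act_act, add_comm 0 j', add_comm t 0, ← act_act, wfix'] at this
    exact this.symm.trans hz'
  have linkOf : ∀ (d1 d2 : SignType) (x y : VS N), SLk G d1 d2 x y → Linked (Ev G) x y := by
    rintro d1 d2 x y ⟨σ, hσ⟩
    by_cases h : Ev G x y 0 0
    · exact ⟨0, 0, _, _, h, fun h' => hσ ⟨fun _ => h, fun _ => h'⟩⟩
    · exact ⟨σ * d1, σ * d2, 0, 0, by by_contra h'; exact hσ ⟨fun a => absurd a h', fun a => absurd a h⟩, h⟩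
  have linkSymm : ∀ x y, Linked (Ev G) x y → Linked (Ev G) y x := by
    rintro x y ⟨σ, τ, σ', τ', h1, h2⟩
    exact ⟨-σ, -τ, -σ', -τ', (Ev_symm G x y σ τ).1 h1, fun h => h2 ((Ev_symm G x y σ' τ').2 h)⟩
  rcases ReflTransGen.cases_head hzs with rfl | ⟨z1, h1, h1s⟩
  · exfalso
    have q1 := sat_act 0 1 w' s
    have q2 := sat_act 0 1 s w'
    have q3 := (sat_Q _ _ (act 0 1 w') (zfix 1))
    rw [q3.1] at q1
    rw [q3.2] at q2
    rw [q1, q2] at n2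
    exact n2 p2
  rcases ReflTransGen.cases_head hzs' with rfl | ⟨z1', h1', h1s'⟩
  · exfalso
    have q1 := sat_act 1 0 w s
    have q2 := sat_act 1 0 s w
    have q3 := (sat_Q _ _ (act 1 0 w) (zfix' 1))
    rw [q3.1] at q1
    rw [q3.2] at q2
    rw [q1, q2] at n1
    exact n1 p1
  refine ⟨z1, z1', ?_, ?_, ?_⟩
  · obtain ⟨σ, hσ⟩ := h1
    simp only [mul_one, mul_zero] at hσ
    have inv : ∀ σ, Ev G z z1 σ 1 ↔ Ev G z z1 σ 0 := by
      intro σ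
      refine eventually_congr (Eventually.of_forall fun M => ?_)
      apply Qs.Es_left
      have := (act_Qs ((σ : ℤ) * M) 0 _ _).2 (zfix M)
      rw [act_act] at this
      simpa using this
    rw [← inv, ← inv] at hσ
    refine ⟨z, 1, by decide, ?_⟩
    by_cases h : Ev G z z1 0 1
    · exact ⟨0, σ, h, fun h' => hσ ⟨fun _ => h, fun _ => h'⟩⟩
    · exact ⟨σ, 0, by by_contra h'; exact hσ ⟨fun a => absurd a h', fun a => absurd a h⟩, h⟩
  · obtain ⟨σ, hσ⟩ := h1'
    simp only [mul_one, mul_zero] at hσ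
    have inv : ∀ σ, Ev G z' z1' 1 σ ↔ Ev G z' z1' 0 σ := by
      intro σ
      refine eventually_congr (Eventually.of_forall fun M => ?_)
      apply Qs.Es_left
      have := (act_Qs 0 ((σ : ℤ) * M) _ _).2 (zfix' M)
      rw [act_act] at this
      simpa using this
    rw [← inv, ← inv] at hσ
    refine ⟨z', 1, by decide, ?_⟩
    by_cases h : Ev G z' z1' 1 0
    · exact ⟨0, σ, h, fun h' => hσ ⟨fun _ => h, fun _ => h'⟩⟩
    · exact ⟨σ, 0, by by_contra h'; exact hσ ⟨fun a => absurd a h', fun a => absurd a h⟩, h⟩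
  · have a1 : ReflTransGen (Linked (Ev G)) z1 s := ReflTransGen.mono (linkOf _ _) _ _ h1s
    have a2 : ReflTransGen (Linked (Ev G)) z1' s := ReflTransGen.mono (linkOf _ _) _ _ h1s'
    haveI : Std.Symm (Linked (Ev G)) := ⟨linkSymm⟩
    exact a1.trans (Std.Symm.symm _ _ a2)

end concrete

set_option linter.deprecated false

theorem xor_iff' (a b : Prop) : Xor' a b ↔ (a ↔ ¬ b) := xor_iff_iff_not

theorem xor_cancel' (a b : Prop) : a ↔ Xor' b (Xor' a b) := by
  simp only [xor_iff']; tauto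

/-- The three kinds of root neighborhoods. -/
inductive Kind | star | clique | half

/-- Root adjacency on indices. -/
def rootAdj (K : Kind) (i i' : ℕ) : Prop :=
  match K with
  | Kind.half => i ≤ i'
  | _ => i = i'

/-- Crossing relation with possibly different kinds at the two ends. -/
def mixRel (Kl Kr : Kind) {n r : ℕ} (u v : CrossVert n r) : Prop :=
  match u, v with
  | Sum.inl i, Sum.inr (Sum.inl (i', _, t)) => rootAdj Kl i i' ∧ (t : ℕ) = 0
  | Sum.inr (Sum.inr j), Sum.inr (Sum.inl (_, j', t)) => rootAdj Kr j j' ∧ (t : ℕ) + 1 = r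
  | Sum.inr (Sum.inl (i, j, t)), Sum.inr (Sum.inl (i', j', t')) =>
      (i = i' ∧ j = j' ∧ (t' : ℕ) = (t : ℕ) + 1) ∨
      (Kl = Kind.clique ∧ i = i' ∧ (t : ℕ) = 0 ∧ (t' : ℕ) = 0 ∧ j ≠ j') ∨
      (Kr = Kind.clique ∧ j = j' ∧ (t : ℕ) + 1 = r ∧ (t' : ℕ) + 1 = r ∧ i ≠ i')
  | _, _ => False

/-- Symmetrized crossing relation. -/
def mixAdj (Kl Kr : Kind) {n r : ℕ} (u v : CrossVert n r) : Prop :=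
  mixRel Kl Kr u v ∨ mixRel Kl Kr v u

/-- A flipped mixed crossing maps (possibly non-injectively) to `X`. -/
def Rz {X : Type} (A : X → X → Prop) (Kl Kr : Kind) (n r : ℕ) : Prop :=
  ∃ (F : Fin (r + 2) → Fin (r + 2) → Prop) (f : CrossVert n r → X), (∀ x y, F x y → F y x) ∧
    ∀ u v, u ≠ v → (A (f u) (f v) ↔ Xor' (mixAdj Kl Kr u v) (F (layer u) (layer v)))

theorem mixAdj_comm (Kl Kr : Kind) {n r : ℕ} (u v : CrossVert n r) :
    mixAdj Kl Kr u v ↔ mixAdj Kl Kr v u := or_comm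

section simps
variable (Kl Kr : Kind) {n r : ℕ}

theorem mix_aa (i i' : Fin n) : mixAdj Kl Kr (Sum.inl i : CrossVert n r) (Sum.inl i') ↔ False := by
  simp [mixAdj, mixRel]
theorem mix_ab (i j : Fin n) :
    mixAdj Kl Kr (Sum.inl i : CrossVert n r) (Sum.inr (Sum.inr j)) ↔ False := by
  simp [mixAdj, mixRel]
theorem mix_bb (i j : Fin n) :
    mixAdj Kl Kr (Sum.inr (Sum.inr i) : CrossVert n r) (Sum.inr (Sum.inr j)) ↔ False := by
  simp [mixAdj, mixRel]
theorem mix_ap (i i' j' : Fin n) (t : Fin r) :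
    mixAdj Kl Kr (Sum.inl i : CrossVert n r) (Sum.inr (Sum.inl (i', j', t))) ↔
      rootAdj Kl i i' ∧ (t : ℕ) = 0 := by
  simp [mixAdj, mixRel]
theorem mix_bp (j i' j' : Fin n) (t : Fin r) :
    mixAdj Kl Kr (Sum.inr (Sum.inr j) : CrossVert n r) (Sum.inr (Sum.inl (i', j', t))) ↔
      rootAdj Kr j j' ∧ (t : ℕ) + 1 = r := by
  simp [mixAdj, mixRel]
theorem mix_pp_lt (i j i' j' : Fin n) (t t' : Fin r) (h : t < t') :
    mixAdj Kl Kr (Sum.inr (Sum.inl (i, j, t)) : CrossVert n r) (Sum.inr (Sum.inl (i', j', t'))) ↔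
      i = i' ∧ j = j' ∧ (t' : ℕ) = t + 1 := by
  have : (t : ℕ) < t' := h
  have h2 := t'.2
  simp only [mixAdj, mixRel]
  constructor
  · rintro ((h | ⟨_, _, h3, h4, _⟩ | ⟨_, _, h3, h4, _⟩) | (⟨_, _, h3⟩ | ⟨_, _, h3, h4, _⟩ | ⟨_, _, h3, h4, _⟩))
    · exact h
    all_goals omega
  · intro h; exact Or.inl (Or.inl h)
theorem mix_pp_eq (i j i' j' : Fin n) (t : Fin r) (h : (i, j) ≠ (i', j')) :
    mixAdj Kl Kr (Sum.inr (Sum.inl (i, j, t)) : CrossVert n r) (Sum.inr (Sum.inl (i', j', t))) ↔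
      (Kl = Kind.clique ∧ i = i' ∧ (t : ℕ) = 0) ∨ (Kr = Kind.clique ∧ j = j' ∧ (t : ℕ) + 1 = r) := by
  simp only [mixAdj, mixRel]
  have : i = i' → j ≠ j' := fun h1 h2 => h (by rw [h1, h2])
  grind
end simps

/-- Assemble a realization layer pair by layer pair. -/
theorem Rz_of {X : Type} (A : X → X → Prop) (hA : ∀ x y, A x y → A y x) (Kl Kr : Kind) (n r : ℕ)
    (a b : Fin n → X) (p : Fin n → Fin n → Fin r → X)
    (haa : ∃ β : Prop, ∀ i i', i ≠ i' → (A (a i) (a i') ↔ β))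
    (hab : ∃ β : Prop, ∀ i j, (A (a i) (b j) ↔ β))
    (hbb : ∃ β : Prop, ∀ i i', i ≠ i' → (A (b i) (b i') ↔ β))
    (hap : ∀ t : Fin r, ∃ β : Prop, ∀ i i' j, (A (a i) (p i' j t) ↔
      Xor' (rootAdj Kl i i' ∧ (t : ℕ) = 0) β))
    (hbp : ∀ t : Fin r, ∃ β : Prop, ∀ j i' j', (A (b j) (p i' j' t) ↔
      Xor' (rootAdj Kr j j' ∧ (t : ℕ) + 1 = r) β))
    (hlt : ∀ t t' : Fin r, t < t' → ∃ β : Prop, ∀ i j i' j', (A (p i j t) (p i' j' t') ↔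
      Xor' (i = i' ∧ j = j' ∧ (t' : ℕ) = t + 1) β))
    (heq : ∀ t : Fin r, ∃ β : Prop, ∀ i j i' j', (i, j) ≠ (i', j') → (A (p i j t) (p i' j' t) ↔
      Xor' ((Kl = Kind.clique ∧ i = i' ∧ (t : ℕ) = 0) ∨
        (Kr = Kind.clique ∧ j = j' ∧ (t : ℕ) + 1 = r)) β)) :
    Rz A Kl Kr n r := by
  classical
  let f : CrossVert n r → X := fun u => match u with
    | Sum.inl i => a i
    | Sum.inr (Sum.inl (i, j, t)) => p i j t
    | Sum.inr (Sum.inr j) => b j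
  have hA' : ∀ x y, A x y ↔ A y x := fun x y => ⟨hA x y, hA y x⟩
  let D : CrossVert n r → CrossVert n r → Prop := fun u v => Xor' (A (f u) (f v)) (mixAdj Kl Kr u v)
  have Dsymm : ∀ u v, D u v ↔ D v u := by
    intro u v
    simp only [D]
    rw [hA', mixAdj_comm]
  have key : ∀ l l' : Fin (r + 2), ∃ β : Prop, l ≤ l' → ∀ u v, u ≠ v → layer u = l → layer v = l' →
      (D u v ↔ β) := by
    have lay : ∀ u : CrossVert n r, (layer u : ℕ) = match u with
      | Sum.inl _ => 0
      | Sum.inr (Sum.inl (_, _, t)) => (t : ℕ) + 1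
      | Sum.inr (Sum.inr _) => r + 1 := by
      rintro (i | ⟨i, j, t⟩ | j) <;> simp [layer]
    have xr : ∀ {x y z : Prop}, (x ↔ Xor' y z) → (Xor' x y ↔ z) := by
      intro x y z h
      simp only [xor_iff'] at *
      tauto
    have xr0 : ∀ {x z : Prop}, (x ↔ z) → (Xor' x False ↔ z) := by
      intro x z h
      simp only [xor_iff'] at *
      tauto
    -- classify the layers
    have cl : ∀ l : Fin (r + 2), (l : ℕ) = 0 ∨ (∃ t : Fin r, (l : ℕ) = t + 1) ∨ (l : ℕ) = r + 1 := by
      intro l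
      have := l.2
      by_cases h0 : (l : ℕ) = 0
      · exact Or.inl h0
      · by_cases h1 : (l : ℕ) = r + 1
        · exact Or.inr (Or.inr h1)
        · exact Or.inr (Or.inl ⟨⟨l - 1, by omega⟩, by simp; omega⟩)
    have lin : ∀ (u : CrossVert n r) (l : Fin (r + 2)), layer u = l → (l : ℕ) = 0 → ∃ i, u = Sum.inl i := by
      rintro (i | ⟨i, j, t⟩ | j) l h h0
      · exact ⟨i, rfl⟩
      · have := lay (Sum.inr (Sum.inl (i, j, t))); rw [h] at this; dsimp only at this; omega
      · have := lay (Sum.inr (Sum.inr j)); rw [h] at this; dsimp only at this; omega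
    have lip : ∀ (u : CrossVert n r) (l : Fin (r + 2)) (t : Fin r), layer u = l → (l : ℕ) = t + 1 →
        ∃ i j, u = Sum.inr (Sum.inl (i, j, t)) := by
      rintro (i | ⟨i, j, t'⟩ | j) l t h h0
      · have := lay (Sum.inl i); rw [h] at this; dsimp only at this; omega
      · have := lay (Sum.inr (Sum.inl (i, j, t'))); rw [h] at this; dsimp only at this
        have : t' = t := by ext; omega
        exact ⟨i, j, by rw [this]⟩
      · have := lay (Sum.inr (Sum.inr j)); rw [h] at this; dsimp only at this; omega
    have lib : ∀ (u : CrossVert n r) (l : Fin (r + 2)), layer u = l → (l : ℕ) = r + 1 →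
        ∃ j, u = Sum.inr (Sum.inr j) := by
      rintro (i | ⟨i, j, t⟩ | j) l h h0
      · have := lay (Sum.inl i); rw [h] at this; dsimp only at this; omega
      · have := lay (Sum.inr (Sum.inl (i, j, t))); rw [h] at this; dsimp only at this; omega
      · exact ⟨j, rfl⟩
    intro l l'
    rcases cl l with h | ⟨t, h⟩ | h <;> rcases cl l' with h' | ⟨t', h'⟩ | h'
    · obtain ⟨β, hβ⟩ := haa
      refine ⟨β, fun _ u v huv hu hv => ?_⟩
      obtain ⟨i, rfl⟩ := lin u l hu h
      obtain ⟨i', rfl⟩ := lin v l' hv h'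
      simp only [D, mix_aa]
      exact xr0 (hβ i i' (by rintro rfl; exact huv rfl))
    · obtain ⟨β, hβ⟩ := hap t'
      refine ⟨β, fun _ u v huv hu hv => ?_⟩
      obtain ⟨i, rfl⟩ := lin u l hu h
      obtain ⟨i', j', rfl⟩ := lip v l' t' hv h'
      simp only [D, mix_ap]
      exact xr (hβ i i' j')
    · obtain ⟨β, hβ⟩ := hab
      refine ⟨β, fun _ u v huv hu hv => ?_⟩
      obtain ⟨i, rfl⟩ := lin u l hu h
      obtain ⟨i', rfl⟩ := lib v l' hv h'
      simp only [D, mix_ab]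
      exact xr0 (hβ i i')
    · exact ⟨True, fun hle => absurd (Fin.le_def.1 hle) (by omega)⟩
    · rcases lt_trichotomy t t' with htt | rfl | htt
      · obtain ⟨β, hβ⟩ := hlt t t' htt
        refine ⟨β, fun _ u v huv hu hv => ?_⟩
        obtain ⟨i, j, rfl⟩ := lip u l t hu h
        obtain ⟨i', j', rfl⟩ := lip v l' t' hv h'
        simp only [D]
        rw [mix_pp_lt Kl Kr i j i' j' t t' htt]
        exact xr (hβ i j i' j')
      · obtain ⟨β, hβ⟩ := heq t
        refine ⟨β, fun _ u v huv hu hv => ?_⟩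
        obtain ⟨i, j, rfl⟩ := lip u l t hu h
        obtain ⟨i', j', rfl⟩ := lip v l' t hv h'
        have hne : (i, j) ≠ (i', j') := by
          intro h
          rw [Prod.mk.injEq] at h
          exact huv (by rw [h.1, h.2])
        simp only [D]
        rw [mix_pp_eq Kl Kr i j i' j' t hne]
        exact xr (hβ i j i' j' hne)
      · exact ⟨True, fun hle => absurd (Fin.le_def.1 hle) (by have : (t' : ℕ) < t := htt; omega)⟩
    · obtain ⟨β, hβ⟩ := hbp t
      refine ⟨β, fun _ u v huv hu hv => ?_⟩
      obtain ⟨i, j, rfl⟩ := lip u l t hu h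
      obtain ⟨j', rfl⟩ := lib v l' hv h'
      refine (Dsymm (Sum.inr (Sum.inl (i, j, t))) (Sum.inr (Sum.inr j'))).trans ?_
      simp only [D, mix_bp]
      exact xr (hβ j' i j)
    · exact ⟨True, fun hle => absurd (Fin.le_def.1 hle) (by omega)⟩
    · exact ⟨True, fun hle => absurd (Fin.le_def.1 hle) (by omega)⟩
    · obtain ⟨β, hβ⟩ := hbb
      refine ⟨β, fun _ u v huv hu hv => ?_⟩
      obtain ⟨i, rfl⟩ := lib u l hu h
      obtain ⟨i', rfl⟩ := lib v l' hv h'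
      simp only [D, mix_bb]
      exact xr0 (hβ i i' (by rintro rfl; exact huv rfl))
  choose F hF using key
  refine ⟨fun l l' => if l ≤ l' then F l l' else F l' l, f, ?_, ?_⟩
  · intro x y
    rcases lt_trichotomy x y with h | rfl | h
    · simp [h.le, not_le.2 h]
    · exact id
    · simp [h.le, not_le.2 h]
  · intro u v huv
    have hD : D u v ↔ (if layer u ≤ layer v then F (layer u) (layer v) else F (layer v) (layer u)) := by
      by_cases h : layer u ≤ layer v
      · rw [if_pos h]
        exact hF _ _ h u v huv rfl rfl
      · rw [if_neg h, Dsymm]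
        exact hF _ _ (not_le.1 h).le v u huv.symm rfl rfl
    refine Iff.trans ?_ (Iff.of_eq (congrArg (Xor' _) (propext hD)))
    exact xor_cancel' _ _

set_option linter.deprecated false

open Relation

section arr

variable {P : Type} (E : P → P → SignType → SignType → Prop)

/-- Array adjacency. -/
def arr (u v : P × ℤ × ℤ) : Prop :=
  E u.1 v.1 (SignType.sign (u.2.1 - v.2.1)) (SignType.sign (u.2.2 - v.2.2))

theorem chain_of_rtg {R : P → P → Prop} {p q : P} (h : ReflTransGen R p q) :
    ∃ (m : ℕ) (c : ℕ → P), c 0 = p ∧ c m = q ∧ ∀ i < m, R (c i) (c (i + 1)) := by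
  induction h with
  | refl => exact ⟨0, fun _ => p, rfl, rfl, by simp⟩
  | @tail b d _ hbd ih =>
    obtain ⟨m, c, h0, hm, hc⟩ := ih
    refine ⟨m + 1, fun t => if t ≤ m then c t else d, by simp [h0], by simp, ?_⟩
    intro i hi
    rcases Nat.lt_or_ge i m with h | h
    · simp only [h.le, if_true, if_pos (show i + 1 ≤ m from h)]
      exact hc i h
    · obtain rfl : i = m := by omega
      simp only [le_refl, if_true, if_neg (show ¬ i + 1 ≤ i by omega)]
      rw [hm]; exact hbd

/-- A shortest chain from a `KR` node to an `AR` node. -/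
theorem min_chain {p q : P} (hp : KR E p) (hq : AR E q) (h : ReflTransGen (Linked E) p q) :
    ∃ (m : ℕ) (c : ℕ → P), KR E (c 0) ∧ AR E (c m) ∧ (∀ i < m, Linked E (c i) (c (i + 1))) ∧
      (∀ i, 0 < i → i ≤ m → ¬ KR E (c i)) ∧ (∀ i, i < m → ¬ AR E (c i)) ∧
      (∀ i j, i + 1 < j → j ≤ m → ¬ Linked E (c i) (c j)) := by
  classical
  have hex : ∃ m, ∃ c : ℕ → P, KR E (c 0) ∧ AR E (c m) ∧ ∀ i < m, Linked E (c i) (c (i + 1)) := by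
    obtain ⟨m, c, h0, hm, hc⟩ := chain_of_rtg h
    exact ⟨m, c, h0 ▸ hp, hm ▸ hq, hc⟩
  obtain ⟨c, h0, hm, hc⟩ := Nat.find_spec hex
  have hmin := fun k => Nat.find_min hex (m := k)
  set m := Nat.find hex
  refine ⟨m, c, h0, hm, hc, ?_, ?_, ?_⟩
  · intro i hi him hK
    refine hmin (m - i) (by omega) ⟨fun t => c (t + i), by simpa using hK, ?_, ?_⟩
    · simpa [Nat.sub_add_cancel him] using hm
    · intro t ht
      have := hc (t + i) (by omega)
      rwa [show t + i + 1 = t + 1 + i by ring] at this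
  · intro i hi hA
    exact hmin i hi ⟨c, h0, hA, fun t ht => hc t (by omega)⟩
  · intro i j hij hj hL
    refine hmin (m - (j - i - 1)) (by omega) ⟨fun t => if t ≤ i then c t else c (t + (j - i - 1)), ?_, ?_, ?_⟩
    · simpa using h0
    · dsimp only
      rw [if_neg (by omega), Nat.sub_add_cancel (by omega)]
      exact hm
    · intro t ht
      dsimp only
      rcases lt_trichotomy t i with h | rfl | h
      · rw [if_pos (by omega), if_pos (by omega)]
        exact hc t (by omega)
      · rw [if_pos (by omega), if_neg (by omega), show t + 1 + (j - t - 1) = j by omega]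
        exact hL
      · rw [if_neg (by omega), if_neg (by omega), show t + 1 + (j - i - 1) = t + (j - i - 1) + 1 by omega]
        exact hc _ (by omega)

/-- The left end of the chain. -/
theorem left_end (hs : ∀ p q σ τ, E p q σ τ ↔ E q p (-σ) (-τ)) (x : P) (hK : KR E x)
    (hAB : E x x 1 1 ↔ E x x 1 (-1)) :
    ∃ (K : Kind) (q : P) (τ : SignType) (ε : ℤ), τ ≠ 0 ∧ (ε = 1 ∨ ε = -1) ∧
      (∃ β : Prop, ∀ i i' : ℕ, E q x (SignType.sign (ε * (i : ℤ) - ε * (i' : ℤ))) τ ↔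
        Xor' (rootAdj K i i') β) ∧
      (K = Kind.clique ↔ ¬ (E x x 0 1 ↔ E x x 1 1)) := by
  have sg : ∀ i i' : ℕ, (i < i' ∧ SignType.sign ((1 : ℤ) * (i : ℤ) - 1 * (i' : ℤ)) = -1 ∧
        SignType.sign ((-1 : ℤ) * (i : ℤ) - (-1) * (i' : ℤ)) = 1) ∨
      (i = i' ∧ SignType.sign ((1 : ℤ) * (i : ℤ) - 1 * (i' : ℤ)) = 0 ∧
        SignType.sign ((-1 : ℤ) * (i : ℤ) - (-1) * (i' : ℤ)) = 0) ∨
      (i' < i ∧ SignType.sign ((1 : ℤ) * (i : ℤ) - 1 * (i' : ℤ)) = 1 ∧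
        SignType.sign ((-1 : ℤ) * (i : ℤ) - (-1) * (i' : ℤ)) = -1) := by
    intro i i'
    rcases lt_trichotomy i i' with h | h | h
    · exact Or.inl ⟨h, sign_neg (by omega), sign_pos (by omega)⟩
    · exact Or.inr (Or.inl ⟨h, by simp [h], by simp [h]⟩)
    · exact Or.inr (Or.inr ⟨h, sign_pos (by omega), sign_neg (by omega)⟩)
  by_cases hD : E x x 0 1 ↔ E x x 1 1
  · obtain ⟨q, τ, hτ, σ, σ', h1, h2⟩ := hK
    by_cases hf : E q x 1 τ ↔ E q x (-1) τ
    · refine ⟨Kind.star, q, τ, 1, hτ, Or.inl rfl, ⟨E q x 1 τ, ?_⟩, by simp [hD]⟩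
      have h0 : ¬ (E q x 0 τ ↔ E q x 1 τ) := by
        intro h
        have tri : ∀ s : SignType, s = 0 ∨ s = 1 ∨ s = -1 := by decide
        have all : ∀ s, E q x s τ ↔ E q x 1 τ := by
          intro s
          rcases tri s with rfl | rfl | rfl
          · exact h
          · exact Iff.rfl
          · exact hf.symm
        exact h2 ((all σ').2 ((all σ).1 h1))
      intro i i'
      rw [xor_iff']
      simp only [rootAdj]
      rcases sg i i' with ⟨h, e, -⟩ | ⟨h, e, -⟩ | ⟨h, e, -⟩
      · rw [e]
        have : i ≠ i' := by omega
        tauto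
      · rw [e]; tauto
      · rw [e]
        have : i ≠ i' := by omega
        tauto
    · by_cases h0 : E q x 0 τ ↔ E q x (-1) τ
      · refine ⟨Kind.half, q, τ, 1, hτ, Or.inl rfl, ⟨E q x 1 τ, ?_⟩, by simp [hD]⟩
        intro i i'
        rw [xor_iff']
        simp only [rootAdj]
        rcases sg i i' with ⟨h, e, -⟩ | ⟨h, e, -⟩ | ⟨h, e, -⟩
        · rw [e]
          have : i ≤ i' := by omega
          tauto
        · rw [e]
          have : i ≤ i' := by omega
          tauto
        · rw [e]
          have : ¬ i ≤ i' := by omega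
          tauto
      · refine ⟨Kind.half, q, τ, -1, hτ, Or.inr rfl, ⟨E q x (-1) τ, ?_⟩, by simp [hD]⟩
        intro i i'
        rw [xor_iff']
        simp only [rootAdj]
        rcases sg i i' with ⟨h, -, e⟩ | ⟨h, -, e⟩ | ⟨h, -, e⟩
        · rw [e]
          have : i ≤ i' := by omega
          tauto
        · rw [e]
          have : i ≤ i' := by omega
          tauto
        · rw [e]
          have : ¬ i ≤ i' := by omega
          tauto
  · refine ⟨Kind.clique, x, 1, 1, by decide, Or.inl rfl, ⟨E x x 1 1, ?_⟩, by simp [hD]⟩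
    have h3 : E x x (-1) 1 ↔ E x x 1 (-1) := by
      rw [hs]; simp
    intro i i'
    rw [xor_iff']
    simp only [rootAdj]
    rcases sg i i' with ⟨h, e, -⟩ | ⟨h, e, -⟩ | ⟨h, e, -⟩
    · rw [e]
      have : i ≠ i' := by omega
      tauto
    · rw [e]; tauto
    · rw [e]
      have : i ≠ i' := by omega
      tauto

theorem KR_transpose (x : P) : KR (fun p q σ τ => E p q τ σ) x ↔ AR E x := Iff.rfl

theorem sign_bound (n : ℕ) (σ : SignType) (hσ : σ ≠ 0) (ε : ℤ) (hε : ε = 1 ∨ ε = -1) (i : Fin n) :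
    SignType.sign ((σ : ℤ) * (n + 1) - ε * (i : ℕ)) = σ ∧
    SignType.sign (ε * (i : ℕ) - (σ : ℤ) * (n + 1)) = -σ := by
  have hi := i.2
  cases σ with
  | zero => exact absurd rfl hσ
  | pos =>
    constructor
    · apply sign_pos
      rcases hε with rfl | rfl
      · change (0:ℤ) < 1 * _ - _; omega
      · change (0:ℤ) < 1 * _ - _; omega
    · apply sign_neg
      rcases hε with rfl | rfl
      · change _ - 1 * _ < (0:ℤ); omega
      · change _ - 1 * _ < (0:ℤ); omega
  | neg =>
    constructor
    · apply sign_neg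
      rcases hε with rfl | rfl
      · change (-1) * _ - _ < (0:ℤ); omega
      · change (-1) * _ - _ < (0:ℤ); omega
    · apply sign_pos
      rcases hε with rfl | rfl
      · change (0:ℤ) < _ - (-1) * _; omega
      · change (0:ℤ) < _ - (-1) * _; omega

theorem sign_eps (ε : ℤ) (hε : ε = 1 ∨ ε = -1) (i i' : ℕ) :
    SignType.sign (ε * (i : ℤ) - ε * (i' : ℤ)) = 0 ↔ i = i' := by
  rw [sign_eq_zero_iff]
  rcases hε with rfl | rfl <;> omega

theorem self_prop (e : SignType → SignType → Prop) (hs : ∀ s t, e s t ↔ e (-s) (-t))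
    (hAB : e 1 1 ↔ e 1 (-1)) (L R : Prop) (hL : L ↔ ¬ (e 0 1 ↔ e 1 1))
    (hR : R ↔ ¬ (e 1 0 ↔ e 1 1)) (S T : SignType) (hne : ¬ (S = 0 ∧ T = 0)) :
    e S T ↔ Xor' ((L ∧ S = 0) ∨ (R ∧ T = 0)) (e 1 1) := by
  have tri : ∀ s : SignType, s = 0 ∨ s = 1 ∨ s = -1 := by decide
  have neg11 : e (-1) (-1) ↔ e 1 1 := by rw [hs]; simp
  have neg1 : e (-1) 1 ↔ e 1 1 := by rw [hAB, hs]; simp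
  have d1 : e 0 (-1) ↔ e 0 1 := by rw [hs]; simp
  have c1 : e (-1) 0 ↔ e 1 0 := by rw [hs]; simp
  have z1 : ¬ ((1 : SignType) = 0) := by decide
  have z2 : ¬ ((-1 : SignType) = 0) := by decide
  rw [xor_iff', hL, hR]
  clear hL hR hs
  rcases tri S with rfl | rfl | rfl <;> rcases tri T with rfl | rfl | rfl <;>
    simp only [z1, z2, and_true, and_false, or_false, false_or, d1, c1, neg1, neg11, ← hAB] <;>
    tauto

theorem linked_of_not_iff {p q : P} {σ τ σ' τ' : SignType} (h : ¬ (E p q σ τ ↔ E p q σ' τ')) :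
    Linked E p q := by
  by_cases hh : E p q σ τ
  · exact ⟨σ, τ, σ', τ', hh, fun h' => h (iff_of_true hh h')⟩
  · exact ⟨σ', τ', σ, τ, by_contra fun h' => h (iff_of_false hh h'), hh⟩

theorem ppt1 {a b : Prop} (h : ¬ (a ↔ b)) : a ↔ (True ↔ ¬ b) := by tauto
theorem ppt2 {a b c : Prop} (h : ¬ (a ∧ b)) : c ↔ (a ∧ b ↔ ¬ c) := by tauto
theorem ppt3 {a b c d : Prop} (h : ¬ b) (h' : c ↔ d) : (a ∧ b) ↔ ¬ (c ↔ d) := by tauto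

set_option maxHeartbeats 1000000 in
theorem array_lemma (hs : ∀ p q σ τ, E p q σ τ ↔ E q p (-σ) (-τ))
    (h : ∃ p q, KR E p ∧ AR E q ∧ ReflTransGen (Linked E) p q) :
    (∃ x, ¬ (E x x 1 1 ↔ E x x 1 (-1))) ∨
    ∃ (Kl Kr : Kind) (m : ℕ), ∀ n, Rz (arr E) Kl Kr n (m + 1) := by
  obtain ⟨p, q, hp, hq, hpq⟩ := h
  obtain ⟨m, c, h0, hm, hL, hK, hA, hN⟩ := min_chain E hp hq hpq
  by_cases hx : ∃ x, ¬ (E x x 1 1 ↔ E x x 1 (-1))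
  · exact Or.inl hx
  right
  push Not at hx
  have hs2 : ∀ p q σ τ, E p q τ σ ↔ E q p (-τ) (-σ) := fun p q σ τ => hs p q τ σ
  obtain ⟨Kl, ql, τ, ε, hτ, hε, ⟨βl, hl⟩, hKl⟩ := left_end E hs (c 0) h0 (hx _)
  obtain ⟨Kr, qr, σ, ε', hσ, hε', ⟨βr, hr⟩, hKr⟩ := left_end (fun p q σ τ => E p q τ σ) hs2 (c m) hm (by
    have h1 := hs (c m) (c m) (-1) 1
    have h2 := hx (c m)
    rw [h1, h2]; simp)
  refine ⟨Kl, Kr, m, fun n => ?_⟩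
  have noK : ∀ i, 0 < i → i ≤ m → ∀ q τ, τ ≠ 0 → ∀ σ σ', (E q (c i) σ τ ↔ E q (c i) σ' τ) := by
    intro i h1 h2 q τ hτ σ σ'
    by_contra hcon
    apply hK i h1 h2
    by_cases hh : E q (c i) σ τ
    · exact ⟨q, τ, hτ, σ, σ', hh, fun h => hcon (iff_of_true hh h)⟩
    · exact ⟨q, τ, hτ, σ', σ, by_contra fun h => hcon (iff_of_false hh h), hh⟩
  have noA : ∀ i, i < m → ∀ q σ, σ ≠ 0 → ∀ τ τ', (E q (c i) σ τ ↔ E q (c i) σ τ') := by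
    intro i h1 q σ hσ τ τ'
    by_contra hcon
    apply hA i h1
    by_cases hh : E q (c i) σ τ
    · exact ⟨q, σ, hσ, τ, τ', hh, fun h => hcon (iff_of_true hh h)⟩
    · exact ⟨q, σ, hσ, τ', τ, by_contra fun h => hcon (iff_of_false hh h), hh⟩
  have sgn0 : ∀ s : SignType, s ≠ 0 → s = 1 ∨ s = -1 := by decide
  have sgn0' : ∀ s : SignType, s ≠ 0 → -s ≠ 0 := by decide
  refine Rz_of (arr E) ?_ Kl Kr n (m + 1) (fun i => (ql, ε * (i : ℕ), (τ : ℤ) * (n + 1)))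
    (fun j => (qr, (σ : ℤ) * (n + 1), ε' * (j : ℕ)))
    (fun i j t => (c t, ε * (i : ℕ), ε' * (j : ℕ))) ?_ ?_ ?_ ?_ ?_ ?_ ?_
  · intro x y hxy
    unfold arr at *
    rw [hs, ← Left.sign_neg, ← Left.sign_neg, neg_sub, neg_sub]
    exact hxy
  · refine ⟨E ql ql 1 0, fun i i' hii => ?_⟩
    simp only [arr, sub_self, sign_zero]
    rcases sgn0 _ (fun h => hii (Fin.ext ((sign_eps ε hε i i').1 h))) with h | h
    · rw [h]
    · rw [h, hs]; simp
  · refine ⟨E ql qr (-σ) τ, fun i j => ?_⟩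
    simp only [arr]
    rw [(sign_bound n σ hσ ε hε i).2, (sign_bound n τ hτ ε' hε' j).1]
  · refine ⟨E qr qr 0 1, fun i i' hii => ?_⟩
    simp only [arr, sub_self, sign_zero]
    rcases sgn0 _ (fun h => hii (Fin.ext ((sign_eps ε' hε' i i').1 h))) with h | h
    · rw [h]
    · rw [h, hs]; simp
  · intro t
    by_cases ht : (t : ℕ) = 0
    · refine ⟨βl, fun i i' j => ?_⟩
      simp only [arr, ht, and_true]
      rw [(sign_bound n τ hτ ε' hε' j).1]
      exact hl i i'
    · refine ⟨E ql (c t) 0 τ, fun i i' j => ?_⟩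
      simp only [arr, ht, and_false, xor_iff', false_iff, not_not]
      rw [(sign_bound n τ hτ ε' hε' j).1]
      exact noK t (by omega) (by omega) _ _ hτ _ _
  · intro t
    by_cases ht : (t : ℕ) = m
    · refine ⟨βr, fun j i' j' => ?_⟩
      simp only [arr, ht, and_true]
      rw [(sign_bound n σ hσ ε hε i').1]
      exact hr j j'
    · refine ⟨E qr (c t) σ 0, fun j i' j' => ?_⟩
      simp only [arr, Nat.add_right_cancel_iff, ht, and_false, xor_iff', false_iff, not_not]
      rw [(sign_bound n σ hσ ε hε i').1]
      exact noA t (by omega) _ _ hσ _ _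
  · intro t t' htt
    have htt' : (t : ℕ) < t' := htt
    have ht' := t'.2
    by_cases hc : (t' : ℕ) = t + 1
    · refine ⟨E (c t) (c t') 1 1, fun i j i' j' => ?_⟩
      simp only [arr, hc, and_true, xor_iff']
      have kk : ∀ τ, τ ≠ 0 → ∀ σ σ', (E (c t) (c (t + 1)) σ τ ↔ E (c t) (c (t + 1)) σ' τ) := by
        intro τ hτ σ σ'
        exact noK _ (by omega) (by omega) _ _ hτ _ _
      have aa : ∀ σ, σ ≠ 0 → ∀ τ τ', (E (c t) (c (t + 1)) σ τ ↔ E (c t) (c (t + 1)) σ τ') := by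
        intro σ hσ τ τ'
        rw [hs, hs _ _ σ τ']
        exact noA t (by omega) _ _ (sgn0' _ hσ) _ _
      have all : ∀ σ τ, ¬ (σ = 0 ∧ τ = 0) → (E (c t) (c (t + 1)) σ τ ↔ E (c t) (c (t + 1)) 1 1) := by
        intro σ τ hne
        by_cases hτ0 : τ = 0
        · have hσ0 : σ ≠ 0 := fun h => hne ⟨h, hτ0⟩
          rw [aa σ hσ0 τ 1]
          exact kk 1 (by decide) _ _
        · rw [kk τ hτ0 σ 1]
          exact aa 1 (by decide) _ _
      have h00 : ¬ (E (c t) (c (t + 1)) 0 0 ↔ E (c t) (c (t + 1)) 1 1) := by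
        intro h
        have all' : ∀ σ τ, (E (c t) (c (t + 1)) σ τ ↔ E (c t) (c (t + 1)) 1 1) := by
          intro σ τ
          by_cases hne : σ = 0 ∧ τ = 0
          · rw [hne.1, hne.2]; exact h
          · exact all σ τ hne
        obtain ⟨σ, τ, σ', τ', h1, h2⟩ := hL t (by omega)
        exact h2 ((all' _ _).2 ((all' _ _).1 h1))
      by_cases he : i = i' ∧ j = j'
      · obtain ⟨rfl, rfl⟩ := he
        simp only [sub_self, sign_zero, true_and]
        exact ppt1 h00
      · have : ¬ (SignType.sign (ε * (i : ℕ) - ε * ((i' : ℕ) : ℤ)) = 0 ∧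
            SignType.sign (ε' * (j : ℕ) - ε' * ((j' : ℕ) : ℤ)) = 0) := by
          rw [sign_eps ε hε, sign_eps ε' hε']
          intro hh
          exact he ⟨Fin.ext hh.1, Fin.ext hh.2⟩
        rw [all _ _ this]
        exact ppt2 he
    · refine ⟨E (c t) (c t') 1 1, fun i j i' j' => ?_⟩
      simp only [arr, hc, and_false, xor_iff', false_iff, not_not]
      have := hN t t' (by omega) (by omega)
      by_contra hcon
      apply this
      exact linked_of_not_iff E hcon
  · intro t
    have ht := t.2
    refine ⟨E (c t) (c t) 1 1, fun i j i' j' hne => ?_⟩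
    have hAB := hx (c t)
    have hDD : (Kl = Kind.clique ∧ (t : ℕ) = 0) ↔ ¬ (E (c t) (c t) 0 1 ↔ E (c t) (c t) 1 1) := by
      by_cases ht0 : (t : ℕ) = 0
      · rw [ht0]; simpa using hKl
      · have := noK t (by omega) (by omega) (c t) 1 (by decide) 0 1
        exact ppt3 ht0 this
    have hCC : (Kr = Kind.clique ∧ (t : ℕ) + 1 = m + 1) ↔ ¬ (E (c t) (c t) 1 0 ↔ E (c t) (c t) 1 1) := by
      by_cases ht0 : (t : ℕ) = m
      · rw [ht0]; simpa using hKr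
      · have := noA t (by omega) (c t) 1 (by decide) 0 1
        have h3 : ¬ ((t : ℕ) + 1 = m + 1) := by omega
        exact ppt3 h3 this
    simp only [arr]
    have s1 := sign_eps ε hε i i'
    have s2 := sign_eps ε' hε' j j'
    rw [Fin.val_inj] at s1 s2
    have hne' : ¬ (i = i' ∧ j = j') := fun h => hne (by rw [h.1, h.2])
    rw [← s1, ← s2] at hne'
    have hfin := self_prop (E (c t) (c t)) (fun s t' => hs _ _ s t') hAB _ _ hDD hCC _ _ hne'
    rw [hfin, s1, s2, and_right_comm, and_right_comm (a := Kr = Kind.clique), and_assoc, and_assoc]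

/-- Comparability grid from a node whose array distinguishes the two diagonals. -/
theorem grid_of_node (hs : ∀ p q σ τ, E p q σ τ ↔ E q p (-σ) (-τ)) (x : P)
    (hx : ¬ (E x x 1 1 ↔ E x x 1 (-1))) (n : ℕ) :
    ∃ f : Fin n × Fin n → P × ℤ × ℤ, ∀ u v, u ≠ v →
      (arr E (f u) (f v) ↔ (compGrid n).Adj u v) := by
  obtain ⟨ε, hε, hE⟩ : ∃ ε : ℤ, (ε = 1 ∨ ε = -1) ∧ E x x 1 (SignType.sign ε) ∧
      ¬ E x x 1 (SignType.sign (-ε)) := by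
    by_cases h : E x x 1 1
    · exact ⟨1, Or.inl rfl, by simpa using h, by simp; tauto⟩
    · exact ⟨-1, Or.inr rfl, by simp; tauto, by simpa using h⟩
  have hm1 : E x x (-1) (SignType.sign (-ε)) := by
    rw [hs, ← Left.sign_neg, neg_neg, neg_neg]; exact hE.1
  have hm2 : ¬ E x x (-1) (SignType.sign ε) := by
    rw [hs, ← Left.sign_neg, neg_neg]; exact hE.2
  refine ⟨fun u => (x, (u.1 : ℕ) * n + (u.2 : ℕ), ε * ((u.2 : ℕ) * n + (u.1 : ℕ))), ?_⟩
  have key : ∀ u v : Fin n × Fin n, u.1 < v.1 ∨ (u.1 = v.1 ∧ u.2 < v.2) →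
    ((arr E (x, ((u.1 : ℕ) * n + (u.2 : ℕ) : ℤ), ε * ((u.2 : ℕ) * n + (u.1 : ℕ) : ℤ))
      (x, ((v.1 : ℕ) * n + (v.2 : ℕ) : ℤ), ε * ((v.2 : ℕ) * n + (v.1 : ℕ) : ℤ))) ↔
      (compGrid n).Adj u v) := by
    rintro ⟨i, j⟩ ⟨i', j'⟩ h
    have hi := i.2
    have hj := j.2
    have hi' := i'.2
    have hj' := j'.2
    simp only [Fin.lt_def, Fin.ext_iff] at h
    have hk : SignType.sign (((i : ℕ) * n + (j : ℕ) : ℤ) - ((i' : ℕ) * n + (j' : ℕ) : ℤ)) = -1 := by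
      apply sign_neg
      rcases h with h | ⟨h1, h2⟩
      · have : ((i : ℕ) : ℤ) + 1 ≤ (i' : ℕ) := by exact_mod_cast h
        nlinarith
      · rw [h1]; omega
    simp only [arr, hk]
    have hadj : (compGrid n).Adj (i, j) (i', j') ↔ (j : ℕ) < j' ∨ ((j : ℕ) = j' ∧ (i : ℕ) < i') := by
      simp only [compGrid, SimpleGraph.fromRel_adj, ne_eq, Prod.mk.injEq, Fin.ext_iff, Fin.lt_def]
      omega
    rw [hadj]
    by_cases hc : (j : ℕ) < j' ∨ ((j : ℕ) = j' ∧ (i : ℕ) < i')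
    · have hlt : (((j : ℕ) * n + (i : ℕ) : ℤ) - ((j' : ℕ) * n + (i' : ℕ) : ℤ)) < 0 := by
        rcases hc with h | ⟨h1, h2⟩
        · have : ((j : ℕ) : ℤ) + 1 ≤ (j' : ℕ) := by exact_mod_cast h
          nlinarith
        · rw [h1]; omega
      rw [← mul_sub, sign_mul, sign_neg hlt]
      simp only [hc, iff_true]
      rw [Left.sign_neg] at hm1
      simpa using hm1
    · have hlt : 0 < (((j : ℕ) * n + (i : ℕ) : ℤ) - ((j' : ℕ) * n + (i' : ℕ) : ℤ)) := by
        have h : (j' : ℕ) < j := by omega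
        have : ((j' : ℕ) : ℤ) + 1 ≤ (j : ℕ) := by exact_mod_cast h
        nlinarith
      rw [← mul_sub, sign_mul, sign_pos hlt]
      simp only [hc, iff_false]
      simpa using hm2
  intro u v huv
  by_cases h : u.1 < v.1 ∨ (u.1 = v.1 ∧ u.2 < v.2)
  · exact key u v h
  · have h' : v.1 < u.1 ∨ (v.1 = u.1 ∧ v.2 < u.2) := by
      have : ¬ (u.1 = v.1 ∧ u.2 = v.2) := fun h => huv (Prod.ext h.1 h.2)
      simp only [Fin.lt_def, Fin.ext_iff] at *
      omega
    rw [SimpleGraph.adj_comm, ← key v u h']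
    unfold arr
    rw [hs, ← Left.sign_neg, ← Left.sign_neg, neg_sub, neg_sub]

end arr

set_option linter.deprecated false

section dbl

theorem xcongr {x y y' β : Prop} (h : x ↔ Xor' y β) (hy : y ↔ y') : x ↔ Xor' y' β := by
  rw [h, hy]

theorem xnot {x y y' β : Prop} (h : x ↔ Xor' y β) (hy : y ↔ ¬ y') : x ↔ Xor' y' (¬ β) := by
  rw [h, hy, xor_iff', xor_iff']; tauto

theorem xconst {x y β : Prop} (h : x ↔ β) (hy : ¬ y) : x ↔ Xor' y β := by
  rw [h, xor_iff']; tauto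

theorem xunconst {x y β : Prop} (h : x ↔ Xor' y β) (hy : ¬ y) : x ↔ β := by
  rw [h, xor_iff']; tauto

variable {X : Type} (A : X → X → Prop)

/-- Natural number indexed data of a flipped crossing. -/
structure RzD (Kl Kr : Kind) (N r : ℕ) (a b : ℕ → X) (p : ℕ → ℕ → ℕ → X) : Prop where
  haa : ∃ β : Prop, ∀ i i', i < N → i' < N → i ≠ i' → (A (a i) (a i') ↔ β)
  hab : ∃ β : Prop, ∀ i j, i < N → j < N → (A (a i) (b j) ↔ β)
  hbb : ∃ β : Prop, ∀ i i', i < N → i' < N → i ≠ i' → (A (b i) (b i') ↔ β)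
  hap : ∀ t < r, ∃ β : Prop, ∀ i i' j, i < N → i' < N → j < N → (A (a i) (p i' j t) ↔
      Xor' (rootAdj Kl i i' ∧ t = 0) β)
  hbp : ∀ t < r, ∃ β : Prop, ∀ j i' j', j < N → i' < N → j' < N → (A (b j) (p i' j' t) ↔
      Xor' (rootAdj Kr j j' ∧ t + 1 = r) β)
  hlt : ∀ t t', t < t' → t' < r → ∃ β : Prop, ∀ i j i' j', i < N → j < N → i' < N → j' < N →
      (A (p i j t) (p i' j' t') ↔ Xor' (i = i' ∧ j = j' ∧ t' = t + 1) β)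
  heq : ∀ t < r, ∃ β : Prop, ∀ i j i' j', i < N → j < N → i' < N → j' < N → ¬ (i = i' ∧ j = j') →
      (A (p i j t) (p i' j' t) ↔ Xor' ((Kl = Kind.clique ∧ i = i' ∧ t = 0) ∨
        (Kr = Kind.clique ∧ j = j' ∧ t + 1 = r)) β)

theorem Rz_of_RzD (hA : ∀ x y, A x y → A y x) {Kl Kr : Kind} {n r : ℕ} {a b : ℕ → X}
    {p : ℕ → ℕ → ℕ → X} (D : RzD A Kl Kr n r a b p) : Rz A Kl Kr n r := by
  refine Rz_of A hA Kl Kr n r (fun i => a i) (fun i => b i) (fun i j t => p i j t) ?_ ?_ ?_ ?_ ?_ ?_ ?_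
  · obtain ⟨β, h⟩ := D.haa
    exact ⟨β, fun i i' hi => h i i' i.2 i'.2 (fun h => hi (Fin.ext h))⟩
  · obtain ⟨β, h⟩ := D.hab
    exact ⟨β, fun i i' => h i i' i.2 i'.2⟩
  · obtain ⟨β, h⟩ := D.hbb
    exact ⟨β, fun i i' hi => h i i' i.2 i'.2 (fun h => hi (Fin.ext h))⟩
  · intro t
    obtain ⟨β, h⟩ := D.hap t t.2
    exact ⟨β, fun i i' j => h i i' j i.2 i'.2 j.2⟩
  · intro t
    obtain ⟨β, h⟩ := D.hbp t t.2
    exact ⟨β, fun i i' j => h i i' j i.2 i'.2 j.2⟩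
  · intro t t' htt
    obtain ⟨β, h⟩ := D.hlt t t' htt t'.2
    exact ⟨β, fun i j i' j' => xcongr (h i j i' j' i.2 j.2 i'.2 j'.2) (by simp only [Fin.ext_iff])⟩
  · intro t
    obtain ⟨β, h⟩ := D.heq t t.2
    refine ⟨β, fun i j i' j' hne => xcongr (h i j i' j' i.2 j.2 i'.2 j'.2 ?_) (by simp only [Fin.ext_iff])⟩
    intro h
    exact hne (Prod.ext (Fin.ext h.1) (Fin.ext h.2))

theorem RzD_of_Rz {Kl Kr : Kind} {n r : ℕ} (h : Rz A Kl Kr (n + 1) r) :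
    ∃ a b p, RzD A Kl Kr (n + 1) r a b p := by
  obtain ⟨F, f, hF, hf⟩ := h
  let x0 := f (Sum.inl 0)
  refine ⟨fun i => if h : i < n + 1 then f (Sum.inl ⟨i, h⟩) else x0,
    fun i => if h : i < n + 1 then f (Sum.inr (Sum.inr ⟨i, h⟩)) else x0,
    fun i j t => if h : i < n + 1 ∧ j < n + 1 ∧ t < r then
      f (Sum.inr (Sum.inl (⟨i, h.1⟩, ⟨j, h.2.1⟩, ⟨t, h.2.2⟩))) else x0, ?_⟩
  constructor
  · refine ⟨F 0 0, fun i i' hi hi' hne => ?_⟩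
    rw [dif_pos hi, dif_pos hi', hf _ _ (by simpa using hne), mix_aa]
    simp [layer, xor_iff']
  · refine ⟨F 0 (Fin.last _), fun i i' hi hi' => ?_⟩
    rw [dif_pos hi, dif_pos hi', hf _ _ (by simp), mix_ab]
    simp [layer, xor_iff']
  · refine ⟨F (Fin.last _) (Fin.last _), fun i i' hi hi' hne => ?_⟩
    rw [dif_pos hi, dif_pos hi', hf _ _ (by simpa using hne), mix_bb]
    simp [layer, xor_iff']
  · intro t ht
    refine ⟨F 0 (Fin.succ (⟨t, ht⟩ : Fin r)).castSucc, fun i i' j hi hi' hj => ?_⟩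
    rw [dif_pos hi, dif_pos ⟨hi', hj, ht⟩, hf _ _ (by simp), mix_ap]
    simp [layer]
  · intro t ht
    refine ⟨F (Fin.last _) (Fin.succ (⟨t, ht⟩ : Fin r)).castSucc, fun i i' j hi hi' hj => ?_⟩
    rw [dif_pos hi, dif_pos ⟨hi', hj, ht⟩, hf _ _ (by simp), mix_bp]
    simp [layer]
  · intro t t' htt ht'
    refine ⟨F (Fin.succ (⟨t, by omega⟩ : Fin r)).castSucc (Fin.succ (⟨t', ht'⟩ : Fin r)).castSucc,
      fun i j i' j' hi hj hi' hj' => ?_⟩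
    rw [dif_pos ⟨hi, hj, by omega⟩, dif_pos ⟨hi', hj', ht'⟩, hf _ _ (by simp; omega), mix_pp_lt _ _ _ _ _ _ _ _ htt]
    simp [layer]
  · intro t ht
    refine ⟨F (Fin.succ (⟨t, by omega⟩ : Fin r)).castSucc (Fin.succ (⟨t, ht⟩ : Fin r)).castSucc,
      fun i j i' j' hi hj hi' hj' hne => ?_⟩
    have hne' : ((⟨i, hi⟩ : Fin (n+1)), (⟨j, hj⟩ : Fin (n+1))) ≠ (⟨i', hi'⟩, ⟨j', hj'⟩) := by
      simp only [ne_eq, Prod.mk.injEq, Fin.mk.injEq]; exact hne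
    rw [dif_pos ⟨hi, hj, by omega⟩, dif_pos ⟨hi', hj', ht⟩, hf _ _ (by simp; omega), mix_pp_eq _ _ _ _ _ _ _ hne']
    simp [layer]

variable {A}
theorem RzD.mirror (hA : ∀ x y, A x y → A y x) {Kl Kr : Kind} {n r : ℕ} {a b : ℕ → X}
    {p : ℕ → ℕ → ℕ → X} (D : RzD A Kl Kr n r a b p) :
    RzD A Kr Kl n r b a (fun i j t => p j i (r - 1 - t)) := by
  have hA' : ∀ x y, A x y ↔ A y x := fun x y => ⟨hA x y, hA y x⟩
  constructor
  · exact D.hbb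
  · obtain ⟨β, h⟩ := D.hab
    exact ⟨β, fun i j hi hj => (hA' _ _).trans (h j i hj hi)⟩
  · exact D.haa
  · intro t ht
    obtain ⟨β, h⟩ := D.hbp (r - 1 - t) (by omega)
    exact ⟨β, fun i i' j hi hi' hj => xcongr (h i j i' hi hj hi') (and_congr_right fun _ => by omega)⟩
  · intro t ht
    obtain ⟨β, h⟩ := D.hap (r - 1 - t) (by omega)
    exact ⟨β, fun i i' j hi hi' hj => xcongr (h i j i' hi hj hi') (and_congr_right fun _ => by omega)⟩
  · intro t t' htt ht'
    obtain ⟨β, h⟩ := D.hlt (r - 1 - t') (r - 1 - t) (by omega) (by omega)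
    exact ⟨β, fun i j i' j' hi hj hi' hj' => xcongr ((hA' _ _).trans (h j' i' j i hj' hi' hj hi)) (by omega)⟩
  · intro t ht
    obtain ⟨β, h⟩ := D.heq (r - 1 - t) (by omega)
    refine ⟨β, fun i j i' j' hi hj hi' hj' hne => xcongr (h j i j' i' hj hi hj' hi' (by omega)) ?_⟩
    rw [or_comm]
    have e1 : r - 1 - t + 1 = r ↔ t = 0 := by omega
    have e2 : r - 1 - t = 0 ↔ t + 1 = r := by omega
    rw [e1, e2]

theorem code_inj {n i j i' j' : ℕ} (hj : j < n) (hj' : j' < n) :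
    i * n + j = i' * n + j' ↔ i = i' ∧ j = j' := by
  constructor
  · intro h
    have h1 : (i * n + j) % n = (i' * n + j') % n := by rw [h]
    rw [Nat.add_comm, Nat.add_mul_mod_self_right, Nat.add_comm, Nat.add_mul_mod_self_right,
      Nat.mod_eq_of_lt hj, Nat.mod_eq_of_lt hj'] at h1
    subst h1
    exact ⟨Nat.eq_of_mul_eq_mul_right (by omega) (by omega : i * n = i' * n), rfl⟩
  · rintro ⟨rfl, rfl⟩; rfl

theorem code_lt {n i j : ℕ} (hi : i < n) (hj : j < n) : i * n + j < n * n + 2 * n + 1 := by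
  nlinarith

theorem rootAdj_shift (K : Kind) (n i j : ℕ) : rootAdj K (n + i) (n + j) ↔ rootAdj K i j := by
  cases K <;> simp [rootAdj]

theorem rootAdj_low (K : Kind) {n i : ℕ} (j : ℕ) (hi : i < n) : ¬ rootAdj K (n + j) i := by
  cases K <;> simp [rootAdj] <;> omega

theorem rootAdj_high (K : Kind) {n i : ℕ} (j : ℕ) (hi : i < n) : rootAdj K i (n + j) ↔ K = Kind.half := by
  cases K <;> simp [rootAdj] <;> omega

/-- cross relations between left and right half paths -/
theorem RzD.lr (hA : ∀ x y, A x y → A y x) {Kl Kr : Kind} {n N r : ℕ} {a b : ℕ → X}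
    {p : ℕ → ℕ → ℕ → X} (D : RzD A Kl Kr N r a b p) (t t' : ℕ) (ht : t < r) (ht' : t' < r) :
    ∃ β : Prop, ∀ i k j k', i < n → n + j < N → n ≤ N → k < N → k' < N → (A (p i k t) (p (n + j) k' t') ↔
      Xor' (Kr = Kind.clique ∧ k = k' ∧ t = t' ∧ t + 1 = r) β) := by
  have hA' : ∀ x y, A x y ↔ A y x := fun x y => ⟨hA x y, hA y x⟩
  rcases lt_trichotomy t t' with h | rfl | h
  · obtain ⟨β, hβ⟩ := D.hlt t t' h ht'
    exact ⟨β, fun i k j k' hi hj hn hk hk' => xcongr (hβ i k (n + j) k' (by omega) hk hj hk') (by omega)⟩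
  · obtain ⟨β, hβ⟩ := D.heq t ht
    refine ⟨β, fun i k j k' hi hj hn hk hk' => xcongr (hβ i k (n + j) k' (by omega) hk hj hk' (by omega)) ?_⟩
    have : ¬ i = n + j := by omega
    simp [this]
  · obtain ⟨β, hβ⟩ := D.hlt t' t h ht
    exact ⟨β, fun i k j k' hi hj hn hk hk' => xcongr ((hA' _ _).trans (hβ (n + j) k' i k hj hk' (by omega) hk)) (by omega)⟩

theorem RzD.dbl_clique (hA : ∀ x y, A x y → A y x) {Kl : Kind} {n N r : ℕ} {a b : ℕ → X}
    {p : ℕ → ℕ → ℕ → X} (hN : N = n * n + 2 * n + 1) (hr : 1 ≤ r)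
    (D : RzD A Kl Kind.clique N r a b p) :
    RzD A Kl Kl n (2 * r) a (fun j => a (n + j))
      (fun i j s => if s < r then p i (i * n + j) s else p (n + j) (i * n + j) (2 * r - 1 - s)) := by
  have hA' : ∀ x y, A x y ↔ A y x := fun x y => ⟨hA x y, hA y x⟩
  have hnN : ∀ i, i < n → i < N := fun i hi => by rw [hN]; nlinarith
  have hnN' : ∀ i, i < n → n + i < N := fun i hi => by rw [hN]; nlinarith
  have hnn : n ≤ N := by rw [hN]; nlinarith
  have hcN : ∀ i j, i < n → j < n → i * n + j < N := fun i j hi hj => by rw [hN]; exact code_lt hi hj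
  constructor
  · obtain ⟨β, h⟩ := D.haa
    exact ⟨β, fun i i' hi hi' hne => h i i' (hnN i hi) (hnN _ hi') hne⟩
  · obtain ⟨β, h⟩ := D.haa
    exact ⟨β, fun i i' hi hi' => h i _ (hnN i hi) (hnN' _ hi') (by omega)⟩
  · obtain ⟨β, h⟩ := D.haa
    exact ⟨β, fun i i' hi hi' hne => h _ _ (hnN' i hi) (hnN' _ hi') (by omega)⟩
  · intro s hs
    by_cases hsr : s < r
    · obtain ⟨β, h⟩ := D.hap s hsr
      refine ⟨β, fun i i' j hi hi' hj => ?_⟩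
      rw [if_pos hsr]
      exact h i i' _ (hnN i hi) (hnN i' hi') (hcN _ _ hi' hj)
    · obtain ⟨β, h⟩ := D.hap (2 * r - 1 - s) (by omega)
      by_cases hK : Kl = Kind.half ∧ 2 * r - 1 - s = 0
      · refine ⟨¬ β, fun i i' j hi hi' hj => ?_⟩
        rw [if_neg hsr]
        refine xnot (h i (n + j) _ (hnN i hi) (hnN' _ hj) (hcN _ _ hi' hj)) ?_
        rw [rootAdj_high _ _ hi]
        have : ¬ s = 0 := by omega
        simp [hK, this]
      · refine ⟨β, fun i i' j hi hi' hj => ?_⟩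
        rw [if_neg hsr]
        refine xcongr (h i (n + j) _ (hnN i hi) (hnN' _ hj) (hcN _ _ hi' hj)) ?_
        rw [rootAdj_high _ _ hi]
        have : ¬ s = 0 := by omega
        simp only [hK, this, and_false]
  · intro s hs
    by_cases hsr : s < r
    · obtain ⟨β, h⟩ := D.hap s hsr
      refine ⟨β, fun j i' j' hj hi' hj' => ?_⟩
      rw [if_pos hsr]
      refine xcongr (h (n + j) i' _ (hnN' _ hj) (hnN i' hi') (hcN _ _ hi' hj')) ?_
      have h1 := rootAdj_low Kl j hi'
      have : ¬ s + 1 = 2 * r := by omega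
      simp only [h1, this, false_and, and_false]
    · obtain ⟨β, h⟩ := D.hap (2 * r - 1 - s) (by omega)
      refine ⟨β, fun j i' j' hj hi' hj' => ?_⟩
      rw [if_neg hsr]
      refine xcongr (h (n + j) (n + j') _ (hnN' _ hj) (hnN' _ hj') (hcN _ _ hi' hj')) ?_
      rw [rootAdj_shift]
      exact and_congr_right fun _ => by omega
  · intro s s' hss hs'
    by_cases h1 : s' < r
    · have h2 : s < r := by omega
      obtain ⟨β, h⟩ := D.hlt s s' hss h1
      refine ⟨β, fun i j i' j' hi hj hi' hj' => ?_⟩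
      rw [if_pos h1, if_pos h2]
      refine xcongr (h i _ i' _ (hnN _ hi) (hcN _ _ hi hj) (hnN _ hi') (hcN _ _ hi' hj')) ?_
      rw [code_inj hj hj']
      tauto
    · by_cases h2 : s < r
      · obtain ⟨β, h⟩ := D.lr hA (n := n) s (2 * r - 1 - s') h2 (by omega)
        refine ⟨β, fun i j i' j' hi hj hi' hj' => ?_⟩
        rw [if_pos h2, if_neg h1]
        refine xcongr (h i _ j' _ hi (hnN' _ hj') hnn (hcN _ _ hi hj) (hcN _ _ hi' hj')) ?_
        rw [code_inj hj hj']
        have : (s = 2 * r - 1 - s' ∧ s + 1 = r) ↔ s' = s + 1 := by omega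
        rw [this]
        tauto
      · obtain ⟨β, h⟩ := D.hlt (2 * r - 1 - s') (2 * r - 1 - s) (by omega) (by omega)
        refine ⟨β, fun i j i' j' hi hj hi' hj' => ?_⟩
        rw [if_neg h1, if_neg h2, hA']
        refine xcongr (h _ _ _ _ (hnN' _ hj') (hcN _ _ hi' hj') (hnN' _ hj) (hcN _ _ hi hj)) ?_
        rw [code_inj hj' hj]
        have : (2 * r - 1 - s = 2 * r - 1 - s' + 1) ↔ s' = s + 1 := by omega
        rw [this]
        have : n + j' = n + j ↔ j = j' := by omega
        rw [this]
        rw [eq_comm (a := i'), eq_comm (a := j')]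
        tauto
  · intro s hs
    by_cases hsr : s < r
    · obtain ⟨β, h⟩ := D.heq s hsr
      refine ⟨β, fun i j i' j' hi hj hi' hj' hne => ?_⟩
      rw [if_pos hsr, if_pos hsr]
      have hc : ¬ (i * n + j = i' * n + j') := fun h => hne ((code_inj hj hj').1 h)
      refine xcongr (h _ _ _ _ (hnN _ hi) (hcN _ _ hi hj) (hnN _ hi') (hcN _ _ hi' hj') (fun h => hc h.2)) ?_
      have : ¬ s + 1 = 2 * r := by omega
      simp [hc, this]
    · obtain ⟨β, h⟩ := D.heq (2 * r - 1 - s) (by omega)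
      refine ⟨β, fun i j i' j' hi hj hi' hj' hne => ?_⟩
      rw [if_neg hsr, if_neg hsr]
      have hc : ¬ (i * n + j = i' * n + j') := fun h => hne ((code_inj hj hj').1 h)
      refine xcongr (h _ _ _ _ (hnN' _ hj) (hcN _ _ hi hj) (hnN' _ hj') (hcN _ _ hi' hj') (fun h => hc h.2)) ?_
      have h3 : ¬ s = 0 := by omega
      have h4 : 2 * r - 1 - s = 0 ↔ s + 1 = 2 * r := by omega
      simp [hc, h3, h4]

theorem RzD.dbl_star (hA : ∀ x y, A x y → A y x) {Kl : Kind} {n N r : ℕ} {a b : ℕ → X}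
    {p : ℕ → ℕ → ℕ → X} (hN : N = n * n + 2 * n + 1) (hr : 1 ≤ r)
    (D : RzD A Kl Kind.star N r a b p) :
    RzD A Kl Kl n (2 * r + 1) a (fun j => a (n + j))
      (fun i j s => if s < r then p i (i * n + j) s else if s = r then b (i * n + j) else
        p (n + j) (i * n + j) (2 * r - s)) := by
  have hA' : ∀ x y, A x y ↔ A y x := fun x y => ⟨hA x y, hA y x⟩
  have hnN : ∀ i, i < n → i < N := fun i hi => by rw [hN]; nlinarith
  have hnN' : ∀ i, i < n → n + i < N := fun i hi => by rw [hN]; nlinarith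
  have hnn : n ≤ N := by rw [hN]; nlinarith
  have hcN : ∀ i j, i < n → j < n → i * n + j < N := fun i j hi hj => by rw [hN]; exact code_lt hi hj
  constructor
  · obtain ⟨β, h⟩ := D.haa
    exact ⟨β, fun i i' hi hi' hne => h i i' (hnN i hi) (hnN _ hi') hne⟩
  · obtain ⟨β, h⟩ := D.haa
    exact ⟨β, fun i i' hi hi' => h i _ (hnN i hi) (hnN' _ hi') (by omega)⟩
  · obtain ⟨β, h⟩ := D.haa
    exact ⟨β, fun i i' hi hi' hne => h _ _ (hnN' i hi) (hnN' _ hi') (by omega)⟩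
  · intro s hs
    by_cases hsr : s < r
    · obtain ⟨β, h⟩ := D.hap s hsr
      refine ⟨β, fun i i' j hi hi' hj => ?_⟩
      rw [if_pos hsr]
      exact h i i' _ (hnN i hi) (hnN i' hi') (hcN _ _ hi' hj)
    · by_cases hsr' : s = r
      · obtain ⟨β, h⟩ := D.hab
        refine ⟨β, fun i i' j hi hi' hj => ?_⟩
        rw [if_neg hsr, if_pos hsr']
        exact xconst (h i _ (hnN i hi) (hcN _ _ hi' hj)) (fun h => by omega)
      obtain ⟨β, h⟩ := D.hap (2 * r - s) (by omega)
      by_cases hK : Kl = Kind.half ∧ 2 * r - s = 0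
      · refine ⟨¬ β, fun i i' j hi hi' hj => ?_⟩
        rw [if_neg hsr, if_neg hsr']
        refine xnot (h i (n + j) _ (hnN i hi) (hnN' _ hj) (hcN _ _ hi' hj)) ?_
        rw [rootAdj_high _ _ hi]
        have : ¬ s = 0 := by omega
        simp [hK, this]
      · refine ⟨β, fun i i' j hi hi' hj => ?_⟩
        rw [if_neg hsr, if_neg hsr']
        refine xcongr (h i (n + j) _ (hnN i hi) (hnN' _ hj) (hcN _ _ hi' hj)) ?_
        rw [rootAdj_high _ _ hi]
        have : ¬ s = 0 := by omega
        simp only [hK, this, and_false]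
  · intro s hs
    by_cases hsr : s < r
    · obtain ⟨β, h⟩ := D.hap s hsr
      refine ⟨β, fun j i' j' hj hi' hj' => ?_⟩
      rw [if_pos hsr]
      refine xcongr (h (n + j) i' _ (hnN' _ hj) (hnN i' hi') (hcN _ _ hi' hj')) ?_
      have h1 := rootAdj_low Kl j hi'
      have : ¬ s + 1 = 2 * r + 1 := by omega
      simp only [h1, this, false_and, and_false]
    · by_cases hsr' : s = r
      · obtain ⟨β, h⟩ := D.hab
        refine ⟨β, fun j i' j' hj hi' hj' => ?_⟩
        rw [if_neg hsr, if_pos hsr']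
        exact xconst (h _ _ (hnN' _ hj) (hcN _ _ hi' hj')) (fun h => by omega)
      obtain ⟨β, h⟩ := D.hap (2 * r - s) (by omega)
      refine ⟨β, fun j i' j' hj hi' hj' => ?_⟩
      rw [if_neg hsr, if_neg hsr']
      refine xcongr (h (n + j) (n + j') _ (hnN' _ hj) (hnN' _ hj') (hcN _ _ hi' hj')) ?_
      rw [rootAdj_shift]
      exact and_congr_right fun _ => by omega
  · intro s s' hss hs'
    by_cases h1 : s' < r
    · have h2 : s < r := by omega
      obtain ⟨β, h⟩ := D.hlt s s' hss h1
      refine ⟨β, fun i j i' j' hi hj hi' hj' => ?_⟩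
      rw [if_pos h1, if_pos h2]
      refine xcongr (h i _ i' _ (hnN _ hi) (hcN _ _ hi hj) (hnN _ hi') (hcN _ _ hi' hj')) ?_
      rw [code_inj hj hj']
      tauto
    by_cases h1' : s' = r
    · have h2 : s < r := by omega
      obtain ⟨β, h⟩ := D.hbp s h2
      refine ⟨β, fun i j i' j' hi hj hi' hj' => ?_⟩
      rw [if_neg h1, if_pos h1', if_pos h2, hA']
      refine xcongr (h _ _ _ (hcN _ _ hi' hj') (hnN _ hi) (hcN _ _ hi hj)) ?_
      have : s + 1 = r ↔ s' = s + 1 := by omega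
      simp only [rootAdj]
      rw [code_inj hj' hj, this, eq_comm (a := i'), eq_comm (a := j'), and_assoc]
    by_cases h2 : s < r
    · obtain ⟨β, h⟩ := D.lr hA (n := n) s (2 * r - s') h2 (by omega)
      refine ⟨β, fun i j i' j' hi hj hi' hj' => ?_⟩
      rw [if_pos h2, if_neg h1, if_neg h1']
      refine xcongr (h i _ j' _ hi (hnN' _ hj') hnn (hcN _ _ hi hj) (hcN _ _ hi' hj')) ?_
      have : ¬ s' = s + 1 := by omega
      simp [this]
    by_cases h2' : s = r
    · obtain ⟨β, h⟩ := D.hbp (2 * r - s') (by omega)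
      refine ⟨β, fun i j i' j' hi hj hi' hj' => ?_⟩
      rw [if_neg h1, if_neg h1', if_neg h2, if_pos h2']
      refine xcongr (h _ _ _ (hcN _ _ hi hj) (hnN' _ hj') (hcN _ _ hi' hj')) ?_
      have : 2 * r - s' + 1 = r ↔ s' = s + 1 := by omega
      simp only [rootAdj]
      rw [code_inj hj hj', this, and_assoc]
    · obtain ⟨β, h⟩ := D.hlt (2 * r - s') (2 * r - s) (by omega) (by omega)
      refine ⟨β, fun i j i' j' hi hj hi' hj' => ?_⟩
      rw [if_neg h1, if_neg h1', if_neg h2, if_neg h2', hA']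
      refine xcongr (h _ _ _ _ (hnN' _ hj') (hcN _ _ hi' hj') (hnN' _ hj) (hcN _ _ hi hj)) ?_
      rw [code_inj hj' hj]
      have : (2 * r - s = 2 * r - s' + 1) ↔ s' = s + 1 := by omega
      rw [this]
      have : n + j' = n + j ↔ j = j' := by omega
      rw [this]
      rw [eq_comm (a := i'), eq_comm (a := j')]
      tauto
  · intro s hs
    by_cases hsr : s < r
    · obtain ⟨β, h⟩ := D.heq s hsr
      refine ⟨β, fun i j i' j' hi hj hi' hj' hne => ?_⟩
      rw [if_pos hsr, if_pos hsr]
      have hc : ¬ (i * n + j = i' * n + j') := fun h => hne ((code_inj hj hj').1 h)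
      refine xcongr (h _ _ _ _ (hnN _ hi) (hcN _ _ hi hj) (hnN _ hi') (hcN _ _ hi' hj') (fun h => hc h.2)) ?_
      have : ¬ s = 2 * r := by omega
      simp [this]
    by_cases hsr' : s = r
    · obtain ⟨β, h⟩ := D.hbb
      refine ⟨β, fun i j i' j' hi hj hi' hj' hne => ?_⟩
      rw [if_neg hsr, if_pos hsr', if_neg hsr, if_pos hsr']
      have hc : ¬ (i * n + j = i' * n + j') := fun h => hne ((code_inj hj hj').1 h)
      refine xconst (h _ _ (hcN _ _ hi hj) (hcN _ _ hi' hj') hc) ?_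
      omega
    · obtain ⟨β, h⟩ := D.heq (2 * r - s) (by omega)
      refine ⟨β, fun i j i' j' hi hj hi' hj' hne => ?_⟩
      rw [if_neg hsr, if_neg hsr', if_neg hsr, if_neg hsr']
      have hc : ¬ (i * n + j = i' * n + j') := fun h => hne ((code_inj hj hj').1 h)
      refine xcongr (h _ _ _ _ (hnN' _ hj) (hcN _ _ hi hj) (hnN' _ hj') (hcN _ _ hi' hj') (fun h => hc h.2)) ?_
      have h3 : ¬ s = 0 := by omega
      have h4 : 2 * r - s = 0 ↔ s = 2 * r := by omega
      simp [hc, h3, h4]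

/-- Both ends can be made of the same kind. -/
theorem Rz_pure (hA : ∀ x y, A x y → A y x) {Kl Kr : Kind} {r : ℕ} (hr : 1 ≤ r)
    (h : ∀ n, Rz A Kl Kr n r) : ∃ K r', 1 ≤ r' ∧ ∀ n, Rz A K K n r' := by
  have main : ∀ Kl Kr : Kind, Kr ≠ Kind.half → (∀ n, ∃ a b p, RzD A Kl Kr (n + 1) r a b p) →
      ∃ K r', 1 ≤ r' ∧ ∀ n, Rz A K K n r' := by
    intro Kl Kr hKr h
    cases Kr with
    | half => exact absurd rfl hKr
    | star =>
      refine ⟨Kl, 2 * r + 1, by omega, fun n => ?_⟩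
      obtain ⟨a, b, p, D⟩ := h (n * n + 2 * n)
      exact Rz_of_RzD A hA (D.dbl_star hA rfl hr)
    | clique =>
      refine ⟨Kl, 2 * r, by omega, fun n => ?_⟩
      obtain ⟨a, b, p, D⟩ := h (n * n + 2 * n)
      exact Rz_of_RzD A hA (D.dbl_clique hA rfl hr)
  by_cases h1 : Kr = Kind.half
  · by_cases h2 : Kl = Kind.half
    · exact ⟨Kind.half, r, hr, fun n => by have := h n; rwa [h1, h2] at this⟩
    · refine main Kr Kl h2 fun n => ?_
      obtain ⟨a, b, p, D⟩ := RzD_of_Rz A (h (n + 1))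
      exact ⟨_, _, _, D.mirror hA⟩
  · exact main Kl Kr h1 fun n => RzD_of_Rz A (h (n + 1))

end dbl

set_option linter.deprecated false

section inj

variable {X : Type} {A : X → X → Prop} {K : Kind} {N r : ℕ}

/-- Vertices avoiding the extremal indices. -/
def Mid {N r : ℕ} : CrossVert N r → Prop
  | Sum.inl i => 0 < (i : ℕ) ∧ (i : ℕ) + 1 < N
  | Sum.inr (Sum.inl (i, j, _)) => (0 < (i : ℕ) ∧ (i : ℕ) + 1 < N) ∧ (0 < (j : ℕ) ∧ (j : ℕ) + 1 < N)
  | Sum.inr (Sum.inr j) => 0 < (j : ℕ) ∧ (j : ℕ) + 1 < N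

theorem sep_prop {a b c d F F' x y : Prop} (h1 : x ↔ Xor' a F) (h2 : y ↔ Xor' b F)
    (h3 : x ↔ Xor' c F') (h4 : y ↔ Xor' d F') (ha : a) (hb : ¬ b) (hcd : c ↔ d) : False := by
  simp only [xor_iff'] at *
  tauto

theorem sep {F : Fin (r + 2) → Fin (r + 2) → Prop} {f : CrossVert N r → X}
    (hf : ∀ u v, u ≠ v → (A (f u) (f v) ↔ Xor' (mixAdj K K u v) (F (layer u) (layer v))))
    {u v : CrossVert N r} (huv : f u = f v) (w w' : CrossVert N r) (hl : layer w = layer w')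
    (hu : u ≠ w ∧ u ≠ w' ∧ v ≠ w ∧ v ≠ w')
    (h1 : mixAdj K K u w) (h2 : ¬ mixAdj K K u w') (h3 : mixAdj K K v w ↔ mixAdj K K v w') : False := by
  obtain ⟨e1, e2, e3, e4⟩ := hu
  have k1 := hf _ _ e1
  have k2 := hf _ _ e2
  have k3 := hf _ _ e3
  have k4 := hf _ _ e4
  rw [huv] at k1 k2
  rw [← hl] at k2 k4
  exact sep_prop k1 k2 k3 k4 h1 h2 h3

theorem rootAdj_refl (K : Kind) (i : ℕ) : rootAdj K i i := by cases K <;> simp [rootAdj]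
theorem rootAdj_lt (K : Kind) {i i' : ℕ} (h : i' < i) : ¬ rootAdj K i i' := by
  cases K <;> simp [rootAdj] <;> omega

theorem inj_mid {F : Fin (r + 2) → Fin (r + 2) → Prop} {f : CrossVert N r → X}
    (hr : 1 ≤ r)
    (hf : ∀ u v, u ≠ v → (A (f u) (f v) ↔ Xor' (mixAdj K K u v) (F (layer u) (layer v))))
    (u v : CrossVert N r) (hu : Mid u) (hv : Mid v) (huv : f u = f v) : u = v := by
  -- a versus a
  have caseAA : ∀ i i' : Fin N, i < i' → Mid (Sum.inl i : CrossVert N r) → Mid (Sum.inl i' : CrossVert N r) →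
      f (Sum.inl i) = f (Sum.inl i') → False := by
    intro i i' hlt h1 h2 h
    simp only [Mid] at h1 h2
    refine sep hf h (Sum.inr (Sum.inl (i, i, ⟨0, hr⟩))) (Sum.inr (Sum.inl (⟨0, by omega⟩, i, ⟨0, hr⟩))) rfl
      (by simp) ?_ ?_ ?_
    · rw [mix_ap]; exact ⟨rootAdj_refl _ _, rfl⟩
    · rw [mix_ap]; exact fun h => rootAdj_lt K h1.1 h.1
    · rw [mix_ap, mix_ap]
      exact iff_of_false (fun h => rootAdj_lt K hlt h.1) (fun h => rootAdj_lt K h2.1 h.1)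
  have caseBB : ∀ i i' : Fin N, i < i' → Mid (Sum.inr (Sum.inr i) : CrossVert N r) →
      Mid (Sum.inr (Sum.inr i') : CrossVert N r) →
      f (Sum.inr (Sum.inr i)) = f (Sum.inr (Sum.inr i')) → False := by
    intro i i' hlt h1 h2 h
    simp only [Mid] at h1 h2
    refine sep hf h (Sum.inr (Sum.inl (i, i, ⟨r - 1, by omega⟩)))
      (Sum.inr (Sum.inl (i, ⟨0, by omega⟩, ⟨r - 1, by omega⟩))) rfl
      (by simp) ?_ ?_ ?_
    · rw [mix_bp]; exact ⟨rootAdj_refl _ _, by simp; omega⟩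
    · rw [mix_bp]; exact fun h => rootAdj_lt K h1.1 h.1
    · rw [mix_bp, mix_bp]
      exact iff_of_false (fun h => rootAdj_lt K hlt h.1) (fun h => rootAdj_lt K h2.1 h.1)
  have caseAB : ∀ i j : Fin N, Mid (Sum.inl i : CrossVert N r) →
      f (Sum.inl i) = f (Sum.inr (Sum.inr j)) → False := by
    intro i j h1 h
    simp only [Mid] at h1
    refine sep hf h (Sum.inr (Sum.inl (i, i, ⟨0, hr⟩))) (Sum.inr (Sum.inl (⟨0, by omega⟩, i, ⟨0, hr⟩))) rfl
      (by simp) ?_ ?_ ?_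
    · rw [mix_ap]; exact ⟨rootAdj_refl _ _, rfl⟩
    · rw [mix_ap]; exact fun h => rootAdj_lt K h1.1 h.1
    · rw [mix_bp, mix_bp]
  have caseAP : ∀ (i i' j' : Fin N) (t : Fin r), Mid (Sum.inr (Sum.inl (i', j', t))) →
      f (Sum.inr (Sum.inl (i', j', t))) = f (Sum.inl i) → False := by
    intro i i' j' t h1 h
    simp only [Mid] at h1
    obtain ⟨⟨h1, h2⟩, ⟨h3, h4⟩⟩ := h1
    have ht := t.2
    by_cases hc : (t : ℕ) + 1 = r
    · refine sep hf h (Sum.inr (Sum.inr j')) (Sum.inr (Sum.inr ⟨N - 1, by omega⟩)) rfl (by simp) ?_ ?_ ?_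
      · rw [mixAdj_comm, mix_bp]; exact ⟨rootAdj_refl _ _, hc⟩
      · rw [mixAdj_comm, mix_bp]; exact fun h => rootAdj_lt K (by simp; omega) h.1
      · rw [mix_ab, mix_ab]
    · refine sep hf h (Sum.inr (Sum.inl (i', j', ⟨t + 1, by omega⟩)))
        (Sum.inr (Sum.inl (⟨0, by omega⟩, j', ⟨t + 1, by omega⟩))) rfl (by simp [Fin.ext_iff]) ?_ ?_ ?_
      · rw [mix_pp_lt _ _ _ _ _ _ _ _ (by simp [Fin.lt_def])]; simp
      · rw [mix_pp_lt _ _ _ _ _ _ _ _ (by simp [Fin.lt_def])]; simp [Fin.ext_iff]; omega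
      · rw [mix_ap, mix_ap]; simp
  have caseBP : ∀ (j i' j' : Fin N) (t : Fin r), Mid (Sum.inr (Sum.inl (i', j', t))) →
      f (Sum.inr (Sum.inl (i', j', t))) = f (Sum.inr (Sum.inr j)) → False := by
    intro i i' j' t h1 h
    simp only [Mid] at h1
    obtain ⟨⟨h1, h2⟩, ⟨h3, h4⟩⟩ := h1
    have ht := t.2
    by_cases hc : (t : ℕ) = 0
    · refine sep hf h (Sum.inl i') (Sum.inl ⟨N - 1, by omega⟩) rfl (by simp) ?_ ?_ ?_
      · rw [mixAdj_comm, mix_ap]; exact ⟨rootAdj_refl _ _, hc⟩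
      · rw [mixAdj_comm, mix_ap]; exact fun h => rootAdj_lt K (by simp; omega) h.1
      · rw [mixAdj_comm, mix_ab, mixAdj_comm, mix_ab]
    · refine sep hf h (Sum.inr (Sum.inl (i', j', ⟨t - 1, by omega⟩)))
        (Sum.inr (Sum.inl (⟨0, by omega⟩, j', ⟨t - 1, by omega⟩))) rfl (by simp [Fin.ext_iff]; omega) ?_ ?_ ?_
      · rw [mixAdj_comm, mix_pp_lt _ _ _ _ _ _ _ _ (by simp [Fin.lt_def]; omega)]; simp; omega
      · rw [mixAdj_comm, mix_pp_lt _ _ _ _ _ _ _ _ (by simp [Fin.lt_def]; omega)]; simp [Fin.ext_iff]; omega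
      · rw [mix_bp, mix_bp]
  have casePlt : ∀ (i j i' j' : Fin N) (t t' : Fin r), t < t' → Mid (Sum.inr (Sum.inl (i, j, t))) →
      f (Sum.inr (Sum.inl (i, j, t))) = f (Sum.inr (Sum.inl (i', j', t'))) → False := by
    intro i j i' j' t t' htt h1 h
    simp only [Mid] at h1
    rw [Fin.lt_def] at htt
    obtain ⟨⟨h1, h2⟩, ⟨h3, h4⟩⟩ := h1
    have ht := t'.2
    by_cases hc : (t : ℕ) = 0
    · refine sep hf h (Sum.inl i) (Sum.inl ⟨N - 1, by omega⟩) rfl (by simp) ?_ ?_ ?_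
      · rw [mixAdj_comm, mix_ap]; exact ⟨rootAdj_refl _ _, hc⟩
      · rw [mixAdj_comm, mix_ap]; exact fun h => rootAdj_lt K (by simp; omega) h.1
      · rw [mixAdj_comm, mix_ap, mixAdj_comm, mix_ap]
        exact iff_of_false (fun h => by omega) (fun h => by omega)
    · refine sep hf h (Sum.inr (Sum.inl (i, j, ⟨t - 1, by omega⟩)))
        (Sum.inr (Sum.inl (⟨0, by omega⟩, j, ⟨t - 1, by omega⟩))) rfl (by simp [Fin.ext_iff]; omega) ?_ ?_ ?_
      · rw [mixAdj_comm, mix_pp_lt _ _ _ _ _ _ _ _ (by simp [Fin.lt_def]; omega)]; simp; omega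
      · rw [mixAdj_comm, mix_pp_lt _ _ _ _ _ _ _ _ (by simp [Fin.lt_def]; omega)]; simp [Fin.ext_iff]; omega
      · rw [mixAdj_comm, mix_pp_lt _ _ _ _ _ _ _ _ (by simp [Fin.lt_def]; omega),
          mixAdj_comm, mix_pp_lt _ _ _ _ _ _ _ _ (by simp [Fin.lt_def]; omega)]
        exact iff_of_false (fun h => by have := h.2.2; simp at this; omega)
          (fun h => by have := h.2.2; simp at this; omega)
  -- same layer, differing second index, last layer
  have casePb : ∀ (i j i' j' : Fin N) (t : Fin r), j < j' → (t : ℕ) + 1 = r →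
      Mid (Sum.inr (Sum.inl (i', j', t))) →
      f (Sum.inr (Sum.inl (i', j', t))) = f (Sum.inr (Sum.inl (i, j, t))) → False := by
    intro i j i' j' t hjj hc h1 h
    simp only [Mid] at h1
    rw [Fin.lt_def] at hjj
    obtain ⟨⟨h1, h2⟩, ⟨h3, h4⟩⟩ := h1
    refine sep hf h (Sum.inr (Sum.inr j')) (Sum.inr (Sum.inr ⟨N - 1, by omega⟩)) rfl (by simp) ?_ ?_ ?_
    · rw [mixAdj_comm, mix_bp]; exact ⟨rootAdj_refl _ _, hc⟩
    · rw [mixAdj_comm, mix_bp]; exact fun h => rootAdj_lt K (by simp; omega) h.1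
    · rw [mixAdj_comm, mix_bp, mixAdj_comm, mix_bp]
      exact iff_of_false (fun h => rootAdj_lt K hjj h.1) (fun h => rootAdj_lt K (by simp; omega) h.1)
  have casePa : ∀ (i j i' j' : Fin N) (t : Fin r), i < i' → (t : ℕ) = 0 →
      Mid (Sum.inr (Sum.inl (i', j', t))) →
      f (Sum.inr (Sum.inl (i', j', t))) = f (Sum.inr (Sum.inl (i, j, t))) → False := by
    intro i j i' j' t hjj hc h1 h
    simp only [Mid] at h1
    rw [Fin.lt_def] at hjj
    obtain ⟨⟨h1, h2⟩, ⟨h3, h4⟩⟩ := h1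
    refine sep hf h (Sum.inl i') (Sum.inl ⟨N - 1, by omega⟩) rfl (by simp) ?_ ?_ ?_
    · rw [mixAdj_comm, mix_ap]; exact ⟨rootAdj_refl _ _, hc⟩
    · rw [mixAdj_comm, mix_ap]; exact fun h => rootAdj_lt K (by simp; omega) h.1
    · rw [mixAdj_comm, mix_ap, mixAdj_comm, mix_ap]
      exact iff_of_false (fun h => rootAdj_lt K hjj h.1) (fun h => rootAdj_lt K (by simp; omega) h.1)
  have casePP : ∀ (i j i' j' : Fin N) (t : Fin r), Mid (Sum.inr (Sum.inl (i, j, t))) →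
      Mid (Sum.inr (Sum.inl (i', j', t))) →
      f (Sum.inr (Sum.inl (i, j, t))) = f (Sum.inr (Sum.inl (i', j', t))) → i = i' ∧ j = j' := by
    intro i j i' j' t h1 h1' h
    by_contra hne
    have m1 := h1
    have m2 := h1'
    simp only [Mid] at m1 m2
    have ht := t.2
    by_cases hc : (t : ℕ) + 1 = r
    · rcases lt_trichotomy j j' with hj | hj | hj
      · exact casePb i j i' j' t hj hc h1' h.symm
      · have hi : i ≠ i' := fun h => hne ⟨h, hj⟩
        by_cases h0 : (t : ℕ) = 0
        · rcases lt_or_gt_of_ne hi with hi | hi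
          · exact casePa i j i' j' t hi h0 h1' h.symm
          · exact casePa i' j' i j t hi h0 h1 h
        · refine sep hf h (Sum.inr (Sum.inl (i, j, ⟨t - 1, by omega⟩)))
            (Sum.inr (Sum.inl (⟨0, by omega⟩, j, ⟨t - 1, by omega⟩))) rfl (by simp [Fin.ext_iff]; omega) ?_ ?_ ?_
          · rw [mixAdj_comm, mix_pp_lt _ _ _ _ _ _ _ _ (by simp [Fin.lt_def]; omega)]; simp; omega
          · rw [mixAdj_comm, mix_pp_lt _ _ _ _ _ _ _ _ (by simp [Fin.lt_def]; omega)]; simp [Fin.ext_iff]; omega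
          · rw [mixAdj_comm, mix_pp_lt _ _ _ _ _ _ _ _ (by simp [Fin.lt_def]; omega),
              mixAdj_comm, mix_pp_lt _ _ _ _ _ _ _ _ (by simp [Fin.lt_def]; omega)]
            exact iff_of_false (fun h => hi h.1) (fun h => by have := h.1; simp [Fin.ext_iff] at this; omega)
      · exact casePb i' j' i j t hj hc h1 h
    · refine sep hf h (Sum.inr (Sum.inl (i, j, ⟨t + 1, by omega⟩)))
        (Sum.inr (Sum.inl (⟨0, by omega⟩, j, ⟨t + 1, by omega⟩))) rfl (by simp [Fin.ext_iff]) ?_ ?_ ?_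
      · rw [mix_pp_lt _ _ _ _ _ _ _ _ (by simp [Fin.lt_def])]; simp
      · rw [mix_pp_lt _ _ _ _ _ _ _ _ (by simp [Fin.lt_def])]; simp [Fin.ext_iff]; omega
      · rw [mix_pp_lt _ _ _ _ _ _ _ _ (by simp [Fin.lt_def]),
          mix_pp_lt _ _ _ _ _ _ _ _ (by simp [Fin.lt_def])]
        exact iff_of_false (fun h => hne ⟨h.1.symm, h.2.1.symm⟩)
          (fun h => by have := h.1; simp [Fin.ext_iff] at this; omega)
  rcases u with i | ⟨i, j, t⟩ | j <;> rcases v with i' | ⟨i', j', t'⟩ | j'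
  · rcases lt_trichotomy i i' with h | h | h
    · exact (caseAA _ _ h hu hv huv).elim
    · rw [h]
    · exact (caseAA _ _ h hv hu huv.symm).elim
  · exact (caseAP _ _ _ _ hv huv.symm).elim
  · exact (caseAB _ _ hu huv).elim
  · exact (caseAP _ _ _ _ hu huv).elim
  · rcases lt_trichotomy t t' with h | h | h
    · exact (casePlt _ _ _ _ _ _ h hu huv).elim
    · subst h
      obtain ⟨rfl, rfl⟩ := casePP _ _ _ _ _ hu hv huv
      rfl
    · exact (casePlt _ _ _ _ _ _ h hv huv.symm).elim
  · exact (caseBP _ _ _ _ hu huv).elim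
  · exact (caseAB _ _ hv huv.symm).elim
  · exact (caseBP _ _ _ _ hv huv.symm).elim
  · rcases lt_trichotomy j j' with h | h | h
    · exact (caseBB _ _ h hu hv huv).elim
    · rw [h]
    · exact (caseBB _ _ h hv hu huv.symm).elim

/-- Pure crossings. -/
def pureCross (K : Kind) (n r : ℕ) : SimpleGraph (CrossVert n r) :=
  match K with
  | Kind.star => starCross n r
  | Kind.clique => cliqueCross n r
  | Kind.half => halfCross n r

theorem pure_adj (K : Kind) {n r : ℕ} (u v : CrossVert n r) (huv : u ≠ v) :
    (pureCross K n r).Adj u v ↔ mixAdj K K u v := by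
  cases K <;> simp only [pureCross, starCross, cliqueCross, halfCross, SimpleGraph.fromRel_adj, ne_eq, huv,
    not_false_eq_true, true_and, mixAdj]
  · rcases u with i | ⟨i, j, t⟩ | j <;> rcases v with i' | ⟨i', j', t'⟩ | j' <;> simp [mixRel, rootAdj, Fin.ext_iff]
  · rcases u with i | ⟨i, j, t⟩ | j <;> rcases v with i' | ⟨i', j', t'⟩ | j' <;> simp [mixRel, rootAdj, Fin.ext_iff]
  · rcases u with i | ⟨i, j, t⟩ | j <;> rcases v with i' | ⟨i', j', t'⟩ | j' <;> simp [mixRel, rootAdj]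

/-- Index shift. -/
def shiftV {k r : ℕ} : CrossVert k r → CrossVert (k + 2) r
  | Sum.inl i => Sum.inl ⟨i + 1, by omega⟩
  | Sum.inr (Sum.inl (i, j, t)) => Sum.inr (Sum.inl (⟨i + 1, by omega⟩, ⟨j + 1, by omega⟩, t))
  | Sum.inr (Sum.inr j) => Sum.inr (Sum.inr ⟨j + 1, by omega⟩)

theorem shiftV_mid {k r : ℕ} (u : CrossVert k r) : Mid (shiftV u) := by
  rcases u with i | ⟨i, j, t⟩ | j <;> simp [shiftV, Mid]

theorem shiftV_inj {k r : ℕ} {u v : CrossVert k r} (h : shiftV u = shiftV v) : u = v := by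
  rcases u with i | ⟨i, j, t⟩ | j <;> rcases v with i' | ⟨i', j', t'⟩ | j' <;>
    simp_all [shiftV, Fin.ext_iff]

theorem shiftV_layer {k r : ℕ} (u : CrossVert k r) : layer (shiftV u) = layer u := by
  rcases u with i | ⟨i, j, t⟩ | j <;> simp [shiftV, layer]

theorem shiftV_mix {k r : ℕ} (u v : CrossVert k r) : mixAdj K K (shiftV u) (shiftV v) ↔ mixAdj K K u v := by
  rcases u with i | ⟨i, j, t⟩ | j <;> rcases v with i' | ⟨i', j', t'⟩ | j' <;>
    cases K <;> simp [shiftV, mixAdj, mixRel, rootAdj, Fin.ext_iff]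

theorem embed_cross {n : ℕ} (G : SimpleGraph (Fin n)) {k : ℕ} (hr : 1 ≤ r)
    (h : Rz G.Adj K K (k + 2) r) :
    ∃ H : SimpleGraph (CrossVert k r), IsLayerFlip (pureCross K k r) H ∧ Nonempty (H ↪g G) := by
  obtain ⟨F, f, hF, hf⟩ := h
  have hinj : Function.Injective (fun u : CrossVert k r => f (shiftV u)) := by
    intro u v huv
    exact shiftV_inj (inj_mid hr hf _ _ (shiftV_mid u) (shiftV_mid v) huv)
  refine ⟨G.comap fun u => f (shiftV u), ⟨F, fun x y => hF x y, fun u v huv => ?_⟩,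
    ⟨⟨⟨_, hinj⟩, by intro a b; simp [SimpleGraph.comap]⟩⟩⟩
  rw [SimpleGraph.comap_adj, hf _ _ (fun h => huv (shiftV_inj h)), shiftV_mix, shiftV_layer, shiftV_layer,
    pure_adj K u v huv]

theorem embed_grid {n : ℕ} (G : SimpleGraph (Fin n)) {k : ℕ} (f : Fin (k + 1) × Fin (k + 1) → Fin n)
    (hf : ∀ u v, u ≠ v → (G.Adj (f u) (f v) ↔ (compGrid (k + 1)).Adj u v)) :
    Nonempty (compGrid k ↪g G) := by
  let s : Fin k × Fin k → Fin (k + 1) × Fin (k + 1) := fun u => (⟨u.1 + 1, by omega⟩, ⟨u.2, by omega⟩)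
  have sinj : ∀ u v, s u = s v → u = v := by
    rintro ⟨i, j⟩ ⟨i', j'⟩ h
    simpa [s, Fin.ext_iff] using h
  have sadj : ∀ u v, (compGrid (k + 1)).Adj (s u) (s v) ↔ (compGrid k).Adj u v := by
    rintro ⟨i, j⟩ ⟨i', j'⟩
    simp only [s, compGrid, SimpleGraph.fromRel_adj, ne_eq, Prod.mk.injEq, Fin.ext_iff, Fin.lt_def]
    omega
  have key : ∀ u v : Fin k × Fin k, u.1 < v.1 → f (s u) = f (s v) → False := by
    rintro ⟨i, j⟩ ⟨i', j'⟩ hlt h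
    have hlt' : (i : ℕ) < i' := hlt
    have hne : s (i, j) ≠ s (i', j') := fun h => by
      have := sinj _ _ h
      simp only [Prod.mk.injEq] at this
      rw [this.1] at hlt
      exact lt_irrefl _ hlt
    have hna : ¬ (compGrid (k + 1)).Adj (s (i, j)) (s (i', j')) := by
      rw [← hf _ _ hne, h]; exact G.irrefl
    have hj : (j' : ℕ) < j := by
      by_contra hcon
      apply hna
      rw [sadj]
      simp only [compGrid, SimpleGraph.fromRel_adj, ne_eq, Prod.mk.injEq, Fin.ext_iff, Fin.lt_def]
      omega
    let w : Fin (k + 1) × Fin (k + 1) := (⟨i, by omega⟩, ⟨j, by omega⟩)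
    have h1 : (compGrid (k + 1)).Adj w (s (i, j)) := by
      simp only [w, s, compGrid, SimpleGraph.fromRel_adj, ne_eq, Prod.mk.injEq, Fin.ext_iff, Fin.lt_def]
      omega
    have h2 : ¬ (compGrid (k + 1)).Adj w (s (i', j')) := by
      simp only [w, s, compGrid, SimpleGraph.fromRel_adj, ne_eq, Prod.mk.injEq, Fin.ext_iff, Fin.lt_def]
      omega
    have h3 : w ≠ s (i', j') := by
      simp only [w, s, ne_eq, Prod.mk.injEq, Fin.ext_iff]
      omega
    rw [← hf _ _ h1.ne, h, hf _ _ h3] at h1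
    exact h2 h1
  have finj : ∀ u v : Fin k × Fin k, f (s u) = f (s v) → u = v := by
    intro u v h
    rcases lt_trichotomy u.1 v.1 with h1 | h1 | h1
    · exact (key u v h1 h).elim
    · by_contra hne
      have hne' : s u ≠ s v := fun h => hne (sinj _ _ h)
      have : (compGrid (k + 1)).Adj (s u) (s v) := by
        rw [sadj]
        simp only [compGrid, SimpleGraph.fromRel_adj]
        exact ⟨hne, Or.inl (Or.inl h1)⟩
      rw [← hf _ _ hne', h] at this
      exact G.irrefl this
    · exact (key v u h1 h.symm).elim
  refine ⟨⟨⟨fun u => f (s u), fun u v h => finj u v h⟩, ?_⟩⟩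
  intro u v
  by_cases huv : u = v
  · subst huv; simp
  · exact (hf _ _ (fun h => huv (sinj _ _ h))).trans (sadj u v)

/-- The hard direction. -/
theorem hard_direction (C : GraphClass) (hC : TransducesAllGraphs C) :
    (∀ k, ∃ (n : ℕ) (G : SimpleGraph (Fin n)), C n G ∧ Nonempty (compGrid k ↪g G)) ∨
    ∃ (K : Kind) (r : ℕ), 1 ≤ r ∧ ∀ k, ∃ H : SimpleGraph (CrossVert k r),
      IsLayerFlip (pureCross K k r) H ∧ ∃ (n : ℕ) (G : SimpleGraph (Fin n)), C n G ∧ Nonempty (H ↪g G) := by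
  obtain ⟨P, E, hs, -, hch, hreal⟩ := master C hC
  have harr : ∀ x y, arr E x y → arr E y x := by
    intro x y hxy
    unfold arr at *
    rw [hs, ← Left.sign_neg, ← Left.sign_neg, neg_sub, neg_sub]
    exact hxy
  rcases array_lemma E hs hch with ⟨x, hx⟩ | ⟨Kl, Kr, m, hR⟩
  · left
    intro k
    obtain ⟨f, hf⟩ := grid_of_node E hs x hx (k + 1)
    obtain ⟨n, G, hG, h, hh⟩ := hreal _ f
    exact ⟨n, G, hG, embed_grid G h fun u v huv => (hh u v).trans (hf u v huv)⟩
  · right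
    obtain ⟨K, r, hr, hK⟩ := Rz_pure harr (by omega) hR
    refine ⟨K, r, hr, fun k => ?_⟩
    obtain ⟨F, f, hF, hf⟩ := hK (k + 2)
    obtain ⟨n, G, hG, h, hh⟩ := hreal _ f
    obtain ⟨H, h1, h2⟩ := embed_cross G (k := k) (K := K) hr ⟨F, h, hF, fun u v huv => (hh u v).trans (hf u v huv)⟩
    exact ⟨H, h1, n, G, hG, h2⟩

end inj

set_option linter.deprecated false
set_option linter.style.haveILetI false

section udef
open FirstOrder

/-- Uniformly definable binary relations on colored graphs. -/
def UDef (k : ℕ) (R : ∀ V : Type, SimpleGraph V → (V → Fin k) → V → V → Prop) : Prop :=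
  ∃ φ : (colLang k).Formula (Fin 2), ∀ (V : Type) (G : SimpleGraph V) (c : V → Fin k) (u v : V),
    colSat G c φ u v ↔ R V G c u v

variable {k : ℕ} {R S : ∀ V : Type, SimpleGraph V → (V → Fin k) → V → V → Prop}

theorem UDef.adj : UDef k (fun _ G _ x y => G.Adj x y) := by
  refine ⟨FirstOrder.Language.Relations.formula₂ (L := colLang k) (() : (colLang k).Relations 2)
    (Language.Term.var 0) (Language.Term.var 1), ?_⟩
  intro V G c u v
  letI := colStruct G c
  unfold colSat
  exact Language.Formula.realize_rel₂

theorem UDef.colX (i : Fin k) : UDef k (fun _ _ c x _ => c x = i) := by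
  refine ⟨FirstOrder.Language.Relations.formula₁ (L := colLang k) (i : (colLang k).Relations 1)
    (Language.Term.var 0), ?_⟩
  intro V G c u v
  letI := colStruct G c
  unfold colSat
  exact Language.Formula.realize_rel₁

theorem UDef.not (h : UDef k R) : UDef k (fun V G c x y => ¬ R V G c x y) := by
  obtain ⟨φ, hφ⟩ := h
  refine ⟨φ.not, fun V G c u v => ?_⟩
  letI := colStruct G c
  beta_reduce
  rw [← hφ]
  unfold colSat
  exact Language.Formula.realize_not

theorem UDef.and (h : UDef k R) (h' : UDef k S) : UDef k (fun V G c x y => R V G c x y ∧ S V G c x y) := by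
  obtain ⟨φ, hφ⟩ := h
  obtain ⟨ψ, hψ⟩ := h'
  refine ⟨φ ⊓ ψ, fun V G c u v => ?_⟩
  letI := colStruct G c
  beta_reduce
  rw [← hφ, ← hψ]
  unfold colSat
  exact Language.Formula.realize_inf

theorem UDef.or (h : UDef k R) (h' : UDef k S) : UDef k (fun V G c x y => R V G c x y ∨ S V G c x y) := by
  obtain ⟨φ, hφ⟩ := h
  obtain ⟨ψ, hψ⟩ := h'
  refine ⟨φ ⊔ ψ, fun V G c u v => ?_⟩
  letI := colStruct G c
  beta_reduce
  rw [← hφ, ← hψ]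
  unfold colSat
  exact Language.Formula.realize_sup

theorem UDef.conv (h : UDef k R) : UDef k (fun V G c x y => R V G c y x) := by
  obtain ⟨φ, hφ⟩ := h
  refine ⟨φ.relabel ![1, 0], fun V G c u v => ?_⟩
  letI := colStruct G c
  beta_reduce
  rw [← hφ]
  unfold colSat
  rw [Language.Formula.realize_relabel]
  have : (![u, v] ∘ ![1, 0] : Fin 2 → V) = ![v, u] := by
    funext i; fin_cases i <;> rfl
  rw [this]

theorem UDef.comp (h : UDef k R) (h' : UDef k S) :
    UDef k (fun V G c x y => ∃ z, R V G c x z ∧ S V G c z y) := by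
  obtain ⟨φ, hφ⟩ := h
  obtain ⟨ψ, hψ⟩ := h'
  refine ⟨Language.Formula.iExs Unit ((φ.relabel ![Sum.inl 0, Sum.inr ()]) ⊓
    (ψ.relabel ![Sum.inr (), Sum.inl 1])), fun V G c u v => ?_⟩
  letI := colStruct G c
  simp only [← hφ, ← hψ]
  unfold colSat
  rw [Language.Formula.realize_iExs]
  have e1 : ∀ i : Unit → V, (Sum.elim ![u, v] i ∘ ![Sum.inl 0, Sum.inr ()] : Fin 2 → V) = ![u, i ()] := by
    intro i; funext j; fin_cases j <;> rfl
  have e2 : ∀ i : Unit → V, (Sum.elim ![u, v] i ∘ ![Sum.inr (), Sum.inl 1] : Fin 2 → V) = ![i (), v] := by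
    intro i; funext j; fin_cases j <;> rfl
  simp only [Language.Formula.realize_inf, Language.Formula.realize_relabel, e1, e2]
  constructor
  · rintro ⟨i, hi⟩; exact ⟨i (), hi⟩
  · rintro ⟨z, hz⟩; exact ⟨fun _ => z, hz⟩

theorem UDef.congr (h : UDef k R) (e : ∀ V G c x y, R V G c x y ↔ S V G c x y) : UDef k S := by
  obtain ⟨φ, hφ⟩ := h
  exact ⟨φ, fun V G c u v => (hφ V G c u v).trans (e V G c u v)⟩

/-- Adjacency, possibly flipped. -/
def fAdj (g : Prop) {V : Type} (G : SimpleGraph V) (x y : V) : Prop := Xor' (G.Adj x y) g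

theorem UDef.fadj (g : Prop) : UDef k (fun _ G _ x y => fAdj g G x y) := by
  by_cases hg : g
  · exact UDef.adj.not.congr fun V G c x y => by simp [fAdj, xor_iff', hg]
  · exact UDef.adj.congr fun V G c x y => by simp [fAdj, xor_iff', hg]

/-- `y` belongs to the root `x`. -/
def Bel (g : Prop) (iR l1 l2 : Fin k) (V : Type) (G : SimpleGraph V) (c : V → Fin k) (x y : V) : Prop :=
  (fAdj g G x y ∧ (c x = iR ∧ (c y = l1 ∨ c y = l2))) ∧
    ¬ ∃ x', (∃ q, (fAdj g G x q ∧ (c q = l1 ∨ c q = l2)) ∧ ¬ fAdj g G x' q) ∧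
      (c x' = iR ∧ fAdj g G x' y)

theorem UDef.bel (g : Prop) (iR l1 l2 : Fin k) : UDef k (Bel g iR l1 l2) := by
  have hL : UDef k (fun _ _ c _ y => c y = l1 ∨ c y = l2) := ((UDef.colX l1).or (UDef.colX l2)).conv
  have hE : UDef k (fun _ G _ x y => fAdj g G x y) := UDef.fadj g
  exact (hE.and ((UDef.colX iR).and hL)).and
    ((((hE.and hL).comp hE.not.conv).comp ((UDef.colX iR).and hE)).not)

theorem bel_iff {V : Type} {G : SimpleGraph V} {c : V → Fin k} {g : Prop} {iR l1 l2 : Fin k} {K : Kind}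
    {U S : Type} (val : U → ℕ) (hval : Function.Injective val) (ρ : U → V) (π : S → V) (idx : S → U)
    (hR : ∀ x, c x = iR ↔ ∃ u, x = ρ u) (hL : ∀ y, (c y = l1 ∨ c y = l2) ↔ ∃ s, y = π s)
    (hE : ∀ u s, fAdj g G (ρ u) (π s) ↔ rootAdj K (val u) (val (idx s))) (hs : ∀ u, ∃ s, idx s = u) (x y : V) :
    Bel g iR l1 l2 V G c x y ↔ ∃ s, x = ρ (idx s) ∧ y = π s := by
  unfold Bel
  simp only [hR, hL]
  constructor
  · rintro ⟨⟨h1, ⟨u, rfl⟩, ⟨s, rfl⟩⟩, h2⟩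
    refine ⟨s, ?_, rfl⟩
    rw [hE] at h1
    by_contra hne
    apply h2
    obtain ⟨s', rfl⟩ := hs u
    have hlt : val (idx s') < val (idx s) := by
      have hv : val (idx s') ≠ val (idx s) := fun h => hne (by rw [hval h])
      cases K with
      | half => exact lt_of_le_of_ne h1 hv
      | star => exact absurd h1 hv
      | clique => exact absurd h1 hv
    refine ⟨ρ (idx s), ⟨π s', ⟨?_, s', rfl⟩, ?_⟩, ⟨idx s, rfl⟩, ?_⟩
    · rw [hE]; exact rootAdj_refl _ _
    · rw [hE]; exact rootAdj_lt K hlt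
    · rw [hE]; exact rootAdj_refl _ _
  · rintro ⟨s, rfl, rfl⟩
    refine ⟨⟨?_, ⟨_, rfl⟩, ⟨s, rfl⟩⟩, ?_⟩
    · rw [hE]; exact rootAdj_refl _ _
    · rintro ⟨x', ⟨q, ⟨h1, ⟨s', rfl⟩⟩, h2⟩, ⟨u, rfl⟩, h3⟩
      rw [hE] at h1 h2 h3
      apply h2
      cases K with
      | half => exact le_trans h3 h1
      | star => exact Eq.trans h3 h1
      | clique => exact Eq.trans h3 h1

end udef

set_option linter.deprecated false
set_option linter.unusedSimpArgs false

section easy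

/-- The bare pattern needed to encode arbitrary graphs. -/
def Pat (K : Kind) (r : ℕ) (g : ℕ → Prop) (k : ℕ) {V : Type} (G : SimpleGraph V) : Prop :=
  ∃ q : CrossVert k r → V, Function.Injective q ∧
    (∀ (i i' j : Fin k) (t : Fin r), (t : ℕ) = 0 →
      (G.Adj (q (Sum.inl i)) (q (Sum.inr (Sum.inl (i', j, t)))) ↔ Xor' (rootAdj K i i') (g 0))) ∧
    (∀ (i j i' j' : Fin k) (t t' : Fin r), (t' : ℕ) = t + 1 →
      (G.Adj (q (Sum.inr (Sum.inl (i, j, t)))) (q (Sum.inr (Sum.inl (i', j', t')))) ↔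
        Xor' (i = i' ∧ j = j') (g t'))) ∧
    (∀ (j i' j' : Fin k) (t : Fin r), (t : ℕ) + 1 = r →
      (G.Adj (q (Sum.inr (Sum.inr j))) (q (Sum.inr (Sum.inl (i', j', t)))) ↔
        Xor' (rootAdj K j j') (g r)))

/-- Restriction of indices. -/
def cvCast {k k' : ℕ} (r : ℕ) (h : k ≤ k') : CrossVert k r → CrossVert k' r
  | Sum.inl i => Sum.inl (Fin.castLE h i)
  | Sum.inr (Sum.inl (i, j, t)) => Sum.inr (Sum.inl (Fin.castLE h i, Fin.castLE h j, t))
  | Sum.inr (Sum.inr j) => Sum.inr (Sum.inr (Fin.castLE h j))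

theorem cvCast_inj {k k' : ℕ} (r : ℕ) (h : k ≤ k') : Function.Injective (cvCast r h) := by
  rintro (i | ⟨i, j, t⟩ | j) (i' | ⟨i', j', t'⟩ | j') <;> simp [cvCast]

theorem Pat.anti {K : Kind} {r : ℕ} {g : ℕ → Prop} {k k' : ℕ} (h : k ≤ k') {V : Type}
    {G : SimpleGraph V} (hp : Pat K r g k' G) : Pat K r g k G := by
  obtain ⟨q, hq, h1, h2, h3⟩ := hp
  refine ⟨q ∘ cvCast r h, hq.comp (cvCast_inj r h), ?_, ?_, ?_⟩
  · intro i i' j t ht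
    exact h1 (Fin.castLE h i) (Fin.castLE h i') (Fin.castLE h j) t ht
  · intro i j i' j' t t' ht
    refine (h2 (Fin.castLE h i) (Fin.castLE h j) (Fin.castLE h i') (Fin.castLE h j') t t' ht).trans ?_
    simp
  · intro j i' j' t ht
    exact h3 (Fin.castLE h j) (Fin.castLE h i') (Fin.castLE h j') t ht

/-- The first color of a layer. -/
def lay1 (t : ℕ) : ℕ := if t = 0 then 3 else 4 + t

/-- Colors. -/
def fc (r m : ℕ) : Fin (r + 5) := Fin.ofNat (r + 5) m

theorem fc_inj {r m m' : ℕ} (h : m < r + 5) (h' : m' < r + 5) : fc r m = fc r m' ↔ m = m' := by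
  simp [fc, Fin.ext_iff, Nat.mod_eq_of_lt h, Nat.mod_eq_of_lt h']

/-- Chains starting from a root. -/
def Ch (r : ℕ) (g : ℕ → Prop) (χ : Fin (r + 5)) :
    ℕ → ∀ V : Type, SimpleGraph V → (V → Fin (r + 5)) → V → V → Prop
  | 0 => fun V G c x y => Bel (g 0) (fc r 1) (fc r 3) (fc r 4) V G c x y ∧ c y = χ
  | t + 1 => fun V G c x y => ∃ z, Ch r g χ t V G c x z ∧ (fAdj (g (t + 1)) G z y ∧ c y = fc r (4 + (t + 1)))

/-- Connection of an `a`-root to a `b`-root. -/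
def Conn (r : ℕ) (g : ℕ → Prop) (χ : Fin (r + 5)) (V : Type) (G : SimpleGraph V) (c : V → Fin (r + 5))
    (x z : V) : Prop :=
  ∃ p, Ch r g χ (r - 1) V G c x p ∧ Bel (g r) (fc r 2) (fc r (lay1 (r - 1))) (fc r (4 + (r - 1))) V G c z p

theorem UDef.ch (r : ℕ) (g : ℕ → Prop) (χ : Fin (r + 5)) (t : ℕ) : UDef (r + 5) (Ch r g χ t) := by
  induction t with
  | zero => exact (UDef.bel _ _ _ _).and (UDef.colX χ).conv
  | succ t ih => exact ih.comp ((UDef.fadj _).and (UDef.colX _).conv)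

theorem UDef.conn (r : ℕ) (g : ℕ → Prop) (χ : Fin (r + 5)) : UDef (r + 5) (Conn r g χ) :=
  (UDef.ch r g χ (r - 1)).comp (UDef.bel _ _ _ _).conv

/-- The encoding formula. -/
theorem UDef.psi (r : ℕ) (g : ℕ → Prop) : UDef (r + 5) (fun V G c x y =>
    ∃ z, Conn r g (fc r 4) V G c x z ∧ Conn r g (fc r 3) V G c y z) :=
  (UDef.conn r g _).comp (UDef.conn r g _).conv

open Classical in
/-- Colors of the crossing vertices. -/
noncomputable def colN {n : ℕ} (r : ℕ) (H : SimpleGraph (Fin n)) : CrossVert n r → ℕ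
  | Sum.inl _ => 1
  | Sum.inr (Sum.inl (u, v, t)) =>
      if u = v then 4 + (t : ℕ) else if H.Adj u v then lay1 t else 0
  | Sum.inr (Sum.inr _) => 2

theorem colN_lt {n r : ℕ} (H : SimpleGraph (Fin n)) (w : CrossVert n r) : colN r H w < r + 5 := by
  classical
  rcases w with i | ⟨i, j, t⟩ | j
  · simp [colN]
  · have := t.2
    simp only [colN, lay1]
    split_ifs <;> omega
  · simp [colN]

open Classical in
/-- Coloring of the big graph. -/
noncomputable def colBig {n : ℕ} (r : ℕ) (H : SimpleGraph (Fin n)) {V : Type} (q : CrossVert n r → V) (x : V) :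
    Fin (r + 5) :=
  if h : ∃ w, q w = x then fc r (colN r H h.choose) else fc r 0

theorem colBig_q {n r : ℕ} (H : SimpleGraph (Fin n)) {V : Type} {q : CrossVert n r → V}
    (hq : Function.Injective q) (w : CrossVert n r) : colBig r H q (q w) = fc r (colN r H w) := by
  have h : ∃ w', q w' = q w := ⟨w, rfl⟩
  unfold colBig
  rw [dif_pos h, hq h.choose_spec]

theorem colBig_iff {n r : ℕ} (H : SimpleGraph (Fin n)) {V : Type} {q : CrossVert n r → V}
    (hq : Function.Injective q) (x : V) (m : ℕ) (hm : m < r + 5) (h0 : m ≠ 0) :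
    colBig r H q x = fc r m ↔ ∃ w, x = q w ∧ colN r H w = m := by
  constructor
  · intro h
    by_cases hx : ∃ w, q w = x
    · obtain ⟨w, rfl⟩ := hx
      rw [colBig_q H hq, fc_inj (colN_lt H w) hm] at h
      exact ⟨w, rfl, h⟩
    · unfold colBig at h
      rw [dif_neg hx, fc_inj (by omega) hm] at h
      omega
  · rintro ⟨w, rfl, h⟩
    rw [colBig_q H hq, h]

theorem colBig_a {n r : ℕ} (H : SimpleGraph (Fin n)) {V : Type} {q : CrossVert n r → V}
    (hq : Function.Injective q) (x : V) :
    colBig r H q x = fc r 1 ↔ ∃ u, x = q (Sum.inl u) := by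
  classical
  rw [colBig_iff H hq x 1 (by omega) (by omega)]
  constructor
  · rintro ⟨i | ⟨i, j, t⟩ | j, rfl, h⟩
    · exact ⟨i, rfl⟩
    · simp only [colN, lay1] at h
      split_ifs at h <;> omega
    · simp [colN] at h
  · rintro ⟨u, rfl⟩
    exact ⟨_, rfl, rfl⟩

theorem colBig_b {n r : ℕ} (H : SimpleGraph (Fin n)) {V : Type} {q : CrossVert n r → V}
    (hq : Function.Injective q) (x : V) :
    colBig r H q x = fc r 2 ↔ ∃ u, x = q (Sum.inr (Sum.inr u)) := by
  classical
  rw [colBig_iff H hq x 2 (by omega) (by omega)]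
  constructor
  · rintro ⟨i | ⟨i, j, t⟩ | j, rfl, h⟩
    · simp [colN] at h
    · simp only [colN, lay1] at h
      split_ifs at h <;> omega
    · exact ⟨j, rfl⟩
  · rintro ⟨u, rfl⟩
    exact ⟨_, rfl, rfl⟩

theorem colBig_edge {n r : ℕ} (H : SimpleGraph (Fin n)) {V : Type} {q : CrossVert n r → V}
    (hq : Function.Injective q) (x : V) (t : Fin r) (ht : (t : ℕ) = 0) :
    colBig r H q x = fc r 3 ↔ ∃ u v, H.Adj u v ∧ x = q (Sum.inr (Sum.inl (u, v, t))) := by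
  classical
  rw [colBig_iff H hq x 3 (by omega) (by omega)]
  constructor
  · rintro ⟨i | ⟨i, j, t'⟩ | j, rfl, h⟩
    · simp [colN] at h
    · simp only [colN, lay1] at h
      split_ifs at h with h1 h2 h3 <;> try omega
      have : t' = t := Fin.ext (by omega)
      subst this
      exact ⟨i, j, h2, rfl⟩
    · simp [colN] at h
  · rintro ⟨u, v, huv, rfl⟩
    exact ⟨_, rfl, by simp [colN, lay1, huv.ne, huv, ht]⟩

theorem colBig_id {n r : ℕ} (H : SimpleGraph (Fin n)) {V : Type} {q : CrossVert n r → V}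
    (hq : Function.Injective q) (x : V) (t : Fin r) (ht : (t : ℕ) = 0) :
    colBig r H q x = fc r 4 ↔ ∃ u v, u = v ∧ x = q (Sum.inr (Sum.inl (u, v, t))) := by
  classical
  rw [colBig_iff H hq x 4 (by omega) (by omega)]
  constructor
  · rintro ⟨i | ⟨i, j, t'⟩ | j, rfl, h⟩
    · simp [colN] at h
    · simp only [colN, lay1] at h
      split_ifs at h with h1 h2 h3 <;> try omega
      have : t' = t := Fin.ext (by omega)
      subst this
      exact ⟨i, j, h1, rfl⟩
    · simp [colN] at h
  · rintro ⟨u, v, rfl, rfl⟩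
    exact ⟨_, rfl, by simp [colN, ht]⟩

/-- Selected paths. -/
def Selp {n : ℕ} (H : SimpleGraph (Fin n)) : Type := {s : Fin n × Fin n // s.1 = s.2 ∨ H.Adj s.1 s.2}

theorem colBig_pos {n r : ℕ} (H : SimpleGraph (Fin n)) {V : Type} {q : CrossVert n r → V}
    (hq : Function.Injective q) (x : V) (t : Fin r) (ht : (t : ℕ) ≠ 0) :
    colBig r H q x = fc r (4 + t) ↔ ∃ s : Selp H, x = q (Sum.inr (Sum.inl (s.1.1, s.1.2, t))) := by
  classical
  have := t.2
  rw [colBig_iff H hq x (4 + t) (by omega) (by omega)]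
  constructor
  · rintro ⟨i | ⟨i, j, t'⟩ | j, rfl, h⟩
    · simp only [colN] at h; omega
    · simp only [colN, lay1] at h
      split_ifs at h with h1 h2 h3 <;> try omega
      · have : t' = t := Fin.ext (by omega)
        subst this
        exact ⟨⟨(i, j), Or.inl h1⟩, rfl⟩
      · have : t' = t := Fin.ext (by omega)
        subst this
        exact ⟨⟨(i, j), Or.inr h2⟩, rfl⟩
    · simp only [colN] at h; omega
  · rintro ⟨⟨⟨u, v⟩, huv⟩, rfl⟩
    refine ⟨_, rfl, ?_⟩
    simp only [colN, lay1]
    split_ifs with h1 h2 <;> first | rfl | (exfalso; tauto)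

theorem colBig_layer {n r : ℕ} (H : SimpleGraph (Fin n)) {V : Type} {q : CrossVert n r → V}
    (hq : Function.Injective q) (x : V) (t : Fin r) :
    (colBig r H q x = fc r (lay1 t) ∨ colBig r H q x = fc r (4 + t)) ↔
      ∃ s : Selp H, x = q (Sum.inr (Sum.inl (s.1.1, s.1.2, t))) := by
  by_cases ht : (t : ℕ) = 0
  · have h1 : lay1 t = 3 := by simp [lay1, ht]
    have h2 : 4 + (t : ℕ) = 4 := by omega
    rw [h1, h2, colBig_edge H hq x t ht, colBig_id H hq x t ht]
    constructor
    · rintro (⟨u, v, h, rfl⟩ | ⟨u, v, h, rfl⟩)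
      · exact ⟨⟨(u, v), Or.inr h⟩, rfl⟩
      · exact ⟨⟨(u, v), Or.inl h⟩, rfl⟩
    · rintro ⟨⟨⟨u, v⟩, h | h⟩, rfl⟩
      · exact Or.inr ⟨u, v, h, rfl⟩
      · exact Or.inl ⟨u, v, h, rfl⟩
  · have h1 : lay1 t = 4 + t := by simp [lay1, ht]
    rw [h1, or_self, colBig_pos H hq x t ht]

theorem fAdj_of {V : Type} {G : SimpleGraph V} {x y : V} {P g : Prop} (h : G.Adj x y ↔ Xor' P g) :
    fAdj g G x y ↔ P := by
  unfold fAdj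
  rw [h, xor_iff', xor_iff']
  tauto

section sem
variable {n r : ℕ} {H : SimpleGraph (Fin n)} {V : Type} {G : SimpleGraph V} {g : ℕ → Prop} {K : Kind}
  {q : CrossVert n r → V} (hq : Function.Injective q)
  (h1 : ∀ (i i' j : Fin n) (t : Fin r), (t : ℕ) = 0 →
      (G.Adj (q (Sum.inl i)) (q (Sum.inr (Sum.inl (i', j, t)))) ↔ Xor' (rootAdj K i i') (g 0)))
  (h2 : ∀ (i j i' j' : Fin n) (t t' : Fin r), (t' : ℕ) = t + 1 →
      (G.Adj (q (Sum.inr (Sum.inl (i, j, t)))) (q (Sum.inr (Sum.inl (i', j', t')))) ↔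
        Xor' (i = i' ∧ j = j') (g t')))
  (h3 : ∀ (j i' j' : Fin n) (t : Fin r), (t : ℕ) + 1 = r →
      (G.Adj (q (Sum.inr (Sum.inr j))) (q (Sum.inr (Sum.inl (i', j', t)))) ↔
        Xor' (rootAdj K j j') (g r)))

include hq h1 in
theorem bel_a_iff (hr : 0 < r) (x y : V) :
    Bel (g 0) (fc r 1) (fc r 3) (fc r 4) V G (colBig r H q) x y ↔
      ∃ s : Selp H, x = q (Sum.inl s.1.1) ∧ y = q (Sum.inr (Sum.inl (s.1.1, s.1.2, ⟨0, hr⟩))) := by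
  refine bel_iff (K := K) (U := Fin n) (S := Selp H) (fun u => (u : ℕ)) Fin.val_injective (fun u => q (Sum.inl u))
    (fun s => q (Sum.inr (Sum.inl (s.1.1, s.1.2, ⟨0, hr⟩)))) (fun s => s.1.1) ?_ ?_ ?_ ?_ x y
  · exact colBig_a H hq
  · intro y
    exact colBig_layer H hq y ⟨0, hr⟩
  · intro u s
    exact fAdj_of (h1 _ _ _ _ rfl)
  · intro u
    exact ⟨⟨(u, u), Or.inl rfl⟩, rfl⟩

include hq h3 in
theorem bel_b_iff (hr : 0 < r) (x y : V) :
    Bel (g r) (fc r 2) (fc r (lay1 (r - 1))) (fc r (4 + (r - 1))) V G (colBig r H q) x y ↔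
      ∃ s : Selp H, x = q (Sum.inr (Sum.inr s.1.2)) ∧
        y = q (Sum.inr (Sum.inl (s.1.1, s.1.2, ⟨r - 1, by omega⟩))) := by
  refine bel_iff (K := K) (U := Fin n) (S := Selp H) (fun u => (u : ℕ)) Fin.val_injective
    (fun u => q (Sum.inr (Sum.inr u)))
    (fun s => q (Sum.inr (Sum.inl (s.1.1, s.1.2, ⟨r - 1, by omega⟩)))) (fun s => s.1.2) ?_ ?_ ?_ ?_ x y
  · exact colBig_b H hq
  · intro y
    exact colBig_layer H hq y ⟨r - 1, by omega⟩
  · intro u s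
    exact fAdj_of (h3 _ _ _ _ (by simp; omega))
  · intro u
    exact ⟨⟨(u, u), Or.inl rfl⟩, rfl⟩

include hq h1 h2 in
theorem ch_iff (hr : 0 < r) (χ : Fin (r + 5)) (sel : Fin n → Fin n → Prop)
    (hsel : ∀ u v, sel u v → u = v ∨ H.Adj u v)
    (hχ : ∀ y, colBig r H q y = χ ↔ ∃ u v, sel u v ∧ y = q (Sum.inr (Sum.inl (u, v, ⟨0, hr⟩))))
    (t : ℕ) (ht : t < r) (u : Fin n) (y : V) :
    Ch r g χ t V G (colBig r H q) (q (Sum.inl u)) y ↔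
      ∃ v, sel u v ∧ y = q (Sum.inr (Sum.inl (u, v, ⟨t, ht⟩))) := by
  induction t generalizing y with
  | zero =>
    simp only [Ch]
    rw [bel_a_iff hq h1 hr, hχ]
    constructor
    · rintro ⟨⟨s, hs1, rfl⟩, u', v', hs, he⟩
      have e1 := hq hs1
      have e2 := hq he
      simp only [Sum.inl.injEq, Sum.inr.injEq, Prod.mk.injEq, and_true] at e1 e2
      refine ⟨v', ?_, ?_⟩
      · rw [e1, e2.1]; exact hs
      · rw [he, e1, e2.1]
    · rintro ⟨v, hs, rfl⟩
      exact ⟨⟨⟨(u, v), hsel _ _ hs⟩, rfl, rfl⟩, u, v, hs, rfl⟩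
  | succ t ih =>
    simp only [Ch]
    have hp := colBig_pos H hq y ⟨t + 1, ht⟩ (by simp)
    simp only [] at hp
    rw [hp]
    constructor
    · rintro ⟨z, hz, ha, s, rfl⟩
      obtain ⟨v, hv, rfl⟩ := (ih (by omega) z).1 hz
      obtain ⟨e1, e2⟩ := (fAdj_of (h2 _ _ _ _ ⟨t, by omega⟩ ⟨t + 1, ht⟩ rfl)).1 ha
      exact ⟨v, hv, by rw [← e1, ← e2]⟩
    · rintro ⟨v, hv, rfl⟩
      refine ⟨_, (ih (by omega) _).2 ⟨v, hv, rfl⟩, ?_, ⟨(u, v), hsel _ _ hv⟩, rfl⟩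
      exact (fAdj_of (h2 _ _ _ _ ⟨t, by omega⟩ ⟨t + 1, ht⟩ rfl)).2 ⟨rfl, rfl⟩

include hq h1 h2 h3 in
theorem conn_iff (hr : 0 < r) (χ : Fin (r + 5)) (sel : Fin n → Fin n → Prop)
    (hsel : ∀ u v, sel u v → u = v ∨ H.Adj u v)
    (hχ : ∀ y, colBig r H q y = χ ↔ ∃ u v, sel u v ∧ y = q (Sum.inr (Sum.inl (u, v, ⟨0, hr⟩))))
    (u : Fin n) (z : V) :
    Conn r g χ V G (colBig r H q) (q (Sum.inl u)) z ↔ ∃ v, sel u v ∧ z = q (Sum.inr (Sum.inr v)) := by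
  unfold Conn
  simp only [ch_iff hq h1 h2 hr χ sel hsel hχ (r - 1) (by omega) u, bel_b_iff hq h3 hr]
  constructor
  · rintro ⟨p, ⟨v, hv, rfl⟩, s, rfl, he⟩
    have e := hq he
    simp only [Sum.inl.injEq, Sum.inr.injEq, Prod.mk.injEq, and_true] at e
    exact ⟨v, hv, by rw [e.2]⟩
  · rintro ⟨v, hv, rfl⟩
    exact ⟨_, ⟨v, hv, rfl⟩, ⟨(u, v), hsel _ _ hv⟩, rfl, rfl⟩

include hq h1 h2 h3 in
theorem psi_iff (hr : 0 < r) (u v : Fin n) :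
    (∃ z, Conn r g (fc r 4) V G (colBig r H q) (q (Sum.inl u)) z ∧
      Conn r g (fc r 3) V G (colBig r H q) (q (Sum.inl v)) z) ↔ H.Adj v u := by
  simp only [conn_iff hq h1 h2 h3 hr (fc r 4) (fun u v => u = v) (fun _ _ h => Or.inl h)
      (fun y => colBig_id H hq y _ rfl),
    conn_iff hq h1 h2 h3 hr (fc r 3) (fun u v => H.Adj u v) (fun _ _ h => Or.inr h)
      (fun y => colBig_edge H hq y _ rfl)]
  constructor
  · rintro ⟨z, ⟨w, rfl, rfl⟩, w', h, he⟩
    have e := hq he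
    simp only [Sum.inr.injEq] at e
    rw [e]; exact h
  · intro h
    exact ⟨_, ⟨u, rfl, rfl⟩, u, h, rfl⟩

end sem

theorem transduces_of_pat (C : GraphClass) (K : Kind) (r : ℕ) (hr : 0 < r) (g : ℕ → Prop)
    (h : ∀ k, ∃ (n : ℕ) (G : SimpleGraph (Fin n)), C n G ∧ Pat K r g k G) : TransducesAllGraphs C := by
  obtain ⟨φ, hφ⟩ := UDef.psi r g
  refine ⟨r + 5, φ, fun n H => ?_⟩
  obtain ⟨N, G, hG, q, hq, h1, h2, h3⟩ := h n
  refine ⟨N, G, hG, colBig r H q, fun u => q (Sum.inl u), fun u v huv => Sum.inl_injective (hq huv), ?_⟩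
  intro u v
  simp only [hφ, psi_iff hq h1 h2 h3 hr]
  constructor
  · intro h
    exact ⟨fun he => h.ne (Sum.inl_injective (hq he)), Or.inr h⟩
  · rintro ⟨-, h | h⟩
    · exact h.symm
    · exact h

/-- Flip bits between consecutive layers. -/
def bits {r : ℕ} (F : Fin (r + 2) → Fin (r + 2) → Prop) (s : ℕ) : Prop :=
  F (Fin.ofNat (r + 2) s) (Fin.ofNat (r + 2) (s + 1))

theorem pat_of_cross {K : Kind} {k r : ℕ} {H : SimpleGraph (CrossVert k r)} {V : Type} {G : SimpleGraph V}
    (hH : IsLayerFlip (pureCross K k r) H) (e : Nonempty (H ↪g G)) :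
    ∃ F : Fin (r + 2) → Fin (r + 2) → Prop, Pat K r (bits F) k G := by
  obtain ⟨F, hF, hH⟩ := hH
  obtain ⟨e⟩ := e
  have key : ∀ u v : CrossVert k r, u ≠ v → (G.Adj (e u) (e v) ↔ Xor' (mixAdj K K u v) (F (layer u) (layer v))) := by
    intro u v huv
    rw [e.map_adj_iff, hH u v huv, pure_adj K u v huv]
  refine ⟨F, e, e.injective, ?_, ?_, ?_⟩
  · intro i i' j t ht
    rw [key _ _ (by simp), mix_ap]
    have : bits F 0 = F (layer (Sum.inl i : CrossVert k r)) (layer (Sum.inr (Sum.inl (i', j, t)) : CrossVert k r)) := by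
      unfold bits layer
      congr 1
      ext; simp [ht]
    rw [this]
    simp [ht]
  · intro i j i' j' t t' ht
    have hlt : t < t' := Fin.lt_def.2 (by omega)
    rw [key _ _ (by simp [hlt.ne]), mix_pp_lt _ _ _ _ _ _ _ _ hlt]
    have : bits F t' = F (layer (Sum.inr (Sum.inl (i, j, t)) : CrossVert k r)) (layer (Sum.inr (Sum.inl (i', j', t')) : CrossVert k r)) := by
      have := t'.2
      unfold bits layer
      congr 1
      · congr 1
        ext; simp [ht]
      · ext; simp
    rw [this]
    simp [ht]
  · intro j i' j' t ht
    rw [key _ _ (by simp), mix_bp]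
    have : bits F r = F (layer (Sum.inr (Sum.inr j) : CrossVert k r)) (layer (Sum.inr (Sum.inl (i', j', t)) : CrossVert k r)) := by
      have e1 : bits F r = F (layer (Sum.inr (Sum.inl (i', j', t)) : CrossVert k r)) (layer (Sum.inr (Sum.inr j) : CrossVert k r)) := by
        unfold bits layer
        congr 1
        · congr 1
          ext; simp [ht]
        · ext; simp
      rw [e1]
      exact propext ⟨fun h => hF h, fun h => hF h⟩
    rw [this]
    simp [ht]

/-- Position of crossing vertices in the grid. -/
def gridPos (k : ℕ) : CrossVert k 1 → Fin (k + 1) × Fin (k + 1)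
  | Sum.inl i => (⟨k - 1 - i, by omega⟩, ⟨k, by omega⟩)
  | Sum.inr (Sum.inl (i, j, _)) => (⟨k - 1 - i, by omega⟩, ⟨k - 1 - j, by omega⟩)
  | Sum.inr (Sum.inr j) => (⟨k, by omega⟩, ⟨k - 1 - j, by omega⟩)

theorem pat_of_grid {k : ℕ} {V : Type} {G : SimpleGraph V} (e : Nonempty (compGrid (k + 1) ↪g G)) :
    Pat Kind.half 1 (fun _ => False) k G := by
  obtain ⟨e⟩ := e
  refine ⟨fun w => e (gridPos k w), e.injective.comp ?_, ?_, ?_, ?_⟩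
  · rintro (i | ⟨i, j, t⟩ | j) (i' | ⟨i', j', t'⟩ | j') <;>
      simp only [gridPos, Prod.mk.injEq, Fin.mk.injEq, Sum.inl.injEq, Sum.inr.injEq, Fin.ext_iff,
        reduceCtorEq, imp_false, not_and] <;> omega
  · intro i i' j t ht
    rw [e.map_adj_iff]
    simp only [gridPos, compGrid, SimpleGraph.fromRel_adj, ne_eq, Prod.mk.injEq, Fin.ext_iff, Fin.lt_def,
      rootAdj, xor_iff', not_false_eq_true, not_true_eq_false, iff_false, iff_true]
    have := i.2
    have := i'.2
    have := j.2
    omega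
  · intro i j i' j' t t' ht
    omega
  · intro i i' j t ht
    rw [e.map_adj_iff]
    simp only [gridPos, compGrid, SimpleGraph.fromRel_adj, ne_eq, Prod.mk.injEq, Fin.ext_iff, Fin.lt_def,
      rootAdj, xor_iff', not_false_eq_true, not_true_eq_false, iff_false, iff_true]
    have := i.2
    have := i'.2
    have := j.2
    omega

theorem easy_direction (C : GraphClass) (r : ℕ) (hr : 1 ≤ r)
    (h : ∀ k, (∃ K, ∃ H : SimpleGraph (CrossVert k r), IsLayerFlip (pureCross K k r) H ∧
        ∃ (n : ℕ) (G : SimpleGraph (Fin n)), C n G ∧ Nonempty (H ↪g G)) ∨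
      ∃ (n : ℕ) (G : SimpleGraph (Fin n)), C n G ∧ Nonempty (compGrid k ↪g G)) :
    TransducesAllGraphs C := by
  by_contra hC
  have hfin : Finite Kind := by
    refine Finite.of_injective (fun K : Kind => (match K with
      | Kind.star => (0 : Fin 3) | Kind.clique => 1 | Kind.half => 2)) ?_
    intro a b
    cases a <;> cases b <;> simp
  have h1 : ∀ x : Kind × (Fin (r + 2) → Fin (r + 2) → Prop), ∃ k, ∀ (n : ℕ) (G : SimpleGraph (Fin n)),
      C n G → ¬ Pat x.1 r (bits x.2) k G := by
    intro x
    by_contra hx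
    push Not at hx
    exact hC (transduces_of_pat C x.1 r hr _ fun k => by
      obtain ⟨n, G, a, b⟩ := hx k; exact ⟨n, G, a, b⟩)
  have h2 : ∃ k, ∀ (n : ℕ) (G : SimpleGraph (Fin n)), C n G → ¬ Pat Kind.half 1 (fun _ => False) k G := by
    by_contra hx
    push Not at hx
    exact hC (transduces_of_pat C Kind.half 1 (by omega) _ fun k => by
      obtain ⟨n, G, a, b⟩ := hx k; exact ⟨n, G, a, b⟩)
  choose f hf using h1
  obtain ⟨k0, hk0⟩ := h2
  obtain ⟨M, hM⟩ := (Set.finite_range f).bddAbove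
  rcases h (M + k0 + 1) with ⟨K, H, hH, n, G, hG, e⟩ | ⟨n, G, hG, e⟩
  · obtain ⟨F, hF⟩ := pat_of_cross hH e
    have : f (K, F) ≤ M := hM ⟨_, rfl⟩
    exact hf (K, F) n G hG (hF.anti (by omega))
  · exact hk0 n G hG ((pat_of_grid e).anti (by omega))

end easy

/-- A class of finite graphs `C` is monadically dependent if and only if for
every `r ≥ 1` there exists `k ∈ ℕ` such that `C` excludes as induced subgraphs all flipped star
`r`-crossings of order `k`, all flipped clique `r`-crossings of order `k`, all flipped
half-graph `r`-crossings of order `k`, and the comparability grid of order `k`. -/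
theorem monadicallyDependent_iff_excluded_crossings (C : GraphClass) :
    MonadicallyDependent C ↔
      ∀ r : ℕ, 1 ≤ r → ∃ k : ℕ,
        (∀ H : SimpleGraph (CrossVert k r), IsLayerFlip (starCross k r) H →
          ∀ (n : ℕ) (G : SimpleGraph (Fin n)), C n G → IsEmpty (H ↪g G)) ∧
        (∀ H : SimpleGraph (CrossVert k r), IsLayerFlip (cliqueCross k r) H →
          ∀ (n : ℕ) (G : SimpleGraph (Fin n)), C n G → IsEmpty (H ↪g G)) ∧
        (∀ H : SimpleGraph (CrossVert k r), IsLayerFlip (halfCross k r) H →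
          ∀ (n : ℕ) (G : SimpleGraph (Fin n)), C n G → IsEmpty (H ↪g G)) ∧
        (∀ (n : ℕ) (G : SimpleGraph (Fin n)), C n G → IsEmpty (compGrid k ↪g G)) := by
  constructor
  · intro hd r hr
    by_contra hk
    apply hd
    refine easy_direction C r hr fun k => ?_
    by_contra hcon
    apply hk
    refine ⟨k, ?_, ?_, ?_, ?_⟩
    · intro H hH n G hG
      by_contra he
      exact hcon (Or.inl ⟨Kind.star, H, hH, n, G, hG, not_isEmpty_iff.1 he⟩)
    · intro H hH n G hG
      by_contra he
      exact hcon (Or.inl ⟨Kind.clique, H, hH, n, G, hG, not_isEmpty_iff.1 he⟩)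
    · intro H hH n G hG
      by_contra he
      exact hcon (Or.inl ⟨Kind.half, H, hH, n, G, hG, not_isEmpty_iff.1 he⟩)
    · intro n G hG
      by_contra he
      exact hcon (Or.inr ⟨n, G, hG, not_isEmpty_iff.1 he⟩)
  · intro h hC
    rcases hard_direction C hC with hg | ⟨K, r, hr, hK⟩
    · obtain ⟨k, -, -, -, hk⟩ := h 1 le_rfl
      obtain ⟨n, G, hG, he⟩ := hg k
      exact not_isEmpty_iff.2 he (hk n G hG)
    · obtain ⟨k, h1, h2, h3, -⟩ := h r hr
      obtain ⟨H, hH, n, G, hG, he⟩ := hK k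
      cases K with
      | star => exact not_isEmpty_iff.2 he (h1 H hH n G hG)
      | clique => exact not_isEmpty_iff.2 he (h2 H hH n G hG)
      | half => exact not_isEmpty_iff.2 he (h3 H hH n G hG)
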